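/- Let A be a packing bound function, let 1 ≤ n ≤ d, and let C ⊆ ℝ^d be an (H_n, n)-rectifiable set whose closure C̄ satisfies M_n(C) = H_n(C̄) < ∞, where M_n denotes n-dimensional Minkowski content. Then the limit as r → ∞ of A(rC)/r^n exists and equals δ_{A,n} · M_n(C). -/

import Mathlib

open scoped Pointwise
open MeasureTheory Bornology Filter

/-- The unit cube `[0,1]^n` in `ℝ^n`. -/
def unitCube (n : ℕ) : Set (EuclideanSpace ℝ (Fin n)) :=
  {x | ∀ i, x i ∈ Set.Icc (0 : ℝ) 1}

/-- A packing bound function: an assignment of a nonnegative real number to every bounded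
Borel subset of every Euclidean space, satisfying the sphere bound, Lipschitz, union,
and mesh axioms. -/
structure PackingBoundFunction where
  toFun : ∀ d : ℕ, Set (EuclideanSpace ℝ (Fin d)) → ℝ
  nonneg : ∀ (d : ℕ) (C : Set (EuclideanSpace ℝ (Fin d))),
    IsBounded C → MeasurableSet C → 0 ≤ toFun d C
  sphere_bound : ∀ (d : ℕ) (C : Set (EuclideanSpace ℝ (Fin d))),
    IsBounded C → MeasurableSet C → C.Nonempty →
    (∃ z, C ⊆ Metric.ball z 1) → toFun d C = 1
  lipschitz : ∀ (d d' : ℕ) (C : Set (EuclideanSpace ℝ (Fin d)))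
    (C' : Set (EuclideanSpace ℝ (Fin d'))),
    IsBounded C → MeasurableSet C → IsBounded C' → MeasurableSet C' →
    (∃ ψ : EuclideanSpace ℝ (Fin d) → EuclideanSpace ℝ (Fin d'),
      (∀ x ∈ C, ψ x ∈ C') ∧ ∀ x ∈ C, ∀ y ∈ C, dist x y ≤ dist (ψ x) (ψ y)) →
    toFun d C ≤ toFun d' C'
  union : ∀ (d : ℕ) (C C' : Set (EuclideanSpace ℝ (Fin d))),
    IsBounded C → MeasurableSet C → IsBounded C' → MeasurableSet C' →
    (∀ x ∈ C, ∀ x' ∈ C', 2 ≤ dist x x') →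
    toFun d (C ∪ C') = toFun d C + toFun d C'
  mesh : ∀ (ε : ℝ), 0 < ε → ∀ (d : ℕ) (C C' : Set (EuclideanSpace ℝ (Fin d))),
    IsBounded C → MeasurableSet C → IsBounded C' → MeasurableSet C' →
    C ⊆ Metric.thickening ε C' →
    toFun d ((1 / (1 + ε)) • C) ≤ toFun d C'

/-- The Euclidean limit `δ_{A,n}` of a packing bound function: the limit of
`A(2^k·[0,1]^n)/2^{kn}` as `k → ∞` (expressed as a `limsup`, which coincides with the
limit since the latter exists). -/
noncomputable def pbfDensity (A : PackingBoundFunction) (n : ℕ) : ℝ :=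
  Filter.limsup (fun k : ℕ => A.toFun n ((2 : ℝ) ^ k • unitCube n) / 2 ^ (k * n)) Filter.atTop

/-- Normalized `n`-dimensional Hausdorff measure on `ℝ^d`, normalized (by the factor
`L_n(B_1^n)/2^n`) so that it agrees with Lebesgue measure on `ℝ^n`. -/
noncomputable def normHausdorff (n d : ℕ) : Measure (EuclideanSpace ℝ (Fin d)) :=
  (volume (Metric.ball (0 : EuclideanSpace ℝ (Fin n)) 1) / 2 ^ n) •
    (MeasureTheory.Measure.hausdorffMeasure (n : ℝ) : Measure (EuclideanSpace ℝ (Fin d)))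

/-- `C ⊆ ℝ^d` has `n`-dimensional Minkowski content `m`:
`L_d(C(ε))/L_{d-n}(B_ε^{d-n}) → m` as `ε → 0⁺` (when `n = d`, the denominator is
the volume of a ball in the zero-dimensional space, which is `1`). -/
def HasMinkowskiContent (n d : ℕ) (C : Set (EuclideanSpace ℝ (Fin d))) (m : ℝ) : Prop :=
  Filter.Tendsto (fun ε : ℝ =>
      (volume (Metric.thickening ε C)).toReal /
      (volume (Metric.ball (0 : EuclideanSpace ℝ (Fin (d - n))) ε)).toReal)
    (nhdsWithin 0 (Set.Ioi 0)) (nhds m)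

set_option autoImplicit false
set_option linter.unusedSectionVars false

/-! ### Finite pointwise inequalities -/
namespace PBF
open Finset MeasureTheory Bornology Filter
open scoped Pointwise

section pw
variable {ι : Type*} [Fintype ι] {d : ℕ}

/-- weighted exponential Jensen -/
lemma jensen_exp [Nonempty ι] (w t : ι → ℝ) (hw : ∀ i, 0 < w i) :
    (∑ i, w i) * Real.log (∑ i, w i) + ∑ i, w i * t i
      ≤ (∑ i, w i) * Real.log (∑ i, w i * Real.exp (t i)) := by
  have hW : 0 < ∑ i, w i := Finset.sum_pos (fun i _ => hw i) Finset.univ_nonempty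
  set W := ∑ i, w i with hWdef
  set T := (∑ i, w i * t i) / W with hT
  have h1 : W * Real.exp T ≤ ∑ i, w i * Real.exp (t i) := by
    have : ∑ i, w i * (Real.exp T * (1 + (t i - T))) = W * Real.exp T := by
      have h0 : ∑ i, w i * t i = T * W := by rw [hT]; field_simp
      calc ∑ i, w i * (Real.exp T * (1 + (t i - T)))
          = Real.exp T * (∑ i, w i + ∑ i, w i * t i - T * ∑ i, w i) := by
            rw [Finset.mul_sum, ← Finset.sum_add_distrib, ← Finset.sum_sub_distrib, Finset.mul_sum]
            exact Finset.sum_congr rfl (fun i _ => by ring)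
        _ = _ := by rw [h0, ← hWdef]; ring
    rw [← this]
    refine Finset.sum_le_sum (fun i _ => mul_le_mul_of_nonneg_left ?_ (hw i).le)
    have := Real.add_one_le_exp (t i - T)
    calc Real.exp T * (1 + (t i - T)) ≤ Real.exp T * Real.exp (t i - T) := by
          gcongr; linarith
      _ = Real.exp (t i) := by rw [← Real.exp_add]; congr 1; ring
  have h2 : Real.log W + T ≤ Real.log (∑ i, w i * Real.exp (t i)) := by
    have := Real.log_le_log (by positivity) h1
    rwa [Real.log_mul hW.ne' (Real.exp_pos _).ne', Real.log_exp] at this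
  calc W * Real.log W + ∑ i, w i * t i = W * (Real.log W + T) := by rw [hT]; field_simp
    _ ≤ _ := by gcongr

variable {E : Type*} [NormedAddCommGroup E] [InnerProductSpace ℝ E]

/-- pairwise variance numerator -/
noncomputable def vn (w : ι → ℝ) (s : ι → E) : ℝ :=
  (1/2) * ∑ i, ∑ j, w i * w j * ‖s i - s j‖^2

lemma vn_nonneg (w : ι → ℝ) (s : ι → E) (hw : ∀ i, 0 < w i) : 0 ≤ vn w s := by
  unfold vn
  have : 0 ≤ ∑ i, ∑ j, w i * w j * ‖s i - s j‖^2 :=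
    Finset.sum_nonneg (fun i _ => Finset.sum_nonneg (fun j _ => by
      have := hw i; have := hw j; positivity))
  linarith

lemma vn_eq (w : ι → ℝ) (s : ι → E) (a : E) :
    vn w s = (∑ i, w i) * (∑ i, w i * ‖s i - a‖^2) - ‖∑ i, w i • (s i - a)‖^2 := by
  have h1 : ∀ i j, ‖s i - s j‖^2 = ‖s i - a‖^2 - 2 * inner ℝ (s i - a) (s j - a) + ‖s j - a‖^2 := by
    intro i j
    rw [← norm_sub_sq_real]; congr 2; abel
  have h2 : ‖∑ i, w i • (s i - a)‖^2 = ∑ i, ∑ j, w i * w j * inner ℝ (s i - a) (s j - a) := by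
    rw [← real_inner_self_eq_norm_sq, sum_inner]
    refine Finset.sum_congr rfl (fun i _ => ?_)
    rw [inner_sum]
    refine Finset.sum_congr rfl (fun j _ => ?_)
    rw [inner_smul_left, inner_smul_right]; simp; ring
  have h3 : (∑ i, w i) * (∑ i, w i * ‖s i - a‖^2) = ∑ i, ∑ j, w i * w j * ‖s j - a‖^2 := by
    rw [Finset.sum_mul_sum]
    exact Finset.sum_congr rfl (fun i _ => Finset.sum_congr rfl (fun j _ => by ring))
  have h4 : (∑ i, w i) * (∑ i, w i * ‖s i - a‖^2) = ∑ i, ∑ j, w i * w j * ‖s i - a‖^2 := by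
    rw [h3, Finset.sum_comm]
    exact Finset.sum_congr rfl (fun i _ => Finset.sum_congr rfl (fun j _ => by ring))
  have h5 : ∑ i, ∑ j, w i * w j * ‖s i - s j‖^2 = ∑ i, ∑ j, w i * w j * ‖s i - a‖^2
      - 2 * ∑ i, ∑ j, w i * w j * inner ℝ (s i - a) (s j - a)
      + ∑ i, ∑ j, w i * w j * ‖s j - a‖^2 := by
    rw [Finset.mul_sum, ← Finset.sum_sub_distrib, ← Finset.sum_add_distrib]
    refine Finset.sum_congr rfl (fun i _ => ?_)
    rw [Finset.mul_sum, ← Finset.sum_sub_distrib, ← Finset.sum_add_distrib]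
    exact Finset.sum_congr rfl (fun j _ => by rw [h1]; ring)
  unfold vn
  rw [h5, ← h4, ← h3, h2]; ring

lemma vn_le (w : ι → ℝ) (s : ι → E) (a : E) :
    vn w s ≤ (∑ i, w i) * (∑ i, w i * ‖s i - a‖^2) := by
  rw [vn_eq w s a]; nlinarith [sq_nonneg ‖∑ i, w i • (s i - a)‖]

/-- unnormalized gaussian -/
noncomputable def ph (x y : E) : ℝ := Real.exp (-‖y - x‖^2 / 2)
lemma ph_pos (x y : E) : 0 < ph x y := Real.exp_pos _
lemma ph_le_one (x y : E) : ph x y ≤ 1 := by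
  unfold ph; rw [Real.exp_le_one_iff]; nlinarith [sq_nonneg ‖y - x‖]

noncomputable def gW (p : ι → ℝ) (s : ι → E) (y : E) : ℝ := ∑ i, p i * ph (s i) y

/-- posterior variance times W -/
noncomputable def gv (p : ι → ℝ) (s : ι → E) (y : E) : ℝ :=
  vn (fun i => p i * ph (s i) y) s / gW p s y

variable [Nonempty ι] (p : ι → ℝ) (s : ι → E) (hp : ∀ i, 0 < p i)
include hp

lemma gW_pos (y : E) : 0 < gW p s y :=
  Finset.sum_pos (fun i _ => mul_pos (hp i) (ph_pos _ _)) Finset.univ_nonempty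

lemma gv_nonneg (y : E) : 0 ≤ gv p s y :=
  div_nonneg (vn_nonneg _ _ fun i => mul_pos (hp i) (ph_pos _ _)) (gW_pos p s hp y).le

lemma gv_le (y a : E) : gv p s y ≤ ∑ i, p i * ph (s i) y * ‖s i - a‖^2 := by
  unfold gv; rw [div_le_iff₀ (gW_pos p s hp y), mul_comm]
  exact vn_le _ _ _

lemma pw_S1 (l : ℝ) (y : E) :
    gW p s y * Real.log (gW p s y) - (l - 1) * l * gv p s y ≤
     ∑ i, p i * ph (s i) y * Real.log (gW p (fun j => l • s j) (y + (l-1) • s i)) := by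
  set w : ι → ℝ := fun i => p i * ph (s i) y with hw
  have hwp : ∀ i, 0 < w i := fun i => mul_pos (hp i) (ph_pos _ _)
  have hW : gW p s y = ∑ i, w i := rfl
  have hWp : 0 < ∑ i, w i := hW ▸ gW_pos p s hp y
  have hb : ∀ i j, ‖y + (l-1) • s i - l • s j‖^2 =
      (1-l) * ‖y - s i‖^2 + l * ‖y - s j‖^2 + l * (l-1) * ‖s i - s j‖^2 := by
    intro i j
    have e1 : y + (l-1) • s i - l • s j = (y - s i) + l • (s i - s j) := by module
    have e2 : y - s j = (y - s i) + (s i - s j) := by abel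
    rw [e1, e2, norm_add_sq_real, norm_add_sq_real, inner_smul_right, norm_smul, mul_pow,
      Real.norm_eq_abs, sq_abs]
    ring
  have hG : ∀ i, gW p (fun j => l • s j) (y + (l-1) • s i) =
      ∑ j, w j * Real.exp (((1-l) * (‖y - s j‖^2 - ‖y - s i‖^2) - l * (l-1) * ‖s i - s j‖^2)/2) := by
    intro i
    refine Finset.sum_congr rfl (fun j _ => ?_)
    simp only [hw, ph]
    rw [mul_assoc, ← Real.exp_add, hb]
    congr 2; ring
  have key : ∀ i, w i * ((∑ i, w i) * Real.log (∑ i, w i) + ∑ j, w j *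
      (((1-l) * (‖y - s j‖^2 - ‖y - s i‖^2) - l * (l-1) * ‖s i - s j‖^2)/2)) ≤
      (∑ i, w i) * (w i * Real.log (gW p (fun j => l • s j) (y + (l-1) • s i))) := by
    intro i
    rw [hG]
    have := mul_le_mul_of_nonneg_left (jensen_exp w (fun j => ((1-l) * (‖y - s j‖^2 - ‖y - s i‖^2) - l * (l-1) * ‖s i - s j‖^2)/2) hwp) (hwp i).le
    linarith
  have hsum := Finset.sum_le_sum (fun i (_ : i ∈ Finset.univ) => key i)
  rw [← Finset.mul_sum] at hsum
  have hl : ∑ i, w i * ((∑ i, w i) * Real.log (∑ i, w i) + ∑ j, w j *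
      (((1-l) * (‖y - s j‖^2 - ‖y - s i‖^2) - l * (l-1) * ‖s i - s j‖^2)/2)) =
      (∑ i, w i) * ((∑ i, w i) * Real.log (∑ i, w i)) - l * (l-1) * vn w s := by
    have h0 : ∑ i, ∑ j, w i * w j * (‖y - s j‖^2 - ‖y - s i‖^2) = 0 := by
      have e1 : ∑ i, ∑ j, w i * w j * (‖y - s j‖^2 - ‖y - s i‖^2) =
        ∑ i, ∑ j, w i * w j * ‖y - s j‖^2 - ∑ i, ∑ j, w i * w j * ‖y - s i‖^2 := by
        rw [← Finset.sum_sub_distrib]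
        refine Finset.sum_congr rfl (fun i _ => ?_)
        rw [← Finset.sum_sub_distrib]
        exact Finset.sum_congr rfl (fun i _ => by ring)
      rw [e1, sub_eq_zero, Finset.sum_comm]
      exact Finset.sum_congr rfl (fun i _ => Finset.sum_congr rfl (fun j _ => by ring))
    have h1 : ∑ i, w i * ((∑ i, w i) * Real.log (∑ i, w i) + ∑ j, w j *
      (((1-l) * (‖y - s j‖^2 - ‖y - s i‖^2) - l * (l-1) * ‖s i - s j‖^2)/2)) =
      (∑ i, w i) * ((∑ i, w i) * Real.log (∑ i, w i)) +
      (1-l)/2 * (∑ i, ∑ j, w i * w j * (‖y - s j‖^2 - ‖y - s i‖^2)) - l * (l-1) * vn w s := by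
      unfold vn
      simp only [mul_add, Finset.sum_add_distrib]
      rw [← Finset.sum_mul, add_sub_assoc]
      congr 1
      rw [← mul_assoc (l * (l-1)), Finset.mul_sum, Finset.mul_sum, ← Finset.sum_sub_distrib]
      refine Finset.sum_congr rfl (fun i _ => ?_)
      rw [Finset.mul_sum, Finset.mul_sum, Finset.mul_sum, ← Finset.sum_sub_distrib]
      exact Finset.sum_congr rfl (fun i _ => by ring)
    rw [h1, h0]; ring
  rw [hl] at hsum
  have hgv : gv p s y = vn w s / ∑ i, w i := rfl
  rw [hW, hgv]
  have : (∑ i, w i) * ((∑ i, w i) * Real.log (∑ i, w i) - (l - 1) * l * (vn w s / ∑ i, w i)) ≤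
      (∑ i, w i) * ∑ i, w i * Real.log (gW p (fun j => l • s j) (y + (l-1) • s i)) := by
    refine le_trans (le_of_eq ?_) hsum
    field_simp
  exact le_of_mul_le_mul_left this hWp

omit hp [Nonempty ι] in
lemma infDist_sq_le (s : ι → E) (y : E) (i : ι) :
    Metric.infDist y (Set.range s) ^ 2 ≤ ‖y - s i‖^2 := by
  have := Metric.infDist_le_dist_of_mem (x := y) (Set.mem_range_self (f := s) i)
  rw [dist_eq_norm] at this
  exact pow_le_pow_left₀ Metric.infDist_nonneg this 2

omit hp in
lemma exists_infDist_sq (s : ι → E) (y : E) :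
    ∃ i, Metric.infDist y (Set.range s) ^ 2 = ‖y - s i‖^2 := by
  obtain ⟨x, ⟨i, rfl⟩, h⟩ := (Set.finite_range s).isCompact.exists_infDist_eq_dist (Set.range_nonempty s) y
  exact ⟨i, by rw [h, dist_eq_norm]⟩

lemma pw_S3 (m : ℝ) (h0 : 0 < m) (h1 : m < 1) (y : E) :
    ∑ i, p i * ph (s i) y * Metric.infDist (y - (1-m) • s i) (Set.range fun j => m • s j) ^ 2 ≤
    (1-m) * (∑ i, p i * ph (s i) y * ‖y - s i‖^2) + m * (gW p s y * Metric.infDist y (Set.range s)^2)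
      - m * (1-m) * gv p s y := by
  obtain ⟨k, hk⟩ := exists_infDist_sq s y
  have hb : ∀ i, Metric.infDist (y - (1-m) • s i) (Set.range fun j => m • s j) ^ 2 ≤
      (1-m) * ‖y - s i‖^2 + m * ‖y - s k‖^2 - m * (1-m) * ‖s i - s k‖^2 := by
    intro i
    refine (infDist_sq_le (fun j => m • s j) _ k).trans (le_of_eq ?_)
    have e1 : y - (1-m) • s i - m • s k = (y - s i) + m • (s i - s k) := by module
    have e2 : y - s k = (y - s i) + (s i - s k) := by abel
    rw [e1, e2, norm_add_sq_real, norm_add_sq_real, inner_smul_right, norm_smul, mul_pow,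
      Real.norm_eq_abs, sq_abs]
    ring
  have hv := gv_le p s hp y (s k)
  rw [hk]
  calc _ ≤ ∑ i, p i * ph (s i) y * ((1-m) * ‖y - s i‖^2 + m * ‖y - s k‖^2 - m * (1-m) * ‖s i - s k‖^2) := by
        refine Finset.sum_le_sum (fun i _ => mul_le_mul_of_nonneg_left (hb i) ?_)
        exact (mul_pos (hp i) (ph_pos _ _)).le
    _ = (1-m) * (∑ i, p i * ph (s i) y * ‖y - s i‖^2) + m * (gW p s y * ‖y - s k‖^2)
       - m * (1-m) * ∑ i, p i * ph (s i) y * ‖s i - s k‖^2 := by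
        unfold gW
        rw [Finset.sum_mul, Finset.mul_sum, Finset.mul_sum, Finset.mul_sum,
          ← Finset.sum_add_distrib, ← Finset.sum_sub_distrib]
        exact Finset.sum_congr rfl (fun i _ => by ring)
    _ ≤ _ := by
        have : 0 < m * (1-m) := mul_pos h0 (by linarith)
        nlinarith

lemma pw_SLB (G : ℝ) (hG : ∀ y, gW p s y ≤ G) (y : E) :
    gW p s y * Real.log (gW p s y) + (1/2) * (∑ i, p i * ph (s i) y * ‖y - s i‖^2)
      - (1/2) * gv p s y ≤ gW p s y * Real.log G := by
  set w : ι → ℝ := fun i => p i * ph (s i) y with hw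
  have hwp : ∀ i, 0 < w i := fun i => mul_pos (hp i) (ph_pos _ _)
  have hW : gW p s y = ∑ i, w i := rfl
  have hWp : 0 < ∑ i, w i := hW ▸ gW_pos p s hp y
  set a : E := (∑ i, w i)⁻¹ • ∑ i, w i • s i with ha
  have ha0 : ∑ i, w i • (s i - a) = 0 := by
    simp only [smul_sub, Finset.sum_sub_distrib]
    rw [← Finset.sum_smul, ha, smul_smul, mul_inv_cancel₀ hWp.ne', one_smul, sub_self]
  have hv : gv p s y = ∑ i, w i * ‖a - s i‖^2 := by
    have : gv p s y = vn w s / ∑ i, w i := rfl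
    rw [this, vn_eq w s a, ha0]
    simp only [norm_sub_rev a]
    field_simp; simp
  have hGa : gW p s a = ∑ i, w i * Real.exp ((‖y - s i‖^2 - ‖a - s i‖^2)/2) := by
    refine Finset.sum_congr rfl (fun j _ => ?_)
    simp only [hw, ph]
    rw [mul_assoc, ← Real.exp_add]
    congr 2; ring
  have hj := jensen_exp w (fun i => (‖y - s i‖^2 - ‖a - s i‖^2)/2) hwp
  rw [← hGa] at hj
  have hl := Real.log_le_log (gW_pos p s hp a) (hG a)
  have hl2 := mul_le_mul_of_nonneg_left hl hWp.le
  rw [hv, hW]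
  have he : ∑ i, w i * ((‖y - s i‖^2 - ‖a - s i‖^2)/2) =
    (1/2) * (∑ i, w i * ‖y - s i‖^2) - (1/2) * ∑ i, w i * ‖a - s i‖^2 := by
    rw [Finset.mul_sum, Finset.mul_sum, ← Finset.sum_sub_distrib]
    exact Finset.sum_congr rfl (fun i _ => by ring)
  rw [he] at hj
  linarith
end pw
end PBF
set_option autoImplicit false
set_option linter.unusedSectionVars false
namespace PBF
open Finset MeasureTheory Bornology Filter
open scoped Pointwise

section core
lemma iadd {α : Type*} [MeasurableSpace α] {μ : Measure α} {f g : α → ℝ} (hf : Integrable f μ)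
    (hg : Integrable g μ) : Integrable (fun y => f y + g y) μ := hf.add hg
variable {ι : Type*} [Fintype ι] [Nonempty ι]
variable {E : Type*} [NormedAddCommGroup E] [InnerProductSpace ℝ E] [MeasurableSpace E] [BorelSpace E]
variable (ν : Measure E)

structure GaussNu [NormedAddCommGroup E] (ν : Measure E) : Prop where
  int0 : Integrable (fun y : E => ph 0 y) ν
  int1 : ∫ y : E, ph 0 y ∂ν = 1
  int2 : Integrable (fun y : E => ph 0 y * ‖y‖^2) ν

noncomputable def gd0 : ℝ := ∫ y : E, ph 0 y * ‖y‖^2 ∂ν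
noncomputable def gJ (p : ι → ℝ) (s : ι → E) : ℝ := ∫ y, gW p s y * Real.log (gW p s y) ∂ν
noncomputable def ge (p : ι → ℝ) (s : ι → E) : ℝ := ∫ y, gW p s y * Metric.infDist y (Set.range s)^2 ∂ν
noncomputable def gB (p : ι → ℝ) (s : ι → E) : ℝ := ∫ y, gv p s y ∂ν

lemma gd0_nonneg : 0 ≤ gd0 ν := integral_nonneg (fun y => by have := ph_pos 0 y; positivity)

lemma ph_sub (x y : E) : ph x y = ph 0 (y - x) := by simp [ph]
lemma continuous_ph (x : E) : Continuous (ph x) := by unfold ph; fun_prop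
lemma continuous_gW (p : ι → ℝ) (s : ι → E) : Continuous (gW p s) := by
  unfold gW; exact continuous_finsetSum _ (fun i _ => (continuous_ph _).const_mul _)

variable {ν} [ν.IsAddLeftInvariant] (hν : GaussNu ν)
include hν

lemma int_ph (x : E) : Integrable (ph x) ν := by
  have := hν.int0.comp_sub_right x
  simpa [← ph_sub] using this
lemma integral_ph (x : E) : ∫ y, ph x y ∂ν = 1 := by
  simp_rw [ph_sub x]
  rw [integral_sub_right_eq_self (fun y => ph 0 y) x, hν.int1]
lemma int_ph2 (x : E) : Integrable (fun y => ph x y * ‖y - x‖^2) ν := by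
  have := hν.int2.comp_sub_right x
  simpa [← ph_sub] using this
lemma integral_ph2 (x : E) : ∫ y, ph x y * ‖y - x‖^2 ∂ν = gd0 ν := by
  simp_rw [ph_sub x]
  rw [integral_sub_right_eq_self (fun y => ph 0 y * ‖y‖^2) x, gd0]

lemma ph_shift (l : ℝ) (x y : E) : ph (l • x) (y + (l-1) • x) = ph x y := by
  have e : y + (l-1) • x - l • x = y - x := by module
  unfold ph; rw [e]

lemma integral_gW_mul (p : ι → ℝ) (s : ι → E) (l : ℝ) (F : E → ℝ)
    (hF : ∀ i, Integrable (fun y => ph (s i) y * F (y + (l-1) • s i)) ν) :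
    Integrable (fun y => gW p (fun j => l • s j) y * F y) ν ∧
    Integrable (fun y => ∑ i, p i * ph (s i) y * F (y + (l-1) • s i)) ν ∧
    ∫ y, gW p (fun j => l • s j) y * F y ∂ν = ∫ y, ∑ i, p i * ph (s i) y * F (y + (l-1) • s i) ∂ν := by
  have hF' : ∀ i, Integrable (fun y => ph (l • s i) y * F y) ν := by
    intro i
    have := (hF i).comp_sub_right ((l-1) • s i)
    simp only [sub_add_cancel] at this
    convert this using 2 with y
    rw [← ph_shift hν l (s i) (y - _), sub_add_cancel]
  have e1 : (fun y => gW p (fun j => l • s j) y * F y) = fun y => ∑ i, p i * (ph (l • s i) y * F y) := by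
    funext y; unfold gW; rw [Finset.sum_mul]
    exact Finset.sum_congr rfl (fun i _ => by ring)
  have e2 : (fun y => ∑ i, p i * ph (s i) y * F (y + (l-1) • s i)) = fun y => ∑ i, p i * (ph (s i) y * F (y + (l-1) • s i)) := by
    funext y; exact Finset.sum_congr rfl (fun i _ => by ring)
  rw [e1, e2]
  refine ⟨integrable_finsetSum _ (fun i _ => (hF' i).const_mul _), integrable_finsetSum _ (fun i _ => (hF i).const_mul _), ?_⟩
  rw [integral_finsetSum _ (fun i _ => (hF' i).const_mul _), integral_finsetSum _ (fun i _ => (hF i).const_mul _)]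
  refine Finset.sum_congr rfl (fun i _ => ?_)
  rw [integral_const_mul, integral_const_mul]
  congr 1
  rw [← integral_add_right_eq_self (fun y => ph (l • s i) y * F y) ((l-1) • s i)]
  simp_rw [ph_shift hν]

variable (p : ι → ℝ) (hp : ∀ i, 0 < p i) (hp1 : ∑ i, p i = 1)
include hp hp1

lemma gW_le_one (s : ι → E) (y : E) : gW p s y ≤ 1 := by
  rw [← hp1]
  exact Finset.sum_le_sum (fun i _ => by nlinarith [hp i, ph_le_one (s i) y])

lemma int_log (s : ι → E) (l : ℝ) (i : ι) :
    Integrable (fun y => ph (s i) y * Real.log (gW p (fun j => l • s j) (y + (l-1) • s i))) ν := by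
  have hb : Integrable (fun y => ph (s i) y * (-Real.log (p i)) + (1/2) * (ph (s i) y * ‖y - s i‖^2)) ν :=
    ((int_ph hν (s i)).mul_const _).add ((int_ph2 hν (s i)).const_mul _)
  refine hb.mono' ?_ ?_
  · refine Continuous.aestronglyMeasurable ?_
    refine (continuous_ph _).mul (Continuous.log ?_ (fun y => (gW_pos p _ hp _).ne'))
    exact (continuous_gW p _).comp (by fun_prop)
  · refine Filter.Eventually.of_forall (fun y => ?_)
    have h1 : p i * ph (s i) y ≤ gW p (fun j => l • s j) (y + (l-1) • s i) := by
      rw [← ph_shift hν l (s i) y]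
      exact Finset.single_le_sum (f := fun j => p j * ph (l • s j) (y + (l-1) • s i))
        (fun j _ => (mul_pos (hp j) (ph_pos _ _)).le) (Finset.mem_univ i)
    have h2 := gW_le_one hν p hp hp1 (fun j => l • s j) (y + (l-1) • s i)
    have h3 : Real.log (p i) + (-‖y - s i‖^2/2) ≤ Real.log (gW p (fun j => l • s j) (y + (l-1) • s i)) := by
      have := Real.log_le_log (mul_pos (hp i) (ph_pos _ _)) h1
      rwa [Real.log_mul (hp i).ne' (ph_pos _ _).ne', ph, Real.log_exp] at this
    have h4 := Real.log_nonpos (gW_pos p (fun j => l • s j) hp (y + (l-1) • s i)).le h2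
    rw [norm_mul, Real.norm_of_nonneg (ph_pos _ _).le, Real.norm_of_nonpos h4]
    nlinarith [ph_pos (s i) y]

lemma int_W2 (s : ι → E) : Integrable (fun y => ∑ i, p i * ph (s i) y * ‖y - s i‖^2) ν ∧
    ∫ y, ∑ i, p i * ph (s i) y * ‖y - s i‖^2 ∂ν = gd0 ν := by
  have e2 : (fun y => ∑ i, p i * ph (s i) y * ‖y - s i‖^2) = fun y => ∑ i, p i * (ph (s i) y * ‖y - s i‖^2) := by
    funext y; exact Finset.sum_congr rfl (fun i _ => by ring)
  rw [e2]
  refine ⟨integrable_finsetSum _ (fun i _ => (int_ph2 hν (s i)).const_mul _), ?_⟩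
  rw [integral_finsetSum _ (fun i _ => (int_ph2 hν (s i)).const_mul _)]
  simp_rw [integral_const_mul, integral_ph2 hν]
  rw [← Finset.sum_mul, hp1, one_mul]

lemma int_gW (s : ι → E) : Integrable (gW p s) ν ∧ ∫ y, gW p s y ∂ν = 1 := by
  unfold gW
  refine ⟨integrable_finsetSum _ (fun i _ => (int_ph hν (s i)).const_mul _), ?_⟩
  rw [integral_finsetSum _ (fun i _ => (int_ph hν (s i)).const_mul _)]
  rw [← hp1]
  refine Finset.sum_congr rfl (fun i _ => ?_)
  rw [integral_const_mul, integral_ph hν, mul_one]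

lemma int_gv (s : ι → E) : Integrable (gv p s) ν := by
  refine (int_W2 hν p hp hp1 s).1.mono' ?_ (Filter.Eventually.of_forall fun y => ?_)
  · refine Continuous.aestronglyMeasurable ?_
    unfold gv vn
    refine Continuous.div ?_ (continuous_gW p s) (fun y => (gW_pos p s hp y).ne')
    refine continuous_const.mul (continuous_finsetSum _ (fun i _ => continuous_finsetSum _ (fun j _ => ?_)))
    exact (((continuous_ph _).const_mul _).mul ((continuous_ph _).const_mul _)).mul continuous_const
  · rw [Real.norm_of_nonneg (gv_nonneg p s hp y)]
    have := gv_le p s hp y y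
    simpa only [norm_sub_rev y] using this

lemma gB_nonneg (s : ι → E) : 0 ≤ gB ν p s := integral_nonneg (fun y => gv_nonneg p s hp y)
lemma gB_le (s : ι → E) : gB ν p s ≤ gd0 ν := by
  rw [← (int_W2 hν p hp hp1 s).2]
  refine integral_mono (int_gv hν p hp hp1 s) (int_W2 hν p hp hp1 s).1 (fun y => ?_)
  have := gv_le p s hp y y
  simpa only [norm_sub_rev y] using this

lemma int_WlogW (s : ι → E) : Integrable (fun y => gW p s y * Real.log (gW p s y)) ν := by
  have := (integral_gW_mul hν p s 1 (fun y => Real.log (gW p s y)) (fun i => by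
    have := int_log hν p hp hp1 s 1 i
    simpa using this)).1
  simpa using this

lemma S1 (s : ι → E) (l : ℝ) :
    gJ ν p s - (l-1) * l * gB ν p s ≤ gJ ν p (fun j => l • s j) := by
  obtain ⟨-, h2, h3⟩ := integral_gW_mul hν p s l (fun y => Real.log (gW p (fun j => l • s j) y))
    (fun i => int_log hν p hp hp1 s l i)
  unfold gJ gB
  rw [h3, ← integral_const_mul, ← integral_sub (int_WlogW hν p hp hp1 s) ((int_gv hν p hp hp1 s).const_mul _)]
  exact integral_mono ((int_WlogW hν p hp hp1 s).sub ((int_gv hν p hp hp1 s).const_mul _)) h2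
    (fun y => pw_S1 p s hp l y)

lemma int_inf (s : ι → E) (m : ℝ) (i : ι) :
    Integrable (fun y => ph (s i) y * Metric.infDist (y + (m-1) • s i) (Set.range fun j => m • s j)^2) ν := by
  refine (int_ph2 hν (s i)).mono' ?_ (Filter.Eventually.of_forall fun y => ?_)
  · refine Continuous.aestronglyMeasurable ?_
    exact (continuous_ph _).mul (((Metric.continuous_infDist_pt _).comp (by fun_prop)).pow 2)
  · have := infDist_sq_le (fun j => m • s j) (y + (m-1) • s i) i
    have e : y + (m-1) • s i - m • s i = y - s i := by module
    simp only [e] at this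
    rw [Real.norm_of_nonneg (mul_nonneg (ph_pos _ _).le (sq_nonneg _))]
    exact mul_le_mul_of_nonneg_left this (ph_pos _ _).le

lemma int_Winf (s : ι → E) : Integrable (fun y => gW p s y * Metric.infDist y (Set.range s)^2) ν := by
  have := (integral_gW_mul hν p s 1 (fun y => Metric.infDist y (Set.range s)^2) (fun i => by
    have := int_inf hν p hp hp1 s 1 i
    simpa using this)).1
  simpa using this

lemma ge_nonneg (s : ι → E) : 0 ≤ ge ν p s :=
  integral_nonneg (fun y => mul_nonneg (gW_pos p s hp y).le (sq_nonneg _))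
lemma ge_le (s : ι → E) : ge ν p s ≤ gd0 ν := by
  rw [← (int_W2 hν p hp hp1 s).2]
  refine integral_mono (int_Winf hν p hp hp1 s) (int_W2 hν p hp hp1 s).1 (fun y => ?_)
  simp only [gW]
  rw [Finset.sum_mul]
  exact Finset.sum_le_sum (fun i _ => mul_le_mul_of_nonneg_left (infDist_sq_le s y i) (mul_pos (hp i) (ph_pos _ _)).le)

lemma S3 (s : ι → E) (m : ℝ) (h0 : 0 < m) (h1 : m < 1) :
    ge ν p (fun j => m • s j) ≤ (1-m) * gd0 ν + m * ge ν p s - m * (1-m) * gB ν p s := by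
  obtain ⟨-, h2, h3⟩ := integral_gW_mul hν p s m (fun y => Metric.infDist y (Set.range fun j => m • s j)^2)
    (fun i => int_inf hν p hp hp1 s m i)
  have i1 := ((int_W2 hν p hp hp1 s).1.const_mul (1-m))
  have i2 := ((int_Winf hν p hp hp1 s).const_mul m)
  have i3 := ((int_gv hν p hp hp1 s).const_mul (m*(1-m)))
  unfold gB
  rw [← (int_W2 hν p hp hp1 s).2]
  unfold ge
  rw [h3, ← integral_const_mul, ← integral_const_mul, ← integral_const_mul, ← integral_add i1 i2, ← integral_sub (iadd i1 i2) i3]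
  refine integral_mono h2 ((iadd i1 i2).sub i3) (fun y => ?_)
  have := pw_S3 p s hp m h0 h1 y
  have e : ∀ i, y + (m-1) • s i = y - (1-m) • s i := fun i => by module
  simp only [e]
  exact this

lemma SLB (s : ι → E) (G : ℝ) (hG : ∀ y, gW p s y ≤ G) :
    gJ ν p s + gd0 ν / 2 - gB ν p s / 2 ≤ Real.log G := by
  have i1 := int_WlogW hν p hp hp1 s
  have i2 := ((int_W2 hν p hp hp1 s).1.const_mul (1/2))
  have i3 := ((int_gv hν p hp hp1 s).const_mul (1/2))
  have : gJ ν p s + (1/2) * gd0 ν - (1/2) * gB ν p s ≤ ∫ y, gW p s y * Real.log G ∂ν := by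
    unfold gJ gB
    rw [← (int_W2 hν p hp hp1 s).2]
    rw [← integral_const_mul, ← integral_const_mul, ← integral_add i1 i2, ← integral_sub (iadd i1 i2) i3]
    exact integral_mono ((iadd i1 i2).sub i3) ((int_gW hν p hp hp1 s).1.mul_const _) (fun y => pw_SLB p s hp G hG y)
  rw [integral_mul_const, (int_gW hν p hp hp1 s).2] at this
  linarith

lemma gJ_le (s : ι → E) (G : ℝ) (hG : ∀ y, gW p s y ≤ G) : gJ ν p s ≤ Real.log G := by
  have : gJ ν p s ≤ ∫ y, gW p s y * Real.log G ∂ν :=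
    integral_mono (int_WlogW hν p hp hp1 s) ((int_gW hν p hp hp1 s).1.mul_const _) (fun y =>
      mul_le_mul_of_nonneg_left (Real.log_le_log (gW_pos p s hp y) (hG y)) (gW_pos p s hp y).le)
  rwa [integral_mul_const, (int_gW hν p hp hp1 s).2, one_mul] at this

lemma int_expd (s : ι → E) : Integrable (fun y => Real.exp (-Metric.infDist y (Set.range s)^2/2)) ν := by
  have : Integrable (fun y => ∑ i, ph (s i) y) ν := integrable_finsetSum _ (fun i _ => int_ph hν (s i))
  refine this.mono' ?_ (Filter.Eventually.of_forall fun y => ?_)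
  · refine Continuous.aestronglyMeasurable ?_
    have := Metric.continuous_infDist_pt (Set.range s)
    fun_prop
  · rw [Real.norm_of_nonneg (Real.exp_pos _).le]
    obtain ⟨i, hi⟩ := exists_infDist_sq s y
    rw [hi]
    exact Finset.single_le_sum (f := fun j => ph (s j) y) (fun j _ => (ph_pos _ _).le) (Finset.mem_univ i)

lemma jensenD (s : ι → E) (k : ℝ) (hk : 0 < k)
    (h : ∫ y, Real.exp (-Metric.infDist y (Set.range s)^2/2) ∂ν ≤ k) :
    - ge ν p s / 2 - gJ ν p s ≤ Real.log k := by
  have i1 := ((int_Winf hν p hp hp1 s).const_mul (-1/2))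
  have i2 := int_WlogW hν p hp hp1 s
  have i3 := (int_expd hν p hp hp1 s).const_mul (1/k)
  have i4 := (int_gW hν p hp hp1 s).1.mul_const (Real.log k - 1)
  have : (-1/2) * ge ν p s - gJ ν p s ≤ ∫ y, ((1/k) * Real.exp (-Metric.infDist y (Set.range s)^2/2) + gW p s y * (Real.log k - 1)) ∂ν := by
    unfold ge gJ
    rw [← integral_const_mul, ← integral_sub i1 i2]
    refine integral_mono (i1.sub i2) (i3.add i4) (fun y => ?_)
    have hW := gW_pos p s hp y
    set x := Real.exp (-Metric.infDist y (Set.range s)^2/2)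
    have hx : 0 < x := Real.exp_pos _
    have hl := Real.log_le_sub_one_of_pos (div_pos hx (mul_pos hW hk))
    rw [Real.log_div hx.ne' (mul_pos hW hk).ne', Real.log_mul hW.ne' hk.ne', Real.log_exp] at hl
    have := mul_le_mul_of_nonneg_left hl hW.le
    have e : gW p s y * (x / (gW p s y * k) - 1) = 1/k * x - gW p s y := by field_simp
    rw [e] at this
    simp only
    linarith
  rw [integral_add i3 i4, integral_const_mul, integral_mul_const, (int_gW hν p hp hp1 s).2] at this
  have h2 : 1/k * ∫ y, Real.exp (-Metric.infDist y (Set.range s)^2/2) ∂ν ≤ 1 := by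
    rw [div_mul_eq_mul_div, one_mul, div_le_one hk]; exact h
  linarith

omit hν hp hp1 in
lemma abs_sub_one_le (f k : ℝ) (hf : 0 < f) (hk : 0 < k) (hk1 : k ≤ 1) :
    |f - 1| ≤ k + (2/k) * (f - 1 - Real.log f) := by
  set q := Real.sqrt f with hq
  have hq0 : 0 < q := Real.sqrt_pos.2 hf
  have hf2 : f = q^2 := (Real.sq_sqrt hf.le).symm
  have h1 : Real.log f ≤ 2 * (q - 1) := by
    rw [hf2, Real.log_pow]; push_cast
    have := Real.log_le_sub_one_of_pos hq0; linarith
  have h2 : (q-1)^2 ≤ f - 1 - Real.log f := by rw [hf2] at *; nlinarith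
  have h3 : |f - 1| ≤ k + (2/k) * (q-1)^2 := by
    have e : f - 1 = (q-1) * (q+1) := by rw [hf2]; ring
    rw [e, abs_mul, abs_of_pos (by linarith : 0 < q+1), ← sq_abs (q-1)]
    set t := |q-1|
    have ht : q + 1 ≤ t + 2 := by have := le_abs_self (q-1); linarith
    have ht0 : 0 ≤ t := abs_nonneg _
    have h4 : t * (q+1) ≤ t * (t+2) := by gcongr
    have h5 : k * (t * (t+2)) ≤ k * (k + 2/k * t^2) := by
      have : k * (k + 2/k * t^2) = k^2 + 2 * t^2 := by field_simp
      rw [this]; nlinarith [sq_nonneg (k - t)]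
    exact h4.trans (le_of_mul_le_mul_left h5 hk)
  refine h3.trans ?_
  gcongr

lemma closeness (s : ι → E) (G k ε : ℝ) (hG : 0 < G) (hk : 0 < k) (hk1 : k ≤ 1)
    (h : G * ∫ y, Real.exp (-Metric.infDist y (Set.range s)^2/2) ∂ν ≤ Real.exp ε) :
    ∫ y, |G * Real.exp (-Metric.infDist y (Set.range s)^2/2) - gW p s y| ∂ν ≤
      k + (2/k) * (Real.exp ε - 1 - (Real.log G - ge ν p s / 2 - gJ ν p s)) := by
  have i0 := (int_gW hν p hp hp1 s).1
  have i1 := ((int_Winf hν p hp hp1 s).const_mul (2/k*(1/2)))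
  have i2 := (int_WlogW hν p hp hp1 s).const_mul (2/k)
  have i3 := (int_expd hν p hp hp1 s).const_mul G
  have i4 := i3.const_mul (2/k)
  have i5 := i0.const_mul (k - 2/k - 2/k * Real.log G)
  have key : ∫ y, |G * Real.exp (-Metric.infDist y (Set.range s)^2/2) - gW p s y| ∂ν ≤
      ∫ y, ((2/k) * (G * Real.exp (-Metric.infDist y (Set.range s)^2/2)) + (k - 2/k - 2/k * Real.log G) * gW p s y
        + (2/k*(1/2)) * (gW p s y * Metric.infDist y (Set.range s)^2) + (2/k) * (gW p s y * Real.log (gW p s y))) ∂ν := by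
    refine integral_mono (i3.sub i0).abs ((iadd (iadd i4 i5) i1).add i2) (fun y => ?_)
    have hW := gW_pos p s hp y
    simp only
    set x := Real.exp (-Metric.infDist y (Set.range s)^2/2) with hxdef
    have hx : 0 < x := Real.exp_pos _
    have hl := abs_sub_one_le (G * x / gW p s y) k (by positivity) hk hk1
    rw [Real.log_div (by positivity) hW.ne', Real.log_mul hG.ne' hx.ne', Real.log_exp] at hl
    have h2 := mul_le_mul_of_nonneg_left hl hW.le
    have e : G * x - gW p s y = gW p s y * (G * x / gW p s y - 1) := by field_simp
    rw [e, abs_mul, abs_of_pos hW]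
    refine h2.trans (le_of_eq ?_)
    field_simp
    ring
  rw [integral_add (iadd (iadd i4 i5) i1) i2, integral_add (iadd i4 i5) i1, integral_add i4 i5,
    integral_const_mul, integral_const_mul, integral_const_mul, integral_const_mul, integral_const_mul, (int_gW hν p hp hp1 s).2] at key
  refine key.trans ?_
  have := mul_le_mul_of_nonneg_left h (by positivity : 0 ≤ 2/k)
  unfold ge gJ
  linarith

end core
end PBF
set_option autoImplicit false
set_option linter.unusedSectionVars false
namespace PBF
open Finset MeasureTheory Bornology Filter
open scoped Pointwise

structure OdeHyp (n d0 e l : ℝ) (T : ℕ) (X P B : ℕ → ℝ) : Prop where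
  h1 : ∀ k < T, (1 - 1/l) / l * B (k+1) - n * Real.log l ≤ X (k+1) - X k
  h2 : ∀ k < T, X (k+1) - X k ≤ (l-1) * l * B k - n * Real.log l
  h3 : ∀ k < T, P (k+1) - P k ≤ (1-1/l) * P (k+1) - (1-1/l) / (2*l) * B (k+1)
  hB : ∀ k ≤ T, n - 2 * X k ≤ B k
  hB0 : ∀ k ≤ T, 0 ≤ B k
  hB1 : ∀ k ≤ T, B k ≤ d0
  hXP : ∀ k ≤ T, X k + P k ≤ n/2 + e
  hX : ∀ k ≤ T, -d0/2 ≤ X k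
  hP : ∀ k ≤ T, 0 ≤ P k

set_option maxHeartbeats 1000000 in
lemma ode (n d0 η : ℝ) (hn : 0 ≤ n) (hd : 0 ≤ d0) (hη : 0 < η) :
    ∃ e > 0, ∃ l > 1, ∃ N M : ℕ, ∀ X P B : ℕ → ℝ, OdeHyp n d0 e l (N+M) X P B →
      -η ≤ X N + P N - n/2 := by
  set ℓ : ℝ := (4/η) * (n + 2 + 3 * d0/2) with hℓ
  have hℓ0 : 0 < ℓ := by positivity
  set q := (n+d0)/2 with hq
  have hq0 : 0 ≤ q := by positivity
  obtain ⟨a, ha0, ha1, ha2, ha3, ha4⟩ : ∃ a : ℝ, 0 < a ∧ a ≤ 1 ∧ 2*a*n ≤ η/4 ∧ 4*a*d0 ≤ η/4 ∧ (ℓ+1)*(a*q) ≤ η/8 := by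
    have hD : 0 < 1 + 2*n + 4 * d0 + (ℓ+1)*q := by positivity
    have hpos : 0 < min 1 (η/8) / (1 + 2*n + 4 * d0 + (ℓ+1)*q) := by positivity
    set a := min 1 (η/8) / (1 + 2*n + 4 * d0 + (ℓ+1)*q) with ha
    have h : a * (1 + 2*n + 4 * d0 + (ℓ+1)*q) = min 1 (η/8) := by rw [ha]; field_simp
    have h1 : min 1 (η/8) ≤ 1 := min_le_left _ _
    have h2 : min 1 (η/8) ≤ η/8 := min_le_right _ _
    have t1 : 0 ≤ a * n := by positivity
    have t2 : 0 ≤ a * d0 := by positivity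
    have t3 : 0 ≤ a * ((ℓ+1)*q) := by positivity
    refine ⟨a, hpos, ?_, ?_, ?_, ?_⟩ <;> linarith
  set l := 1 + a with hl
  have hl1 : 1 < l := by linarith
  have hl0 : 0 < l := by linarith
  set h := 1 - 1/l with hh
  have hh0 : 0 < h := by rw [hh, sub_pos, div_lt_one hl0]; exact hl1
  have hhl : h * l = a := by rw [hh]; field_simp; rw [hl]; ring
  have hha : h ≤ a := by nlinarith
  set e := min 1 (η / (8 * (ℓ+1))) with he
  have he0 : 0 < e := by positivity
  have he1 : e ≤ 1 := min_le_left _ _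
  have he2 : (ℓ+1) * e ≤ η/8 := by
    have : e ≤ η / (8 * (ℓ+1)) := min_le_right _ _
    rw [le_div_iff₀ (by positivity)] at this; linarith
  set θ := 1/(1+2*(h/l)) with hθ
  have hhl0 : 0 < h / l := by positivity
  have hθ0 : 0 < θ := by positivity
  have hθ1 : θ < 1 := by rw [hθ, div_lt_one (by positivity)]; linarith
  have hθe : θ * (1 + 2*(h/l)) = 1 := by rw [hθ]; field_simp
  obtain ⟨N, hN⟩ : ∃ N : ℕ, (d0/2) * θ^N ≤ η/4 := by
    obtain ⟨N, hN⟩ := exists_pow_lt_of_lt_one (show 0 < (η/4)/(d0/2+1) by positivity) hθ1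
    refine ⟨N, ?_⟩
    rw [lt_div_iff₀ (by positivity)] at hN
    have : 0 < θ^N := by positivity
    linarith
  set M := ⌈ℓ/h⌉₊ with hM
  have hM1 : ℓ ≤ M * h := by
    have := Nat.le_ceil (ℓ/h); rw [← hM] at this; rwa [div_le_iff₀ hh0] at this
  have hM2 : M * h ≤ ℓ + 1 := by
    have := Nat.ceil_lt_add_one (div_nonneg hℓ0.le hh0.le)
    rw [← hM] at this
    have h2 : M * h ≤ (ℓ/h + 1) * h := by gcongr
    have h3 : (ℓ/h + 1) * h = ℓ + h := by field_simp
    linarith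
  refine ⟨e, he0, l, hl1, N, M, fun X P B H => ?_⟩
  have hlogu : Real.log l ≤ a := by have := Real.log_le_sub_one_of_pos hl0; linarith
  have hlogl : h ≤ Real.log l := by
    have := Real.one_sub_inv_le_log_of_pos hl0
    rw [hh]; simpa using this
  -- (A)
  have hA : ∀ k ≤ N+M, -(d0/2) * θ^k - 2*a*n ≤ X k := by
    intro k
    induction k with
    | zero => intro hk; have := H.hX 0 hk; simp; nlinarith [mul_nonneg ha0.le hn]
    | succ k ih =>
      intro hk
      have ih := ih (by omega)
      have h1 := H.h1 k (by omega)
      have h4 := H.hB (k+1) hk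
      rw [← hh] at h1
      have h5 : (h/l) * (n - 2 * X (k+1)) ≤ h/l * B (k+1) := by gcongr
      have h6 : X k + n * (h/l - a) ≤ X (k+1) * (1 + 2*(h/l)) := by
        have : n * Real.log l ≤ n * a := by gcongr
        linarith
      have h7 : 2 * a * (1 + 2 * (h/l)) - 2*a + (h/l - a) ≥ 0 := by
        -- (h/l)(1+4a) ≥ a, h/l = a/l^2
        have e1 : h / l * l^2 = a := by rw [← hhl]; field_simp
        have e2 : l^2 ≤ 1 + 4 * a := by rw [hl]; nlinarith
        have e3 : a ≤ h/l * (1+4*a) := e1.symm.le.trans (mul_le_mul_of_nonneg_left e2 hhl0.le)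
        linarith
      have h8 : (-(d0/2) * θ^(k+1) - 2*a*n) * (1 + 2*(h/l)) ≤ X (k+1) * (1 + 2*(h/l)) := by
        refine le_trans ?_ h6
        have : (-(d0/2) * θ^(k+1) - 2*a*n) * (1 + 2*(h/l)) = -(d0/2) * θ^k * (θ * (1 + 2*(h/l))) - n * (2*a*(1+2*(h/l))) := by
          rw [pow_succ]; ring
        rw [this, hθe]
        have := mul_nonneg hn h7
        linarith
      exact le_of_mul_le_mul_right h8 (by positivity)
  have hXN : -η/2 ≤ X N := by have := hA N (by omega); linarith
  by_contra hcon
  push Not at hcon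
  have hPN : P N ≤ n/2 - η/2 := by linarith
  have hPj : ∀ j ≤ M, P (N+j) ≤ n/2 - η/2 + j * (h * (e + h*q)) := by
    intro j
    induction j with
    | zero => intro _; simpa using hPN
    | succ j ih =>
      intro hj
      have ih := ih (by omega)
      have h3 := H.h3 (N+j) (by omega)
      have h4 := H.hB (N+j+1) (by omega)
      have h5 := H.hXP (N+j+1) (by omega)
      have h6 := H.hX (N+j+1) (by omega)
      rw [← hh] at h3
      rw [← add_assoc]
      have e1 : h / (2*l) = h * (1-h) / 2 := by rw [hh]; field_simp; ring
      rw [e1] at h3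
      have hh1 : 0 < 1 - h := by rw [hh]; simp; exact hl0
      have h7 : h * (1-h)/2 * (n - 2 * X (N+j+1)) ≤ h * (1-h)/2 * B (N+j+1) := by gcongr
      have h8 : h * P (N+j+1) ≤ h * (n/2 + e - X (N+j+1)) := by gcongr; linarith
      have h9 : h * h * (n/2 - X (N+j+1)) ≤ h * h * q := by gcongr; rw [hq]; linarith
      push_cast
      linarith
  have hPj' : ∀ j ≤ M, P (N+j) ≤ n/2 - η/4 := by
    intro j hj
    have h1 := hPj j hj
    have h2 : (j:ℝ) * (h * (e + h*q)) ≤ M * (h * (e+h*q)) := by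
      gcongr
    have h3 : M * (h * (e+h*q)) ≤ (ℓ+1) * (e + a*q) := by
      rw [← mul_assoc]; gcongr
    have h4 : (ℓ+1) * (e + a*q) ≤ η/8 + η/8 := by rw [mul_add]; linarith
    linarith
  have hQ : ∀ j ≤ M, X (N+j) + 2 * P (N+j) + (h/l) * B (N+j) ≤
      X N + 2 * P N + (h/l) * B N - j * (h * (η/4)) := by
    intro j
    induction j with
    | zero => intro _; simp
    | succ j ih =>
      intro hj
      have ih := ih (by omega)
      have h2 := H.h2 (N+j) (by omega)
      have h3 := H.h3 (N+j) (by omega)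
      have hb0 := H.hB0 (N+j) (by omega)
      have hb1 := H.hB1 (N+j) (by omega)
      have hp := hPj' (j+1) hj
      rw [← hh] at h3
      rw [← add_assoc] at hp ⊢
      have e1 : h / (2*l) = (h/l)/2 := by field_simp
      rw [e1] at h3
      have e2 : (l-1) * l = h * l^2 := by
        have : l - 1 = h*l := by rw [hhl, hl]; ring
        rw [this]; ring
      have e3 : h/l = h * (1-h) := by rw [hh]; field_simp; ring
      have c1 : (l-1)*l - h/l ≤ h * (4*a) := by
        rw [e2, e3]
        have : l^2 - (1-h) ≤ 4*a := by rw [hl]; nlinarith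
        have := mul_le_mul_of_nonneg_left this hh0.le
        linarith
      have c2 : ((l-1)*l - h/l) * B (N+j) ≤ h * (4*a) * d0 := by
        calc _ ≤ h * (4*a) * B (N+j) := by gcongr
          _ ≤ _ := by gcongr
      have c3 : h * (4*a*d0) ≤ h * (η/4) := by gcongr
      have c4 : h * P (N+j+1) ≤ h * (n/2 - η/4) := by gcongr
      have c5 : n * h ≤ n * Real.log l := by gcongr
      push_cast
      linarith
  have hf := hQ M le_rfl
  have f1 : ℓ * (η/4) ≤ M * h * (η/4) := by gcongr
  have f2 : ℓ * (η/4) = n + 2 + 3*d0/2 := by rw [hℓ]; field_simp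
  have g1 := H.hX (N+M) le_rfl
  have g2 := H.hP (N+M) le_rfl
  have g3 : 0 ≤ (h/l) * B (N+M) := mul_nonneg hhl0.le (H.hB0 _ le_rfl)
  have g4 := H.hXP N (by omega)
  have g5 : (h/l) * B N ≤ d0 := by
    have a1 := H.hB0 N (by omega)
    have a2 := H.hB1 N (by omega)
    have a3 : h / l ≤ 1 := by rw [div_le_one hl0]; linarith
    nlinarith
  have g6 := hPj' 0 (by omega)
  simp only [add_zero] at g6
  linarith

end PBF
set_option autoImplicit false
set_option linter.unusedSectionVars false
namespace PBF
open Finset MeasureTheory Bornology Filter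
open scoped Pointwise

theorem coreThm {E : Type*} [NormedAddCommGroup E] [InnerProductSpace ℝ E] [MeasurableSpace E] [BorelSpace E]
    {ν : Measure E} [ν.IsAddLeftInvariant] (hν : GaussNu ν) (n : ℕ) (η : ℝ) (hη : 0 < η) :
    ∃ e > 0, ∃ L > 1, ∀ {ι : Type} [Fintype ι] [Nonempty ι] (p : ι → ℝ) (s : ι → E) (G : ℝ),
      (∀ i, 0 < p i) → ∑ i, p i = 1 → 0 < G →
      (∀ r : ℝ, 1/L ≤ r → r ≤ L → ∀ y, gW p (fun j => r • s j) y ≤ G / r^n) →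
      (∀ r : ℝ, 1/L ≤ r → r ≤ L →
        ∫ y, Real.exp (-Metric.infDist y (Set.range fun j => r • s j)^2/2) ∂ν ≤ Real.exp e * r^n / G) →
      ∫ y, |G * Real.exp (-Metric.infDist y (Set.range s)^2/2) - gW p s y| ∂ν ≤ η := by
  set k : ℝ := min 1 (η/2) with hk
  have hk0 : 0 < k := by positivity
  have hk1 : k ≤ 1 := min_le_left _ _
  have hk2 : k ≤ η/2 := min_le_right _ _
  obtain ⟨e1, he1, l, hl, N, M, hode⟩ := ode n (gd0 ν) (k*η/8) (by positivity) (gd0_nonneg ν) (by positivity)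
  have hl0 : 0 < l := by linarith
  set e := min e1 (Real.log (1 + k*η/8)) with he
  have hkη : 0 < k*η/8 := by positivity
  have hlog : 0 < Real.log (1 + k*η/8) := Real.log_pos (by linarith)
  have he0 : 0 < e := lt_min he1 hlog
  have hee : Real.exp e ≤ 1 + k*η/8 := by
    rw [← Real.le_log_iff_exp_le (by linarith)]; exact min_le_right _ _
  refine ⟨e, he0, l^(N+M+1), one_lt_pow₀ hl (by omega), ?_⟩
  intro ι _ _ p s G hp hp1 hG hgr hM
  set r : ℕ → ℝ := fun k => l^k / l^N with hr
  have hr0 : ∀ k, 0 < r k := fun k => by positivity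
  have hrs : ∀ k, r (k+1) = l * r k := fun k => by simp only [hr, pow_succ]; ring
  have hrN : r N = 1 := by simp only [hr]; field_simp
  have hrange : ∀ k ≤ N+M, 1/l^(N+M+1) ≤ r k ∧ r k ≤ l^(N+M+1) := by
    intro k hk
    simp only [hr]
    constructor
    · have a1 : l^N ≤ l^(N+M+1) := pow_le_pow_right₀ hl.le (by omega)
      have a2 : 1 ≤ l^k := one_le_pow₀ hl.le
      gcongr
    · have a1 : l^k ≤ l^(N+M+1) := pow_le_pow_right₀ hl.le (by omega)
      have a2 : 1 ≤ l^N := one_le_pow₀ hl.le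
      rw [div_le_iff₀ (by positivity)]
      nlinarith [show 0 < l^(N+M+1) by positivity]
  set S : ℕ → ι → E := fun k j => r k • s j with hS
  have hSl : ∀ k, (fun j => l • S k j) = S (k+1) := fun k => by
    funext j; simp only [hS, hrs, smul_smul]
  have hSl' : ∀ k, (fun j => (1/l) • S (k+1) j) = S k := fun k => by
    funext j; simp only [hS, hrs, smul_smul]; congr 1; field_simp
  have hlogr : ∀ k, Real.log (r (k+1)) = Real.log l + Real.log (r k) := fun k => by
    rw [hrs, Real.log_mul hl0.ne' (hr0 k).ne']
  have hh0 : 0 < 1 / l := by positivity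
  have hh1 : 1 / l < 1 := by rw [div_lt_one hl0]; exact hl
  have key := hode
    (fun k => - gd0 ν / 2 - gJ ν p (S k) - n * Real.log (r k) + Real.log G + n/2)
    (fun k => (gd0 ν - ge ν p (S k))/2) (fun k => gB ν p (S k)) ?_
  · have hSN : S N = s := by funext j; simp [hS, hrN]
    simp only [hrN, hSN, Real.log_one, mul_zero] at key
    have hcl := closeness hν p hp hp1 s G k e hG hk0 hk1 (by
      have := hM 1 (by simpa [hrN] using (hrange N (by omega)).1) (by simpa [hrN] using (hrange N (by omega)).2)
      simp only [one_smul, one_pow, mul_one] at this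
      rw [le_div_iff₀ hG] at this
      linarith)
    refine hcl.trans ?_
    have : Real.exp e - 1 - (Real.log G - ge ν p s / 2 - gJ ν p s) ≤ k*η/4 := by linarith
    have h2 := mul_le_mul_of_nonneg_left this (show 0 ≤ 2/k by positivity)
    have h3 : 2/k * (k*η/4) = η/2 := by field_simp; ring
    linarith
  · have hlb : ∀ k ≤ N+M, Real.log (G / r k^n) = Real.log G - n * Real.log (r k) := fun k _ => by
      rw [Real.log_div hG.ne' (by have := hr0 k; positivity), Real.log_pow]
    constructor
    · intro k hk
      have := S1 hν p hp hp1 (S (k+1)) (1/l)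
      rw [hSl'] at this
      rw [hlogr]
      have e : (1 - 1/l)/l = -((1/l-1)*(1/l)) := by ring
      rw [e]
      linarith
    · intro k hk
      have := S1 hν p hp hp1 (S k) l
      rw [hSl] at this
      rw [hlogr]
      linarith
    · intro k hk
      have := S3 hν p hp hp1 (S (k+1)) (1/l) hh0 hh1
      rw [hSl'] at this
      have e : (1-1/l)/(2*l) = 1/2 * (1/l * (1-1/l)) := by field_simp
      rw [e]
      linarith
    · intro k hk
      have := SLB hν p hp hp1 (S k) _ (hgr (r k) (hrange k hk).1 (hrange k hk).2)
      rw [hlb k hk] at this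
      linarith
    · exact fun k _ => gB_nonneg hν p hp hp1 _
    · exact fun k _ => gB_le hν p hp hp1 _
    · intro k hk
      have := jensenD hν p hp hp1 (S k) _ (by have := hr0 k; positivity) (hM (r k) (hrange k hk).1 (hrange k hk).2)
      rw [Real.log_div (by have := hr0 k; positivity) hG.ne', Real.log_mul (Real.exp_pos _).ne' (by have := hr0 k; positivity),
        Real.log_exp, Real.log_pow] at this
      have h2 : e ≤ e1 := min_le_left _ _
      linarith
    · intro k hk
      have := gJ_le hν p hp hp1 (S k) _ (hgr (r k) (hrange k hk).1 (hrange k hk).2)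
      rw [hlb k hk] at this
      have : (0:ℝ) ≤ n := by positivity
      linarith
    · intro k hk
      have := ge_le hν p hp hp1 (S k)
      linarith
end PBF
set_option autoImplicit false
set_option linter.unusedSectionVars false
namespace PBF
open Finset MeasureTheory Bornology Filter
open scoped Pointwise ENNReal

lemma greedy {X : Type*} [MeasurableSpace X] (h : Measure X) (pr : OuterMeasure X) (m : Set X → ℝ≥0∞)
    (U : Set (Set X)) (hU : ∀ u ∈ U, MeasurableSet u) (hUe : ∅ ∈ U) (hme : m ∅ = 0)
    (hprm : ∀ u ∈ U, pr u ≤ m u) (hprh : ∀ s, pr s ≤ h s) (K : Set X) (hK : MeasurableSet K)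
    (hKf : h K ≠ ∞) (e a : ℝ≥0∞) (hKe : h K ≤ pr K + e) :
    ∃ K' ⊆ K, MeasurableSet K' ∧ (∀ u ∈ U, h (K' ∩ u) ≤ a * m u) ∧
      a * h (K \ K') ≤ a * e + h (K \ K') := by
  classical
  -- greedy step
  have step : ∀ S : Set X, ∃ u, u ∈ U ∧ (S ⊆ K → a * m u ≤ h (S ∩ u) ∧
      ∀ v ∈ U, a * m v < h (S ∩ v) → h (S ∩ v) ≤ 2 * h (S ∩ u)) := by
    intro S
    by_cases hSK : S ⊆ K
    swap
    · exact ⟨∅, hUe, fun h => (hSK h).elim⟩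
    by_cases hb : ∃ v ∈ U, a * m v < h (S ∩ v)
    swap
    · push Not at hb
      exact ⟨∅, hUe, fun _ => ⟨by simp [hme], fun v hv hlt => ((hb v hv).not_gt hlt).elim⟩⟩
    set B : Set ℝ≥0∞ := {x | ∃ v ∈ U, a * m v < h (S ∩ v) ∧ x = h (S ∩ v)} with hB
    have hfin : sSup B ≠ ∞ := by
      refine ne_top_of_le_ne_top hKf (sSup_le ?_)
      rintro x ⟨v, -, -, rfl⟩
      exact measure_mono (Set.inter_subset_left.trans hSK)
    have hpos : sSup B ≠ 0 := by
      obtain ⟨v, hv, hlt⟩ := hb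
      have : h (S ∩ v) ≤ sSup B := le_sSup ⟨v, hv, hlt, rfl⟩
      intro h0
      rw [h0] at this
      exact not_lt_bot (lt_of_lt_of_le hlt this)
    have hlt : sSup B / 2 < sSup B := ENNReal.half_lt_self hpos hfin
    obtain ⟨x, ⟨u, hu, hu1, rfl⟩, hx⟩ := lt_sSup_iff.1 hlt
    refine ⟨u, hu, fun _ => ⟨hu1.le, fun v hv hv1 => ?_⟩⟩
    have h1 : h (S ∩ v) ≤ sSup B := le_sSup ⟨v, hv, hv1, rfl⟩
    have h2 := (ENNReal.div_le_iff (by norm_num) (by norm_num)).1 hx.le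
    rw [mul_comm]
    exact h1.trans h2
  choose u hu1 hu2 using step
  let Ks : ℕ → Set X := fun k => Nat.rec (motive := fun _ => Set X) K (fun _ S => S \ u S) k
  have Ks0 : Ks 0 = K := rfl
  have KsS : ∀ k, Ks (k+1) = Ks k \ u (Ks k) := fun k => rfl
  have hsub : ∀ k, Ks k ⊆ K := by
    intro k; induction k with
    | zero => exact le_rfl
    | succ k ih => rw [KsS]; exact Set.sdiff_subset.trans ih
  have hmeas : ∀ k, MeasurableSet (Ks k) := by
    intro k; induction k with
    | zero => exact hK
    | succ k ih => rw [KsS]; exact ih.diff (hU _ (hu1 _))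
  have hanti : Antitone Ks := antitone_nat_of_succ_le (fun k => by rw [KsS]; exact Set.sdiff_subset)
  set K' := ⋂ k, Ks k with hK'
  have hK'K : K' ⊆ K := Set.iInter_subset_of_subset 0 le_rfl
  have hK'm : MeasurableSet K' := MeasurableSet.iInter hmeas
  have hunion : K \ K' = ⋃ k, Ks k ∩ u (Ks k) := by
    ext x; constructor
    · rintro ⟨hxK, hx⟩
      rw [hK', Set.mem_iInter] at hx
      push Not at hx
      have hex : ∃ k, x ∉ Ks k := hx
      have h0 : x ∉ Ks (Nat.find hex) := Nat.find_spec hex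
      have h1 : Nat.find hex ≠ 0 := by intro h; rw [h] at h0; exact h0 hxK
      obtain ⟨k, hk⟩ := Nat.exists_eq_succ_of_ne_zero h1
      have h2 : x ∈ Ks k := by
        by_contra hc
        exact Nat.find_min hex (m := k) (by omega) hc
      rw [hk, Nat.succ_eq_add_one, KsS] at h0
      refine Set.mem_iUnion.2 ⟨k, h2, ?_⟩
      by_contra hc; exact h0 ⟨h2, hc⟩
    · intro hx
      obtain ⟨k, hk1, hk2⟩ := Set.mem_iUnion.1 hx
      refine ⟨hsub k hk1, fun hc => ?_⟩
      have := Set.mem_iInter.1 hc (k+1)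
      rw [KsS] at this
      exact this.2 hk2
  have hdisj : Pairwise (Function.onFun Disjoint fun k => Ks k ∩ u (Ks k)) := by
    have : ∀ i j, i < j → Disjoint (Ks i ∩ u (Ks i)) (Ks j ∩ u (Ks j)) := by
      intro i j hij
      rw [Set.disjoint_left]
      rintro x ⟨-, hx⟩ ⟨hx2, -⟩
      have := hanti (show i + 1 ≤ j from hij) hx2
      rw [KsS] at this
      exact this.2 hx
    intro i j hij
    rcases lt_or_gt_of_ne hij with h | h
    · exact this i j h
    · exact (this j i h).symm
  have hsum : h (K \ K') = ∑' k, h (Ks k ∩ u (Ks k)) := by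
    rw [hunion, measure_iUnion hdisj (fun k => (hmeas k).inter (hU _ (hu1 _)))]
  have hfin2 : h (K \ K') ≠ ∞ := ne_top_of_le_ne_top hKf (measure_mono Set.sdiff_subset)
  refine ⟨K', hK'K, hK'm, ?_, ?_⟩
  · intro v hv
    by_contra hc
    push Not at hc
    have h1 : ∀ k, h (K' ∩ v) ≤ h (Ks k ∩ v) := fun k =>
      measure_mono (Set.inter_subset_inter_left _ (Set.iInter_subset _ k))
    have h2 : ∀ k, h (K' ∩ v) ≤ 2 * h (Ks k ∩ u (Ks k)) := fun k =>
      (h1 k).trans ((hu2 (Ks k) (hsub k)).2 v hv (hc.trans_le (h1 k)))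
    have h3 := ENNReal.tendsto_atTop_zero_of_tsum_ne_top (hsum ▸ hfin2)
    have h4 := ENNReal.Tendsto.const_mul h3 (a := 2) (Or.inr (by norm_num))
    rw [mul_zero] at h4
    have h5 := ge_of_tendsto' h4 h2
    exact not_lt_bot (lt_of_lt_of_le hc h5)
  · have hc : pr K ≤ h K' + ∑' k, m (u (Ks k)) := by
      have hcov : K ⊆ K' ∪ ⋃ k, u (Ks k) := by
        intro x hx
        by_cases hx' : x ∈ K'
        · exact Or.inl hx'
        · right
          have : x ∈ K \ K' := ⟨hx, hx'⟩
          rw [hunion] at this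
          obtain ⟨k, hk⟩ := Set.mem_iUnion.1 this
          exact Set.mem_iUnion.2 ⟨k, hk.2⟩
      calc pr K ≤ pr (K' ∪ ⋃ k, u (Ks k)) := measure_mono hcov
        _ ≤ pr K' + pr (⋃ k, u (Ks k)) := measure_union_le _ _
        _ ≤ h K' + ∑' k, pr (u (Ks k)) := add_le_add (hprh _) (measure_iUnion_le _)
        _ ≤ _ := by gcongr with k; exact hprm _ (hu1 _)
    have hdec : h K = h K' + h (K \ K') := by
      rw [← measure_union Set.disjoint_sdiff_right (hK.diff hK'm), Set.union_sdiff_cancel hK'K]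
    have hK'f : h K' ≠ ∞ := ne_top_of_le_ne_top hKf (measure_mono hK'K)
    have h1 : h (K \ K') ≤ ∑' k, m (u (Ks k)) + e := by
      have : h K' + h (K \ K') ≤ h K' + (∑' k, m (u (Ks k)) + e) := by
        rw [← hdec, ← add_assoc]
        exact hKe.trans (by gcongr)
      exact (ENNReal.add_le_add_iff_left hK'f).1 this
    calc a * h (K \ K') ≤ a * (∑' k, m (u (Ks k)) + e) := by gcongr
      _ = ∑' k, a * m (u (Ks k)) + a * e := by rw [mul_add, ENNReal.tsum_mul_left]
      _ ≤ h (K \ K') + a * e := by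
        rw [hsum]; gcongr with k
        exact (hu2 (Ks k) (hsub k)).1
      _ = _ := add_comm _ _

lemma hausdorff_growth {X : Type*} [MetricSpace X] [MeasurableSpace X] [BorelSpace X] (n : ℕ) (hn : 1 ≤ n)
    (K : Set X) (hK : MeasurableSet K) (hKf : Measure.hausdorffMeasure (n:ℝ) K ≠ ∞) (a : ℝ≥0∞)
    (e : ℝ≥0∞) (he : e ≠ 0) :
    ∃ K' ⊆ K, MeasurableSet K' ∧ ∃ δ > 0, (∀ u : Set X, IsClosed u → Metric.ediam u ≤ δ →
      Measure.hausdorffMeasure (n:ℝ) (K' ∩ u) ≤ a * Metric.ediam u ^ n) ∧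
      a * Measure.hausdorffMeasure (n:ℝ) (K \ K') ≤ a * e + Measure.hausdorffMeasure (n:ℝ) (K \ K') := by
  have hco : ∀ s : Set X, OuterMeasure.mkMetric (fun r : ℝ≥0∞ => r ^ (n:ℝ)) s = Measure.hausdorffMeasure (n:ℝ) s := by
    intro s
    rw [OuterMeasure.coe_mkMetric]; rfl
  have ht := OuterMeasure.mkMetric'.tendsto_pre (fun s : Set X => Metric.ediam s ^ (n:ℝ)) K
  have hlim : OuterMeasure.mkMetric' (fun s : Set X => Metric.ediam s ^ (n:ℝ)) K = Measure.hausdorffMeasure (n:ℝ) K := hco K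
  rw [hlim] at ht
  have hev : ∀ᶠ r in nhdsWithin (0:ℝ≥0∞) (Set.Ioi 0), Measure.hausdorffMeasure (n:ℝ) K ≤
      OuterMeasure.mkMetric'.pre (fun s : Set X => Metric.ediam s ^ (n:ℝ)) r K + e := by
    by_cases h0 : Measure.hausdorffMeasure (n:ℝ) K = 0
    · exact Eventually.of_forall (fun r => by rw [h0]; exact bot_le)
    · have hlt : Measure.hausdorffMeasure (n:ℝ) K - e < Measure.hausdorffMeasure (n:ℝ) K :=
        ENNReal.sub_lt_self hKf h0 he
      filter_upwards [ht.eventually (lt_mem_nhds hlt)] with r hr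
      exact tsub_le_iff_right.1 hr.le
  obtain ⟨δ, hδ, hδ0⟩ := (hev.and self_mem_nhdsWithin).exists
  have hδ0 : 0 < δ := hδ0
  obtain ⟨K', h1, h2, h3, h4⟩ := greedy (Measure.hausdorffMeasure (n:ℝ))
    (OuterMeasure.mkMetric'.pre (fun s : Set X => Metric.ediam s ^ (n:ℝ)) δ) (fun s => Metric.ediam s ^ (n:ℝ))
    {u | IsClosed u ∧ Metric.ediam u ≤ δ} (fun u hu => hu.1.measurableSet) ⟨isClosed_empty, by simp⟩
    (by simp; omega) (fun u hu => OuterMeasure.mkMetric'.pre_le hu.2)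
    (fun s => by
      rw [← hco s]
      have : OuterMeasure.mkMetric'.pre (fun s : Set X => Metric.ediam s ^ (n:ℝ)) δ ≤
        OuterMeasure.mkMetric (fun r : ℝ≥0∞ => r ^ (n:ℝ)) := by
        unfold OuterMeasure.mkMetric OuterMeasure.mkMetric'
        exact le_iSup₂_of_le δ hδ0 le_rfl
      exact this s)
    K hK hKf e a hδ
  refine ⟨K', h1, h2, δ, hδ0, fun u hu hud => ?_, h4⟩
  have := h3 u ⟨hu, hud⟩
  simpa using this
end PBF
set_option autoImplicit false
set_option linter.unusedSectionVars false
namespace PBF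
open Finset MeasureTheory Bornology Filter
open scoped Pointwise ENNReal

abbrev Eu (d : ℕ) := EuclideanSpace ℝ (Fin d)

noncomputable def cn (n : ℕ) : ℝ := (2 * Real.pi) ^ ((n:ℝ)/2)
lemma cn_pos (n : ℕ) : 0 < cn n := by unfold cn; positivity
lemma cn_add (a b : ℕ) : cn (a + b) = cn a * cn b := by
  unfold cn; rw [← Real.rpow_add (by positivity)]; congr 1; push_cast; ring

lemma gauss_integrable (d : ℕ) (b : ℝ) (hb : 0 < b) : Integrable (fun y : Eu d => Real.exp (-b * ‖y‖^2)) := by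
  have := GaussianFourier.integrable_cexp_neg_mul_sq_norm_add (V := Eu d) (b := (b:ℂ)) (by simpa using hb) 0 0
  have h2 := this.norm
  refine h2.congr (Eventually.of_forall fun y => ?_)
  simp only [Complex.norm_exp]
  congr 1
  simp
  norm_cast
  exact Or.inl rfl

lemma ph0_eq (d : ℕ) (y : Eu d) : ph 0 y = Real.exp (-(1/2) * ‖y‖^2) := by
  unfold ph; congr 1; rw [sub_zero]; ring

lemma integral_ph0 (d : ℕ) : ∫ y : Eu d, ph 0 y = cn d := by
  simp_rw [ph0_eq]
  rw [GaussianFourier.integral_rexp_neg_mul_sq_norm (by norm_num)]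
  unfold cn
  simp [finrank_euclideanSpace]
  congr 1; ring

lemma integrable_ph0 (d : ℕ) : Integrable (fun y : Eu d => ph 0 y) := by
  simp_rw [ph0_eq]; exact gauss_integrable d _ (by norm_num)

lemma lintegral_ph0 (d : ℕ) : ∫⁻ y : Eu d, ENNReal.ofReal (ph 0 y) = ENNReal.ofReal (cn d) := by
  rw [← ofReal_integral_eq_lintegral_ofReal (integrable_ph0 d) (Eventually.of_forall fun y => (ph_pos _ _).le), integral_ph0]

noncomputable def nuG (d : ℕ) : Measure (Eu d) := ENNReal.ofReal (cn d)⁻¹ • volume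
noncomputable instance (d : ℕ) : (nuG d).IsAddLeftInvariant := by unfold nuG; infer_instance

lemma gaussNu (d : ℕ) : GaussNu (nuG d) where
  int0 := (integrable_ph0 d).smul_measure (by simp)
  int1 := by
    unfold nuG
    rw [integral_smul_measure, integral_ph0, ENNReal.toReal_ofReal (by have := cn_pos d; positivity), smul_eq_mul,
      inv_mul_cancel₀ (cn_pos d).ne']
  int2 := by
    refine Integrable.smul_measure ?_ (by simp)
    refine ((gauss_integrable d (1/4) (by norm_num)).const_mul 4).mono' ?_ (Eventually.of_forall fun y => ?_)
    · exact ((continuous_ph 0).mul (by fun_prop)).aestronglyMeasurable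
    · rw [Real.norm_of_nonneg (mul_nonneg (ph_pos _ _).le (sq_nonneg _)), ph0_eq]
      have h1 : Real.exp (-(1/2) * ‖y‖^2) = Real.exp (-(1/4) * ‖y‖^2) * Real.exp (-(1/4) * ‖y‖^2) := by
        rw [← Real.exp_add]; congr 1; ring
      have h2 : Real.exp (-(1/4) * ‖y‖^2) * ‖y‖^2 ≤ 4 := by
        have := Real.add_one_le_exp ((1/4) * ‖y‖^2)
        have h3 : Real.exp (-(1/4) * ‖y‖^2) * Real.exp ((1/4) * ‖y‖^2) = 1 := by
          rw [← Real.exp_add]; simp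
        have h4 := Real.exp_pos (-(1/4) * ‖y‖^2)
        nlinarith
      rw [h1, mul_assoc]
      nlinarith [Real.exp_pos (-(1/4) * ‖y‖^2)]

lemma lt_exp_iff {t x : ℝ} (ht : 0 < t) (_ht1 : t < 1) (hx : 0 ≤ x) :
    t < Real.exp (-x^2/2) ↔ x < Real.sqrt (-2 * Real.log t) := by
  rw [← Real.log_lt_iff_lt_exp ht, Real.lt_sqrt hx]
  constructor <;> intro h <;> linarith

lemma level_eq (k : ℕ) {t : ℝ} (ht : 0 < t) (ht1 : t < 1) :
    {x : Eu k | t < ph 0 x} = Metric.ball 0 (Real.sqrt (-2 * Real.log t)) := by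
  ext x
  simp only [Set.mem_ofPred_eq, ph, sub_zero, mem_ball_zero_iff]
  exact lt_exp_iff ht ht1 (norm_nonneg _)

lemma vol_ball_scale (k : ℕ) (x : Eu k) (r c : ℝ) (hc : 0 < c) (hr : 0 < r) :
    volume (Metric.ball x (c * r)) = ENNReal.ofReal (c^k) * volume (Metric.ball (0 : Eu k) r) := by
  rw [Measure.addHaar_ball_of_pos _ _ (by positivity), Measure.addHaar_ball_of_pos _ (0 : Eu k) hr, ← mul_assoc,
    ← ENNReal.ofReal_mul (by positivity), finrank_euclideanSpace, Fintype.card_fin, mul_pow]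

lemma layer (k : ℕ) : ∫⁻ t in Set.Ioi (0:ℝ), volume {x : Eu k | t < ph 0 x} = ENNReal.ofReal (cn k) := by
  rw [← lintegral_ph0, lintegral_eq_lintegral_meas_lt]
  · exact Eventually.of_forall fun y => (ph_pos _ _).le
  · exact (continuous_ph 0).aemeasurable

lemma growth_gauss (n d : ℕ) (μ : Measure (Eu d)) (hμ : μ Set.univ ≤ 1) (a : ℝ≥0∞) (δ : ℝ) (hδ : 0 < δ)
    (hg : ∀ y ρ, 0 < ρ → ρ ≤ δ → μ (Metric.closedBall y ρ) ≤ a * volume (Metric.ball (0 : Eu n) ρ))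
    (r : ℝ) (hr : 0 < r) (y : Eu d) :
    ∫⁻ s, ENNReal.ofReal (ph (r • s) y) ∂μ ≤ a * ENNReal.ofReal (cn n / r^n) +
      ENNReal.ofReal (Real.exp (-(δ*r)^2/2)) := by
  have hcont : Continuous fun s : Eu d => ph (r • s) y := by unfold ph; fun_prop
  rw [lintegral_eq_lintegral_meas_lt _ (Eventually.of_forall fun s => (ph_pos _ _).le) hcont.aemeasurable]
  have hb : ∀ t ∈ Set.Ioi (0:ℝ), μ {s | t < ph (r • s) y} ≤
      (a * ENNReal.ofReal (1/r^n)) * volume {x : Eu n | t < ph 0 x} +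
        Set.indicator (Set.Iio (Real.exp (-(δ*r)^2/2))) (fun _ => 1) t := by
    intro t ht
    have ht : 0 < t := ht
    by_cases ht1 : t < 1
    swap
    · have : {s : Eu d | t < ph (r • s) y} = ∅ := by
        ext s; simp only [Set.mem_ofPred_eq, Set.mem_empty_iff_false, iff_false, not_lt]
        exact (ph_le_one _ _).trans (not_lt.1 ht1)
      rw [this]; simp
    set ρ := Real.sqrt (-2 * Real.log t) with hρ
    have hρ0 : 0 < ρ := by
      have := Real.log_neg ht ht1
      exact Real.sqrt_pos.2 (by linarith)
    have hsub : {s : Eu d | t < ph (r • s) y} ⊆ Metric.closedBall ((1/r) • y) ((1/r) * ρ) := by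
      intro s hs
      simp only [Set.mem_ofPred_eq, ph] at hs
      rw [lt_exp_iff ht ht1 (norm_nonneg _)] at hs
      rw [mem_closedBall_iff_norm]
      have e : s - (1/r) • y = -((1/r) • (y - r • s)) := by
        rw [smul_sub, smul_smul]; field_simp; simp
      rw [e, norm_neg, norm_smul, Real.norm_of_nonneg (by positivity)]
      gcongr
    by_cases hc : (1/r) * ρ ≤ δ
    · calc _ ≤ μ (Metric.closedBall ((1/r) • y) ((1/r) * ρ)) := measure_mono hsub
        _ ≤ a * volume (Metric.ball (0 : Eu n) ((1/r) * ρ)) := hg _ _ (by positivity) hc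
        _ = (a * ENNReal.ofReal (1/r^n)) * volume {x : Eu n | t < ph 0 x} := by
          rw [level_eq n ht ht1, vol_ball_scale _ _ _ _ (by positivity) hρ0, mul_assoc, div_pow, one_pow]
        _ ≤ _ := le_self_add
    · have h1 : t < Real.exp (-(δ*r)^2/2) := by
        rw [lt_exp_iff ht ht1 (by positivity), ← hρ]
        push Not at hc
        rw [one_div, inv_mul_eq_div, lt_div_iff₀ hr] at hc
        exact hc
      calc _ ≤ μ Set.univ := measure_mono (Set.subset_univ _)
        _ ≤ 1 := hμ
        _ = Set.indicator (Set.Iio (Real.exp (-(δ*r)^2/2))) (fun _ => 1) t := by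
          rw [Set.indicator_of_mem]; exact h1
        _ ≤ _ := le_add_self
  calc _ ≤ ∫⁻ t in Set.Ioi (0:ℝ), ((a * ENNReal.ofReal (1/r^n)) * volume {x : Eu n | t < ph 0 x} +
        Set.indicator (Set.Iio (Real.exp (-(δ*r)^2/2))) (fun _ => 1) t) :=
        setLIntegral_mono' measurableSet_Ioi hb
    _ = (a * ENNReal.ofReal (1/r^n)) * ENNReal.ofReal (cn n) + ENNReal.ofReal (Real.exp (-(δ*r)^2/2)) := by
        rw [lintegral_add_right _ (measurable_const.indicator measurableSet_Iio)]
        congr 1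
        · rw [lintegral_const_mul, layer]
          have : Antitone (fun t : ℝ => volume {x : Eu n | t < ph 0 x}) :=
            fun s t hst => measure_mono (fun x hx => lt_of_le_of_lt hst hx)
          exact this.measurable
        · rw [lintegral_indicator measurableSet_Iio]
          rw [Measure.restrict_restrict measurableSet_Iio, Set.inter_comm, Set.Ioi_inter_Iio, setLIntegral_one, Real.volume_Ioo, sub_zero]
    _ ≤ _ := by
        rw [mul_assoc, ← ENNReal.ofReal_mul (by positivity)]
        gcongr
        exact le_of_eq (by ring)

lemma thickening_smul {d : ℕ} (K : Set (Eu d)) (r ρ : ℝ) (hr : 0 < r) :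
    Metric.thickening ρ (r • K) = r • Metric.thickening (ρ / r) K := by
  ext x
  rw [Set.mem_smul_set_iff_inv_smul_mem₀ hr.ne', Metric.mem_thickening_iff, Metric.mem_thickening_iff]
  constructor
  · rintro ⟨z, ⟨w, hw, rfl⟩, hz⟩
    refine ⟨w, hw, ?_⟩
    have : dist x (r • w) = r * dist (r⁻¹ • x) w := by
      conv_lhs => rw [← smul_inv_smul₀ hr.ne' x]
      rw [dist_smul₀, Real.norm_of_nonneg hr.le]
    rw [lt_div_iff₀ hr]
    simp only at hz
    linarith
  · rintro ⟨w, hw, hz⟩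
    refine ⟨r • w, ⟨w, hw, rfl⟩, ?_⟩
    have : dist x (r • w) = r * dist (r⁻¹ • x) w := by
      conv_lhs => rw [← smul_inv_smul₀ hr.ne' x]
      rw [dist_smul₀, Real.norm_of_nonneg hr.le]
    rw [lt_div_iff₀ hr] at hz
    linarith

lemma vol_smul {d : ℕ} (K : Set (Eu d)) (r : ℝ) (hr : 0 < r) :
    volume (r • K) = ENNReal.ofReal (r^d) * volume K := by
  rw [Measure.addHaar_smul_of_nonneg _ hr.le, finrank_euclideanSpace, Fintype.card_fin]

lemma mink_gauss (n d : ℕ) (hnd : n ≤ d) (K : Set (Eu d)) (hKne : K.Nonempty) (D : ℝ) (hD : 0 < D)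
    (hKD : K ⊆ Metric.ball 0 D) (a : ℝ≥0∞) (δ : ℝ) (hδ : 0 < δ)
    (hg : ∀ ρ, 0 < ρ → ρ < δ → volume (Metric.thickening ρ K) ≤ a * volume (Metric.ball (0 : Eu (d-n)) ρ))
    (r : ℝ) (hr : 0 < r) :
    ∫⁻ y, ENNReal.ofReal (Real.exp (-Metric.infDist y (r • K)^2/2)) ≤
      a * ENNReal.ofReal (r^n * cn (d-n)) + ENNReal.ofReal ((D/δ+1)^d * cn d) := by
  have hcont : Continuous fun y : Eu d => Real.exp (-Metric.infDist y (r • K)^2/2) := by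
    have := Metric.continuous_infDist_pt (r • K); fun_prop
  rw [lintegral_eq_lintegral_meas_lt _ (Eventually.of_forall fun s => (Real.exp_pos _).le) hcont.aemeasurable]
  have hrK : (r • K).Nonempty := hKne.smul_set
  have hb : ∀ t ∈ Set.Ioi (0:ℝ), volume {y | t < Real.exp (-Metric.infDist y (r • K)^2/2)} ≤
      (a * ENNReal.ofReal (r^n)) * volume {x : Eu (d-n) | t < ph 0 x} +
        ENNReal.ofReal ((D/δ+1)^d) * volume {x : Eu d | t < ph 0 x} := by
    intro t ht
    have ht : 0 < t := ht
    by_cases ht1 : t < 1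
    swap
    · have : {y | t < Real.exp (-Metric.infDist y (r • K)^2/2)} = ∅ := by
        ext s; simp only [Set.mem_ofPred_eq, Set.mem_empty_iff_false, iff_false, not_lt]
        refine le_trans ?_ (not_lt.1 ht1)
        rw [Real.exp_le_one_iff]; nlinarith [sq_nonneg (Metric.infDist s (r • K))]
      rw [this]; simp
    set ρ := Real.sqrt (-2 * Real.log t) with hρ
    have hρ0 : 0 < ρ := by
      have := Real.log_neg ht ht1
      exact Real.sqrt_pos.2 (by linarith)
    have hset : {y | t < Real.exp (-Metric.infDist y (r • K)^2/2)} = Metric.thickening ρ (r • K) := by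
      ext y
      rw [Set.mem_ofPred_eq, lt_exp_iff ht ht1 Metric.infDist_nonneg, Metric.mem_thickening_iff, Metric.infDist_lt_iff hrK]
    rw [hset, level_eq _ ht ht1, level_eq _ ht ht1]
    by_cases hc : ρ / r < δ
    · rw [thickening_smul _ _ _ hr, vol_smul _ _ hr]
      calc _ ≤ ENNReal.ofReal (r^d) * (a * volume (Metric.ball (0 : Eu (d-n)) (ρ / r))) := by
            gcongr; exact hg _ (by positivity) hc
        _ = a * ENNReal.ofReal (r^n) * volume (Metric.ball (0 : Eu (d-n)) ρ) := by
            rw [div_eq_inv_mul, vol_ball_scale _ _ _ _ (by positivity) hρ0]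
            have : r^n = r^d * r⁻¹^(d-n) := by
              rw [inv_pow, ← div_eq_mul_inv, eq_div_iff (by positivity), ← pow_add]; congr 1; omega
            rw [this, ENNReal.ofReal_mul (by positivity)]
            ring
        _ ≤ _ := le_self_add
    · push Not at hc
      have hsub : Metric.thickening ρ (r • K) ⊆ Metric.ball 0 ((D/δ+1) * ρ) := by
        intro y hy
        obtain ⟨z, ⟨w, hw, rfl⟩, hz⟩ := Metric.mem_thickening_iff.1 hy
        have hw2 := hKD hw
        rw [mem_ball_zero_iff] at hw2 ⊢
        rw [dist_eq_norm] at hz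
        have h1 : ‖y‖ ≤ ‖y - r • w‖ + ‖r • w‖ := by
          have := norm_add_le (y - r • w) (r • w); simpa using this
        rw [norm_smul, Real.norm_of_nonneg hr.le] at h1
        have h2 : r * ‖w‖ ≤ r * D := by gcongr
        have h3 : r * D ≤ D/δ * ρ := by
          rw [le_div_iff₀ hr] at hc
          have : D/δ * ρ = D * (ρ / δ) := by ring
          rw [this, mul_comm r]
          gcongr
          rw [le_div_iff₀ hδ]; linarith
        simp only at hz
        linarith
      calc _ ≤ volume (Metric.ball (0 : Eu d) ((D/δ+1) * ρ)) := measure_mono hsub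
        _ = ENNReal.ofReal ((D/δ+1)^d) * volume (Metric.ball (0 : Eu d) ρ) := vol_ball_scale _ _ _ _ (by positivity) hρ0
        _ ≤ _ := le_add_self
  have hmeas : ∀ k : ℕ, Measurable (fun t : ℝ => volume {x : Eu k | t < ph 0 x}) := fun k =>
    Antitone.measurable (fun s t hst => measure_mono (fun x hx => lt_of_le_of_lt hst hx))
  calc _ ≤ ∫⁻ t in Set.Ioi (0:ℝ), ((a * ENNReal.ofReal (r^n)) * volume {x : Eu (d-n) | t < ph 0 x} +
        ENNReal.ofReal ((D/δ+1)^d) * volume {x : Eu d | t < ph 0 x}) :=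
        setLIntegral_mono' measurableSet_Ioi hb
    _ = _ := by
        rw [lintegral_add_left ((hmeas _).const_mul _), lintegral_const_mul _ (hmeas _),
          lintegral_const_mul _ (hmeas _), layer, layer, mul_assoc, ← ENNReal.ofReal_mul (by positivity),
          ← ENNReal.ofReal_mul (by positivity)]
end PBF
set_option autoImplicit false
set_option linter.unusedSectionVars false
namespace PBF
open Finset MeasureTheory Bornology Filter
open scoped Pointwise ENNReal

lemma gl_lip {a b : ℝ} (ha : 0 ≤ a) (hb : 0 ≤ b) :
    |Real.exp (-a^2/2) - Real.exp (-b^2/2)| ≤ 2 * |a - b| := by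
  wlog hab : a ≤ b generalizing a b
  · have := this hb ha (le_of_not_ge hab)
    rwa [abs_sub_comm, abs_sub_comm b a] at this
  have h1 : Real.exp (-b^2/2) ≤ Real.exp (-a^2/2) := by
    apply Real.exp_le_exp.2; nlinarith
  rw [abs_of_nonneg (by linarith), abs_sub_comm, abs_of_nonneg (by linarith : (0:ℝ) ≤ b - a)]
  have h2 : Real.exp (-a^2/2) ≤ 1 := Real.exp_le_one_iff.2 (by nlinarith)
  have h3 := Real.exp_pos (-b^2/2)
  have h3' := Real.exp_pos (-a^2/2)
  by_cases h : b ≤ a + 1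
  swap
  · linarith
  have h4 : Real.exp (-b^2/2) = Real.exp (-a^2/2) * Real.exp (-(b^2-a^2)/2) := by
    rw [← Real.exp_add]; congr 1; ring
  have h5 := Real.add_one_le_exp (-(b^2-a^2)/2)
  have h6 : Real.exp (-a^2/2) * (a + b) ≤ 4 := by
    have h7 := Real.add_one_le_exp (a^2/2)
    have h8 : Real.exp (-a^2/2) * Real.exp (a^2/2) = 1 := by rw [← Real.exp_add]; simp [neg_div]
    have h9 : a + b ≤ 4 * (a^2/2 + 1) := by nlinarith [sq_nonneg (a-1)]
    calc _ ≤ Real.exp (-a^2/2) * (4 * Real.exp (a^2/2)) := by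
            apply mul_le_mul_of_nonneg_left _ h3'.le; linarith
      _ = 4 := by linarith
  have h10 : Real.exp (-a^2/2) - Real.exp (-b^2/2) ≤ Real.exp (-a^2/2) * ((b^2-a^2)/2) := by
    rw [h4]; nlinarith
  have h11 : Real.exp (-a^2/2) * ((b^2-a^2)/2) = (Real.exp (-a^2/2) * (a + b)) * (b - a) / 2 := by ring
  rw [h11] at h10
  nlinarith

lemma ph_lip {d : ℕ} (x x' y : Eu d) : |ph x y - ph x' y| ≤ 2 * ‖x - x'‖ := by
  refine (gl_lip (norm_nonneg (y - x)) (norm_nonneg (y - x'))).trans ?_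
  have := abs_norm_sub_norm_le (y - x) (y - x')
  rw [show y - x - (y - x') = -(x - x') by abel, norm_neg] at this
  linarith

lemma discretize {d : ℕ} (K : Set (Eu d)) (hK : IsCompact K) (hKne : K.Nonempty) (μ : Measure (Eu d))
    [IsProbabilityMeasure μ] (hμ : μ Kᶜ = 0) (δ : ℝ) (hδ : 0 < δ) :
    ∃ (ι : Type) (_ : Fintype ι) (_ : Nonempty ι) (p : ι → ℝ) (s : ι → Eu d),
      (∀ i, 0 < p i) ∧ ∑ i, p i = 1 ∧ (∀ i, s i ∈ K) ∧
      ∀ (f : Eu d → ℝ) (Λ : ℝ), Continuous f → Integrable f μ → (∀ x y, |f x - f y| ≤ Λ * ‖x - y‖) → 0 ≤ Λ →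
        ∑ i, p i * f (s i) ≤ ∫ x, f x ∂μ + Λ * δ := by
  classical
  obtain ⟨t, htK, htf, hcov⟩ := hK.finite_cover_balls hδ
  have htne : t.Nonempty := by
    obtain ⟨x, hx⟩ := hKne
    obtain ⟨y, hy, _⟩ := Set.mem_iUnion₂.1 (hcov hx)
    exact ⟨y, hy⟩
  obtain ⟨e, he⟩ := htf.countable.exists_eq_range htne
  have hN : ∃ N : ℕ, ∀ y ∈ t, ∃ k ≤ N, e k = y := by
    have : ∀ y ∈ t, ∃ k, e k = y := fun y hy => by rw [he] at hy; exact hy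
    choose! k hk using this
    refine ⟨htf.toFinset.sup k, fun y hy => ⟨k y, ?_, hk y hy⟩⟩
    exact Finset.le_sup (f := k) (htf.mem_toFinset.2 hy)
  obtain ⟨N, hN⟩ := hN
  set T := SimpleFunc.nearestPt e N with hT
  have hTt : ∀ x, T x ∈ t := by
    intro x
    have : ∃ k, T x = e k := by
      rw [hT, SimpleFunc.nearestPt]; exact ⟨_, rfl⟩
    obtain ⟨k, hk⟩ := this
    rw [hk, he]; exact ⟨k, rfl⟩
  have hTd : ∀ x ∈ K, ‖T x - x‖ ≤ δ := by
    intro x hx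
    obtain ⟨y, hy, hxy⟩ := Set.mem_iUnion₂.1 (hcov hx)
    obtain ⟨k, hk, rfl⟩ := hN y hy
    have h1 := SimpleFunc.edist_nearestPt_le e x hk
    rw [← dist_eq_norm]
    rw [edist_dist, edist_dist, ENNReal.ofReal_le_ofReal_iff dist_nonneg] at h1
    rw [Metric.mem_ball, dist_comm] at hxy
    exact h1.trans hxy.le
  let P : Finset (Eu d) := T.range.filter (fun v => 0 < μ.real (T ⁻¹' {v}))
  have hsum : ∀ f : Eu d → ℝ, ∑ v : P, μ.real (T ⁻¹' {v.1}) * f v.1 = ∫ x, f (T x) ∂μ := by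
    intro f
    have h1 : ∀ x, f (T x) = ∑ v ∈ T.range, Set.indicator (T ⁻¹' {v}) (fun _ => f v) x := by
      intro x
      rw [Finset.sum_eq_single (T x)]
      · rw [Set.indicator_of_mem]; rfl
      · intro v _ hv
        rw [Set.indicator_of_notMem]
        intro h; exact hv h.symm
      · intro h; exact absurd (SimpleFunc.mem_range_self T x) h
    simp_rw [h1]
    rw [integral_finsetSum]
    swap
    · intro v _; exact (integrable_const _).indicator (T.measurableSet_fiber v)
    simp_rw [integral_indicator (T.measurableSet_fiber _), setIntegral_const, smul_eq_mul]
    · rw [Finset.sum_coe_sort P (fun v => μ.real (T ⁻¹' {v}) * f v), Finset.sum_filter]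
      apply Finset.sum_congr rfl
      intro v _
      split_ifs with h
      · rfl
      · have : μ.real (T ⁻¹' {v}) = 0 := le_antisymm (not_lt.1 h) measureReal_nonneg
        simp [this]
  have h1 := hsum (fun _ => 1)
  simp only [mul_one, integral_const, smul_eq_mul, probReal_univ] at h1
  refine ⟨P, inferInstance, ?_, fun v => μ.real (T ⁻¹' {v.1}), fun v => v.1, ?_, h1, ?_, ?_⟩
  · by_contra hne
    rw [not_nonempty_iff] at hne
    simp at h1
  · intro v; exact (Finset.mem_filter.1 v.2).2
  · intro v
    obtain ⟨x, hx⟩ := SimpleFunc.mem_range.1 (Finset.mem_filter.1 v.2).1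
    show v.1 ∈ K
    rw [← hx]; exact htK (hTt x)
  · intro f Λ hfc hf hΛ hΛ0
    rw [hsum f]
    have hae : ∀ᵐ x ∂μ, x ∈ K := by rw [ae_iff]; exact hμ
    have : ∫ x, f (T x) ∂μ ≤ ∫ x, (f x + Λ * δ) ∂μ := by
      apply integral_mono_ae
      · exact SimpleFunc.integrable_of_isFiniteMeasure (T.map f)
      · exact hf.add (integrable_const _)
      · filter_upwards [hae] with x hx
        have h1 := hΛ (T x) x
        have h2 := hTd x hx
        have h3 := le_abs_self (f (T x) - f x)
        have h4 := mul_le_mul_of_nonneg_left h2 hΛ0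
        linarith
    rwa [integral_add hf (integrable_const _), integral_const, probReal_univ, one_smul] at this

end PBF
set_option autoImplicit false
set_option linter.unusedSectionVars false
namespace PBF
open Finset MeasureTheory Bornology Filter
open scoped Pointwise ENNReal

lemma tail_small (n : ℕ) (δ c : ℝ) (hδ : 0 < δ) (hc : 0 < c) :
    ∃ R > 0, ∀ r ≥ R, Real.exp (-(δ*r)^2/2) ≤ c / r^n := by
  have h := Real.tendsto_pow_mul_exp_neg_atTop_nhds_zero n
  have h2 := h.comp (tendsto_id.const_mul_atTop hδ)
  have h3 : ∀ᶠ r in atTop, (δ*r)^n * Real.exp (-(δ*r)) < c * δ^n := by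
    have := (h2.eventually (gt_mem_nhds (show 0 < c * δ^n by positivity)))
    simpa using this
  obtain ⟨R, hR⟩ := eventually_atTop.1 h3
  refine ⟨max R (max 1 (2/δ)), by positivity, fun r hr => ?_⟩
  have hr1 : 1 ≤ r := le_trans (by simp) hr
  have hr2 : 2/δ ≤ r := le_trans (by simp) hr
  have := hR r (le_trans (by simp) hr)
  rw [div_le_iff₀ hδ] at hr2
  have h4 : Real.exp (-(δ*r)^2/2) ≤ Real.exp (-(δ*r)) := by
    apply Real.exp_le_exp.2; nlinarith
  rw [le_div_iff₀ (by positivity)]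
  rw [mul_pow] at this
  have hδn : 0 < δ^n := by positivity
  have hrn : 0 < r^n := by positivity
  have h5 : r^n * Real.exp (-(δ*r)) < c := by
    by_contra hh
    push Not at hh
    nlinarith
  nlinarith

lemma growth_measure (n d : ℕ) (hn : 1 ≤ n) (K : Set (Eu d)) (hK : IsCompact K) (m : ℝ) (hm : 0 < m)
    (hH : normHausdorff n d K = ENNReal.ofReal m) (m2 : ℝ) (hm2 : 0 < m2) (hm2m : m2 < m) :
    ∃ μ : Measure (Eu d), IsProbabilityMeasure μ ∧ μ Kᶜ = 0 ∧ ∃ R > 0, ∀ r ≥ R, ∀ y,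
      ∫⁻ s, ENNReal.ofReal (ph (r • s) y) ∂μ ≤ ENNReal.ofReal (cn n / (m2 * r^n)) := by
  set b : ℝ≥0∞ := volume (Metric.ball (0 : Eu n) 1) / 2^n with hb
  have hb0 : b ≠ 0 := by
    rw [hb]; refine (ENNReal.div_pos (Metric.measure_ball_pos _ _ one_pos).ne' (by simp)).ne'
  have hbt : b ≠ ∞ := by
    rw [hb]; exact ENNReal.div_ne_top measure_ball_lt_top.ne (by simp)
  have hH' : b * μH[n] K = ENNReal.ofReal m := by rw [← hH]; rfl
  have hKf : μH[n] K ≠ ∞ := by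
    intro h; rw [h, ENNReal.mul_top hb0] at hH'; simp at hH'
  set b0 := b.toReal with hb0'
  have hbb : b = ENNReal.ofReal b0 := (ENNReal.ofReal_toReal hbt).symm
  have hb0p : 0 < b0 := ENNReal.toReal_pos hb0 hbt
  obtain ⟨m1, hm21, hm1m⟩ := exists_between hm2m
  have hm1 : 0 < m1 := hm2.trans hm21
  obtain ⟨a0, ha1, ha2⟩ := exists_between (show (1:ℝ) < m1 / m2 by rw [lt_div_iff₀ hm2]; linarith)
  have ha0 : 0 < a0 := by linarith
  rw [lt_div_iff₀ hm2] at ha2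
  set e0 := (a0 - 1) * (m - m1) / (a0 * b0) with he0
  have he0p : 0 < e0 := by
    have : 0 < a0 - 1 := by linarith
    have : 0 < m - m1 := by linarith
    positivity
  obtain ⟨K', hK'K, hK'm, δ, hδ, hg, hsm⟩ := hausdorff_growth n hn K hK.measurableSet hKf (ENNReal.ofReal a0)
    (ENNReal.ofReal e0) (by simpa using he0p)
  have hK'f : μH[n] K' ≠ ∞ := ((measure_mono hK'K).trans_lt hKf.lt_top).ne
  have hDf : μH[n] (K \ K') ≠ ∞ := ((measure_mono Set.sdiff_subset).trans_lt hKf.lt_top).ne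
  -- real computation
  set h := (μH[n] K').toReal with hh
  set D := (μH[n] (K \ K')).toReal with hD
  have hD0 : 0 ≤ D := ENNReal.toReal_nonneg
  have hsplit : μH[n] K = μH[n] K' + μH[n] (K \ K') := by
    rw [← measure_inter_add_sdiff K hK'm, Set.inter_eq_self_of_subset_right hK'K]
  have hmreal : b0 * (h + D) = m := by
    have := congrArg ENNReal.toReal hH'
    rwa [ENNReal.toReal_mul, hsplit, ENNReal.toReal_add hK'f hDf, ENNReal.toReal_ofReal hm.le] at this
  have hsm' : a0 * D ≤ a0 * e0 + D := by
    have := ENNReal.toReal_mono (by finiteness) hsm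
    rw [ENNReal.toReal_mul, ENNReal.toReal_add (by finiteness) hDf, ENNReal.toReal_mul, ENNReal.toReal_ofReal ha0.le,
      ENNReal.toReal_ofReal he0p.le] at this
    exact this
  have hbD : b0 * D ≤ m - m1 := by
    have e1 : a0 * e0 = (a0 - 1) * ((m - m1) / b0) := by rw [he0]; field_simp
    have e2 : D ≤ (m - m1) / b0 := by
      have : 0 < a0 - 1 := by linarith
      by_contra hc; push Not at hc
      nlinarith
    rw [le_div_iff₀ hb0p] at e2; linarith
  set m' := b0 * h with hm'
  have hm'1 : m1 ≤ m' := by rw [hm']; nlinarith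
  have hm'0 : 0 < m' := by linarith
  have hbK' : b * μH[n] K' = ENNReal.ofReal m' := by
    rw [hm', ENNReal.ofReal_mul hb0p.le, hbb, ENNReal.ofReal_toReal hK'f]
  let μ : Measure (Eu d) := (ENNReal.ofReal m'⁻¹ * b) • (μH[n]).restrict K'
  have hμ1 : μ Set.univ = 1 := by
    simp only [μ, Measure.smul_apply, Measure.restrict_apply_univ, smul_eq_mul]
    rw [mul_assoc, hbK', ← ENNReal.ofReal_mul (by positivity), inv_mul_cancel₀ hm'0.ne', ENNReal.ofReal_one]
  have hpos : 0 < cn n * (1/m2 - a0/m') := by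
    have : a0 / m' < 1 / m2 := by rw [div_lt_div_iff₀ hm'0 hm2]; linarith
    have := cn_pos n
    apply mul_pos this; linarith
  set δ0 := (min (δ/2) 1).toReal with hδ0
  have hδt : min (δ/2) 1 ≠ ∞ := ((min_le_right _ _).trans_lt ENNReal.one_lt_top).ne
  have hδ0p : 0 < δ0 := ENNReal.toReal_pos (lt_min (ENNReal.half_pos hδ.ne') one_pos).ne' hδt
  obtain ⟨R, hR, htail⟩ := tail_small n δ0 _ hδ0p hpos
  refine ⟨μ, ⟨hμ1⟩, ?_, R, hR, fun r hr y => ?_⟩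
  · simp only [μ, Measure.smul_apply, smul_eq_mul]
    rw [Measure.restrict_apply hK.measurableSet.compl, show Kᶜ ∩ K' = ∅ from ?_]
    · simp
    · rw [Set.eq_empty_iff_forall_notMem]
      rintro x ⟨h1, h2⟩; exact h1 (hK'K h2)
  have hr0 : 0 < r := hR.trans_le hr
  have := growth_gauss n d μ hμ1.le (ENNReal.ofReal (a0 / m')) δ0 hδ0p ?_ r hr0 y
  · refine this.trans ?_
    have hc := cn_pos n
    rw [← ENNReal.ofReal_mul (by positivity), ← ENNReal.ofReal_add (by positivity) (by positivity)]
    apply ENNReal.ofReal_le_ofReal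
    have := htail r hr
    calc _ ≤ a0 / m' * (cn n / r^n) + cn n * (1/m2 - a0/m') / r^n := by linarith
      _ = _ := by field_simp; ring
  · intro y ρ hρ hρδ
    have hed : Metric.ediam (Metric.closedBall y ρ) ≤ 2 * ENNReal.ofReal ρ := by
      rw [← Metric.closedEBall_ofReal hρ.le]; exact Metric.ediam_closedEBall_le
    have h1 : 2 * ENNReal.ofReal ρ ≤ δ := by
      have : ENNReal.ofReal ρ ≤ min (δ/2) 1 := ENNReal.ofReal_le_of_le_toReal hρδ
      calc _ ≤ 2 * (δ/2) := by gcongr; exact this.trans (min_le_left _ _)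
        _ = δ := by rw [ENNReal.mul_div_cancel (by simp) (by simp)]
    have h2 := hg _ Metric.isClosed_closedBall (hed.trans h1)
    simp only [μ, Measure.smul_apply, smul_eq_mul]
    rw [Measure.restrict_apply Metric.isClosed_closedBall.measurableSet, Set.inter_comm]
    calc _ ≤ ENNReal.ofReal m'⁻¹ * b * (ENNReal.ofReal a0 * (2 * ENNReal.ofReal ρ)^n) := by
          gcongr; exact h2.trans (by gcongr)
      _ = ENNReal.ofReal (a0/m') * (ENNReal.ofReal (ρ^n) * (b * 2^n)) := by
          rw [mul_pow, div_eq_mul_inv, ENNReal.ofReal_mul ha0.le, ENNReal.ofReal_pow hρ.le]; ring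
      _ = _ := by
          rw [hb, ENNReal.div_mul_cancel (by simp) (by simp), ← vol_ball_scale n 0 1 ρ hρ one_pos, mul_one]

lemma mink_bound (n d : ℕ) (hn : 1 ≤ n) (hnd : n ≤ d) (K : Set (Eu d)) (hK : IsCompact K) (hKne : K.Nonempty)
    (m : ℝ) (hM : HasMinkowskiContent n d K m) (M : ℝ) (hm : m < M) (hM0 : 0 < M) :
    ∃ R > 0, ∀ r ≥ R,
      Integrable (fun y => Real.exp (-Metric.infDist y (r • K)^2/2)) (nuG d) ∧
      ∫ y, Real.exp (-Metric.infDist y (r • K)^2/2) ∂(nuG d) ≤ M * r^n / cn n := by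
  obtain ⟨M1', hM1', hM1M⟩ := exists_between hm
  set M1 := max M1' (M/2) with hM1
  have hM1p : 0 < M1 := lt_max_of_lt_right (by linarith)
  have hM1M : M1 < M := max_lt hM1M (by linarith)
  have hmM1 : m < M1 := lt_max_of_lt_left hM1'
  have hev := hM.eventually (gt_mem_nhds hmM1)
  rw [eventually_nhdsWithin_iff, Metric.eventually_nhds_iff] at hev
  obtain ⟨δ, hδ, hev⟩ := hev
  obtain ⟨D, hD, hKD⟩ := hK.isBounded.subset_ball_lt 0 0
  have hfinth : ∀ ρ, volume (Metric.thickening ρ K) ≠ ∞ := fun ρ =>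
    (hK.isBounded.thickening).measure_lt_top.ne
  have hg : ∀ ρ, 0 < ρ → ρ < δ → volume (Metric.thickening ρ K) ≤
      ENNReal.ofReal M1 * volume (Metric.ball (0 : Eu (d-n)) ρ) := by
    intro ρ hρ hρδ
    have h := hev (y := ρ) (by rw [Real.dist_eq, sub_zero, abs_of_pos hρ]; exact hρδ) hρ
    have hvp : 0 < (volume (Metric.ball (0 : Eu (d-n)) ρ)).toReal :=
      ENNReal.toReal_pos (Metric.measure_ball_pos _ _ hρ).ne' measure_ball_lt_top.ne
    rw [div_lt_iff₀ hvp] at h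
    rw [← ENNReal.ofReal_toReal (hfinth ρ), ← ENNReal.ofReal_toReal (measure_ball_lt_top (μ := (volume : Measure (Eu (d-n)))) (x := 0) (r := ρ)).ne,
      ← ENNReal.ofReal_mul hM1p.le]
    exact ENNReal.ofReal_le_ofReal h.le
  set B := (D/δ+1)^d with hB
  have hBp : 0 < B := by positivity
  have hcn := cn_pos n
  have hcd := cn_pos d
  have hcdn := cn_pos (d-n)
  have hcadd : cn d = cn n * cn (d-n) := by rw [← cn_add]; congr 1; omega
  have hMM : 0 < M - M1 := by linarith
  refine ⟨max 1 (B * cn n / (M - M1)), by positivity, fun r hr => ?_⟩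
  have hr1 : 1 ≤ r := le_trans (le_max_left _ _) hr
  have hr0 : 0 < r := by linarith
  have hr2 := le_trans (le_max_right _ _) hr
  have key := mink_gauss n d hnd K hKne D hD hKD (ENNReal.ofReal M1) δ hδ hg r hr0
  have hcont : Continuous fun y : Eu d => Real.exp (-Metric.infDist y (r • K)^2/2) := by
    have := Metric.continuous_infDist_pt (r • K); fun_prop
  have key2 : ∫⁻ y, ENNReal.ofReal (Real.exp (-Metric.infDist y (r • K)^2/2)) ∂(nuG d) ≤ ENNReal.ofReal (M * r^n / cn n) := by
    unfold nuG
    rw [lintegral_smul_measure, smul_eq_mul]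
    calc _ ≤ ENNReal.ofReal (cn d)⁻¹ * (ENNReal.ofReal M1 * ENNReal.ofReal (r^n * cn (d-n)) + ENNReal.ofReal (B * cn d)) := by
          gcongr
      _ = ENNReal.ofReal ((cn d)⁻¹ * (M1 * (r^n * cn (d-n)) + B * cn d)) := by
          rw [← ENNReal.ofReal_mul hM1p.le, ← ENNReal.ofReal_add (by positivity) (by positivity), ← ENNReal.ofReal_mul (by positivity)]
      _ ≤ _ := by
          apply ENNReal.ofReal_le_ofReal
          have e1 : (cn d)⁻¹ * (M1 * (r^n * cn (d-n)) + B * cn d) = M1 * r^n / cn n + B := by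
            rw [hcadd]; field_simp
          rw [e1]
          have e2 : B ≤ (M - M1) * r^n / cn n := by
            rw [le_div_iff₀ hcn]
            rw [div_le_iff₀ hMM] at hr2
            have : r ≤ r^n := le_self_pow₀ hr1 (by omega)
            nlinarith
          have e3 : M * r^n / cn n = M1 * r^n / cn n + (M - M1) * r^n / cn n := by ring
          linarith
  have hint : Integrable (fun y => Real.exp (-Metric.infDist y (r • K)^2/2)) (nuG d) := by
    refine ⟨hcont.aestronglyMeasurable, ?_⟩
    rw [hasFiniteIntegral_iff_ofReal (Eventually.of_forall fun y => (Real.exp_pos _).le)]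
    exact key2.trans_lt ENNReal.ofReal_lt_top
  refine ⟨hint, ?_⟩
  rw [integral_eq_lintegral_of_nonneg_ae (Eventually.of_forall fun y => (Real.exp_pos _).le) hcont.aestronglyMeasurable]
  exact ENNReal.toReal_le_of_le_ofReal (by positivity) key2
end PBF
set_option autoImplicit false
set_option linter.unusedSectionVars false
namespace PBF
open Finset MeasureTheory Bornology Filter
open scoped Pointwise ENNReal

lemma expd_mono {d : ℕ} {S T : Set (Eu d)} (hS : S.Nonempty) (h : S ⊆ T) (y : Eu d) :
    Real.exp (-Metric.infDist y S^2/2) ≤ Real.exp (-Metric.infDist y T^2/2) := by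
  have h1 := Metric.infDist_le_infDist_of_subset h hS (x := y)
  have h2 := Metric.infDist_nonneg (x := y) (s := T)
  apply Real.exp_le_exp.2; nlinarith

lemma scale_close {d : ℕ} {ι : Type} [Fintype ι] [Nonempty ι] (p : ι → ℝ) (s : ι → Eu d) (T : Set (Eu d))
    (hp : ∀ i, 0 < p i) (hp1 : ∑ i, p i = 1) (hs : ∀ i, s i ∈ T) (G η B : ℝ) (hG : 0 < G)
    (hint : Integrable (fun y => Real.exp (-Metric.infDist y T^2/2)) (nuG d))
    (hB : ∫ y, Real.exp (-Metric.infDist y T^2/2) ∂(nuG d) ≤ B)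
    (hc : ∫ y, |G * Real.exp (-Metric.infDist y (Set.range s)^2/2) - gW p s y| ∂(nuG d) ≤ η) :
    ∫ y, |G * Real.exp (-Metric.infDist y T^2/2) - gW p s y| ∂(nuG d) ≤ G * B - 1 + 2 * η := by
  have hν := gaussNu d
  obtain ⟨hWi, hW1⟩ := int_gW hν p hp hp1 s
  have hFi := int_expd hν p hp hp1 s
  have hmono : ∀ y, Real.exp (-Metric.infDist y (Set.range s)^2/2) ≤ Real.exp (-Metric.infDist y T^2/2) := fun y =>
    expd_mono (Set.range_nonempty s) (by rintro _ ⟨i, rfl⟩; exact hs i) y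
  set F := fun y => Real.exp (-Metric.infDist y (Set.range s)^2/2) with hF
  set k := fun y => Real.exp (-Metric.infDist y T^2/2) with hk
  have hGF : Integrable (fun y => G * F y) (nuG d) := hFi.const_mul G
  have hGk : Integrable (fun y => G * k y) (nuG d) := hint.const_mul G
  have hd : Integrable (fun y => G * F y - gW p s y) (nuG d) := hGF.sub hWi
  have hkW : Integrable (fun y => G * k y - gW p s y) (nuG d) := hGk.sub hWi
  have hkF : Integrable (fun y => G * k y - G * F y) (nuG d) := hGk.sub hGF
  have h1 : 1 - η ≤ G * ∫ y, F y ∂(nuG d) := by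
    rw [← integral_const_mul]
    have : ∫ y, (gW p s y - G * F y) ∂(nuG d) ≤ ∫ y, |G * F y - gW p s y| ∂(nuG d) := by
      apply integral_mono (hWi.sub hGF) hd.abs
      intro y; simp only; rw [abs_sub_comm]; exact le_abs_self _
    rw [integral_sub hWi hGF, hW1] at this
    linarith
  calc _ ≤ ∫ y, ((G * k y - G * F y) + |G * F y - gW p s y|) ∂(nuG d) := by
        apply integral_mono hkW.abs (iadd hkF hd.abs)
        intro y
        simp only
        have h2 : G * F y ≤ G * k y := mul_le_mul_of_nonneg_left (hmono y) hG.le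
        calc _ = |(G * k y - G * F y) + (G * F y - gW p s y)| := by congr 1; ring
          _ ≤ |G * k y - G * F y| + |G * F y - gW p s y| := abs_add_le _ _
          _ = _ := by rw [abs_of_nonneg (by linarith)]
    _ = (G * ∫ y, k y ∂(nuG d) - G * ∫ y, F y ∂(nuG d)) + ∫ y, |G * F y - gW p s y| ∂(nuG d) := by
        rw [integral_add hkF hd.abs, integral_sub hGk hGF, integral_const_mul, integral_const_mul]
    _ ≤ _ := by
        have := mul_le_mul_of_nonneg_left hB hG.le
        linarith

set_option maxHeartbeats 1000000 in
lemma L1close (n d : ℕ) (hn : 1 ≤ n) (hnd : n ≤ d) (K : Set (Eu d)) (hK : IsCompact K) (hKne : K.Nonempty)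
    (m : ℝ) (hm : 0 < m) (hH : normHausdorff n d K = ENNReal.ofReal m) (hM : HasMinkowskiContent n d K m)
    (ε : ℝ) (hε : 0 < ε) :
    ∃ R > 0, ∀ r ≥ R, ∃ (ι : Type) (_ : Fintype ι) (q : ι → ℝ) (x : ι → Eu d),
      (∀ i, 0 ≤ q i) ∧ (∀ y, ∑ i, q i * Real.exp (-‖y - x i‖^2/4) ≤ cn n * Real.sqrt 2 ^ n) ∧
      ∀ t : ℝ, t = 1 ∨ t = 2 →
        Integrable (fun y => Real.exp (-Metric.infDist y ((t * r) • K)^2/2)) (nuG d) ∧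
        ∫ y, |cn n * Real.exp (-Metric.infDist y ((t * r) • K)^2/2) - t^n * gW q (fun i => t • x i) y| ∂(nuG d)
          ≤ ε * r^n := by
  have hcn := cn_pos n
  set A0 := m * 2^n with hA0
  have hA0p : 0 < A0 := by positivity
  set η := ε / (4 * A0) with hη
  have hηp : 0 < η := by positivity
  obtain ⟨e0, he0, L, hL, core⟩ := coreThm (gaussNu d) n η hηp
  set e := min e0 (Real.log (1 + ε / (2 * A0))) with he
  have hep : 0 < e := lt_min he0 (Real.log_pos (by have : 0 < ε / (2 * A0) := by positivity
                                                   linarith))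
  have hee : Real.exp e - 1 ≤ ε / (2 * A0) := by
    have : Real.exp e ≤ 1 + ε / (2 * A0) := by
      rw [← Real.exp_log (show 0 < 1 + ε / (2 * A0) by positivity)]
      exact Real.exp_le_exp.2 (min_le_right _ _)
    linarith
  have hee0 : Real.exp e ≤ Real.exp e0 := Real.exp_le_exp.2 (min_le_left _ _)
  set m3 := m * Real.exp (-e/2) with hm3
  set m2 := m * Real.exp (-e/4) with hm2
  set M := m * Real.exp (e/2) with hMM
  have hm3p : 0 < m3 := by positivity
  have hm2p : 0 < m2 := by positivity
  have hm2m : m2 < m := by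
    have : Real.exp (-e/4) < 1 := by rw [Real.exp_lt_one_iff]; linarith
    rw [hm2]; nlinarith
  have hm32 : m3 < m2 := by
    exact mul_lt_mul_of_pos_left (Real.exp_lt_exp.2 (by linarith)) hm
  have hmM : m < M := by
    have : 1 < Real.exp (e/2) := by rw [Real.one_lt_exp_iff]; linarith
    rw [hMM]; nlinarith
  have hM3 : M = Real.exp e * m3 := by
    rw [hMM, hm3, mul_left_comm, ← Real.exp_add]; congr 2; ring
  obtain ⟨μ, hμp, hμK, R1, hR1, hgr⟩ := growth_measure n d hn K hK m hm hH m2 hm2p hm2m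
  obtain ⟨R2, hR2, hmk⟩ := mink_bound n d hn hnd K hK hKne m hM M hmM (by positivity)
  set G := cn n / m3 with hG
  have hGp : 0 < G := by positivity
  have hL0 : 0 < L := by linarith
  refine ⟨2 * L * max R1 R2, by positivity, fun r hr => ?_⟩
  have hR0 : 0 < max R1 R2 := by positivity
  have hrL : max R1 R2 ≤ r / (2 * L) := by rw [le_div_iff₀ (by positivity)]; linarith
  have hr0 : 0 < r := lt_of_lt_of_le (by positivity) hr
  set W := 2 * r * L with hW
  have hWp : 0 < W := by positivity
  set gap := cn n / m3 - cn n / m2 with hgap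
  have hgapp : 0 < gap := by
    rw [hgap, sub_pos]; gcongr
  set δ := gap / (2 * W^(n+1)) with hδ
  have hδp : 0 < δ := by positivity
  obtain ⟨ι, hι, hιn, p, s, hp, hp1, hsK, hdisc⟩ := discretize K hK hKne μ hμK δ hδp
  have hgW : ∀ ρ, R1 ≤ ρ → ρ ≤ W → ∀ y, gW p (fun j => ρ • s j) y ≤ G / ρ^n := by
    intro ρ h1 h2 y
    have hρ : 0 < ρ := hR1.trans_le h1
    have hcont : Continuous fun s : Eu d => ph (ρ • s) y := by unfold ph; fun_prop
    have hint : Integrable (fun s : Eu d => ph (ρ • s) y) μ := by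
      refine (integrable_const (1:ℝ)).mono' hcont.aestronglyMeasurable (Eventually.of_forall fun s => ?_)
      rw [Real.norm_of_nonneg (ph_pos _ _).le]; exact ph_le_one _ _
    have h3 := hdisc (fun s => ph (ρ • s) y) (2 * ρ) hcont hint (fun a b => by
      refine (ph_lip _ _ _).trans ?_
      rw [← smul_sub, norm_smul, Real.norm_of_nonneg hρ.le, mul_assoc]) (by positivity)
    have h4 : ∫ x, ph (ρ • x) y ∂μ ≤ cn n / (m2 * ρ^n) := by
      rw [integral_eq_lintegral_of_nonneg_ae (Eventually.of_forall fun s => (ph_pos _ _).le) hcont.aestronglyMeasurable]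
      exact ENNReal.toReal_le_of_le_ofReal (by positivity) (hgr ρ h1 y)
    have h5 : 2 * ρ * δ ≤ gap / ρ^n := by
      rw [le_div_iff₀ (by positivity), hδ]
      have : ρ^(n+1) ≤ W^(n+1) := by gcongr
      calc _ = gap * (ρ^(n+1) / W^(n+1)) := by field_simp; ring
        _ ≤ gap * 1 := by gcongr; rw [div_le_one (by positivity)]; exact this
        _ = gap := mul_one _
    have h6 : G / ρ^n = cn n / (m2 * ρ^n) + gap / ρ^n := by rw [hG, hgap]; field_simp; ring
    unfold gW
    linarith
  have hmk' : ∀ ρ, R2 ≤ ρ → ∫ y, Real.exp (-Metric.infDist y (Set.range fun j => ρ • s j)^2/2) ∂(nuG d) ≤ Real.exp e0 * ρ^n / G := by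
    intro ρ h1
    have hρ : 0 < ρ := hR2.trans_le h1
    obtain ⟨h2, h3⟩ := hmk ρ h1
    have h4 : ∫ y, Real.exp (-Metric.infDist y (Set.range fun j => ρ • s j)^2/2) ∂(nuG d) ≤
        ∫ y, Real.exp (-Metric.infDist y (ρ • K)^2/2) ∂(nuG d) := by
      apply integral_mono (int_expd (gaussNu d) p hp hp1 _) h2
      intro y
      apply expd_mono (Set.range_nonempty _)
      rintro _ ⟨i, rfl⟩; exact Set.smul_mem_smul_set (hsK i)
    calc _ ≤ M * ρ^n / cn n := h4.trans h3
      _ = Real.exp e * ρ^n / G := by rw [hM3, hG]; field_simp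
      _ ≤ _ := by gcongr
  have hRR1 : R1 ≤ r / (2 * L) := (le_max_left _ _).trans hrL
  have hRR2 : R2 ≤ r / (2 * L) := (le_max_right _ _).trans hrL
  have hr2L : r / (2 * L) ≤ r / L := by gcongr; linarith
  have hrl : r / L ≤ r := div_le_self hr0.le hL.le
  refine ⟨ι, hι, fun i => r^n * m3 * p i, fun i => r • s i, fun i => by have := hp i; positivity, ?_, ?_⟩
  · intro y
    have hs2 : 0 < Real.sqrt 2 := by positivity
    have hs2' : Real.sqrt 2 ^ 2 = 2 := Real.sq_sqrt (by norm_num)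
    have hs2'' : Real.sqrt 2 ≤ 2 := by nlinarith
    have hs3 : 1 ≤ Real.sqrt 2 := by nlinarith
    have h1 := hgW (r / Real.sqrt 2) (hRR1.trans (by gcongr; linarith)) (by
      refine (div_le_self hr0.le hs3).trans ?_
      rw [hW]; nlinarith) ((Real.sqrt 2)⁻¹ • y)
    have h2 : ∀ i, Real.exp (-‖y - r • s i‖^2/4) = ph ((r / Real.sqrt 2) • s i) ((Real.sqrt 2)⁻¹ • y) := by
      intro i
      unfold ph
      have : (Real.sqrt 2)⁻¹ • y - (r / Real.sqrt 2) • s i = (Real.sqrt 2)⁻¹ • (y - r • s i) := by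
        rw [smul_sub, smul_smul]; congr 2; ring
      rw [this, norm_smul, Real.norm_of_nonneg (by positivity), mul_pow, inv_pow, hs2']
      congr 1; ring
    calc _ = r^n * m3 * gW p (fun j => (r / Real.sqrt 2) • s j) ((Real.sqrt 2)⁻¹ • y) := by
          unfold gW; rw [Finset.mul_sum]; apply Finset.sum_congr rfl; intro i _; rw [h2]; ring
      _ ≤ r^n * m3 * (G / (r / Real.sqrt 2)^n) := by gcongr
      _ = _ := by rw [hG, div_pow]; field_simp
  · intro t ht
    have ht1 : 1 ≤ t := by rcases ht with h | h <;> rw [h] <;> norm_num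
    have ht2 : t ≤ 2 := by rcases ht with h | h <;> rw [h] ; norm_num
    have ht0 : 0 < t := by linarith
    have htr : r ≤ t * r := by nlinarith
    have hR2t : R2 ≤ t * r := hRR2.trans (hr2L.trans (hrl.trans htr))
    obtain ⟨hi, hb⟩ := hmk (t * r) hR2t
    refine ⟨hi, ?_⟩
    have c1 := core p (fun i => (t * r) • s i) (G / (t * r)^n) hp hp1 (by positivity) (fun ρ h1 h2 y => by
        have hρ : 0 < ρ := lt_of_lt_of_le (by positivity) h1
        simp_rw [smul_smul]
        have := hgW (ρ * (t * r)) (hRR1.trans (hr2L.trans (by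
          calc r / L = (1/L) * r := by ring
            _ ≤ ρ * (t * r) := by gcongr))) (by
          calc ρ * (t * r) ≤ L * (2 * r) := by gcongr
            _ = W := by rw [hW]; ring) y
        rw [mul_pow] at this
        rwa [div_div, mul_comm ((t*r)^n)]) (fun ρ h1 h2 => by
        have hρ : 0 < ρ := lt_of_lt_of_le (by positivity) h1
        simp_rw [smul_smul]
        refine (hmk' (ρ * (t * r)) (hRR2.trans (hr2L.trans (by
          calc r / L = (1/L) * r := by ring
            _ ≤ ρ * (t * r) := by gcongr)))).trans (le_of_eq ?_)
        rw [mul_pow]; field_simp)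
    have c2 := scale_close p (fun i => (t * r) • s i) ((t * r) • K) hp hp1
      (fun i => Set.smul_mem_smul_set (hsK i)) (G / (t * r)^n) η _ (by positivity) hi hb c1
    have e1 : G / (t*r)^n * (M * (t*r)^n / cn n) = Real.exp e := by
      rw [hM3, hG]; field_simp
    rw [e1] at c2
    have e2 : ∀ y, |cn n * Real.exp (-Metric.infDist y ((t * r) • K)^2/2) - t^n * gW (fun i => r^n * m3 * p i) (fun i => t • r • s i) y|
        = (t*r)^n * m3 * |G / (t*r)^n * Real.exp (-Metric.infDist y ((t * r) • K)^2/2) - gW p (fun i => (t * r) • s i) y| := by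
      intro y
      rw [← abs_of_pos (show 0 < (t*r)^n * m3 by positivity), ← abs_mul]
      congr 1
      rw [mul_sub]
      congr 1
      · rw [hG]; field_simp
      · unfold gW; rw [Finset.mul_sum, Finset.mul_sum]; apply Finset.sum_congr rfl; intro i _
        simp only [smul_smul, mul_pow]; ring
    simp_rw [e2]
    rw [integral_const_mul]
    have hm3m : m3 ≤ m := by linarith
    have hfin : Real.exp e - 1 + 2 * η ≤ ε / A0 := by
      have : 2 * η = ε / (2 * A0) := by rw [hη]; field_simp; norm_num
      have : ε / A0 = ε / (2*A0) + ε / (2*A0) := by field_simp; norm_num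
      linarith
    calc _ ≤ (t*r)^n * m3 * (ε / A0) := by gcongr; linarith
      _ ≤ (2*r)^n * m * (ε / A0) := by gcongr
      _ = _ := by rw [hA0, mul_pow]; field_simp
end PBF
set_option autoImplicit false
set_option linter.unusedSectionVars false
namespace PBF
open Finset MeasureTheory Bornology Filter
open scoped Pointwise ENNReal

lemma frame {d k : ℕ} (V : Submodule ℝ (Eu d)) (hk : Module.finrank ℝ V = k) :
    ∃ (f : Eu k →ₗᵢ[ℝ] Eu d) (g : Eu (d - k) →ₗᵢ[ℝ] Eu d),
      (∀ a, f a ∈ V) ∧ (∀ v ∈ V, ∃ a, f a = v) ∧ (∀ a b, inner ℝ (f a) (g b) = 0) ∧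
      (∀ y, ∃ a b, y = f a + g b) ∧
      MeasurePreserving (fun p : Eu k × Eu (d - k) => f p.1 + g p.2) (volume.prod volume) volume := by
  have hk' : Module.finrank ℝ Vᗮ = d - k := by
    have := Submodule.finrank_add_finrank_orthogonal V
    rw [finrank_euclideanSpace, Fintype.card_fin] at this
    omega
  let e1 : V ≃ₗᵢ[ℝ] Eu k := ((stdOrthonormalBasis ℝ V).reindex (finCongr hk)).repr
  let e2 : Vᗮ ≃ₗᵢ[ℝ] Eu (d-k) := ((stdOrthonormalBasis ℝ Vᗮ).reindex (finCongr hk')).repr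
  refine ⟨V.subtypeₗᵢ.comp e1.symm.toLinearIsometry, Vᗮ.subtypeₗᵢ.comp e2.symm.toLinearIsometry, ?_, ?_, ?_, ?_, ?_⟩
  · intro a; exact (e1.symm a).2
  · intro v hv; exact ⟨e1 ⟨v, hv⟩, by simp⟩
  · intro a b
    exact Submodule.inner_right_of_mem_orthogonal (e1.symm a).2 (e2.symm b).2
  · intro y
    obtain ⟨a, ha, b, hb, hab⟩ := V.exists_add_mem_mem_orthogonal y
    exact ⟨e1 ⟨a, ha⟩, e2 ⟨b, hb⟩, by simpa using hab⟩
  · have h1 : MeasurePreserving (Prod.map e1.symm e2.symm) (volume.prod volume) (volume.prod volume) :=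
      e1.symm.measurePreserving.prod e2.symm.measurePreserving
    have h2 := WithLp.volume_preserving_toLp V Vᗮ
    have h3 := V.orthogonalDecomposition.symm.measurePreserving
    have := h3.comp (h2.comp h1)
    have he : (fun p : Eu k × Eu (d - k) => (V.subtypeₗᵢ.comp e1.symm.toLinearIsometry) p.1 + (Vᗮ.subtypeₗᵢ.comp e2.symm.toLinearIsometry) p.2)
      = (V.orthogonalDecomposition.symm ∘ WithLp.toLp 2 ∘ Prod.map e1.symm e2.symm) := by
      funext p
      simp
    rw [he]
    exact this
end PBF
set_option autoImplicit false
set_option linter.unusedSectionVars false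
namespace PBF
open Finset MeasureTheory Bornology Filter
open scoped Pointwise ENNReal

lemma ascoli {d : ℕ} (f : ℕ → Eu d → ℝ) (hL : ∀ j x y, |f j x - f j y| ≤ ‖x - y‖) (R : ℝ)
    (h0 : ∀ j, 0 ≤ f j 0 ∧ f j 0 ≤ R) :
    ∃ (D : Eu d → ℝ) (φ : ℕ → ℕ), (∀ x y, |D x - D y| ≤ ‖x - y‖) ∧
      ∀ N : ℕ, N ≤ φ N ∧ ∀ y : Eu d, ‖y‖ ≤ N → |f (φ N) y - D y| ≤ 1 / (N + 1) := by
  let U := hyperfilter ℕ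
  have h1 : ∀ y, ∃ l, Tendsto (fun j => f j y) U (nhds l) := by
    intro y
    have hc : IsCompact (Set.Icc (-‖y‖) (R + ‖y‖)) := isCompact_Icc
    have := hc.ultrafilter_le_nhds (U.map (fun j => f j y)) (by
      rw [le_principal_iff]
      refine Filter.mem_map.2 (Filter.univ_mem' fun j => ?_)
      have := hL j y 0
      rw [sub_zero, abs_le] at this
      have := h0 j
      constructor <;> linarith)
    obtain ⟨l, -, hl⟩ := this
    exact ⟨l, hl⟩
  choose D hD using h1
  have hDL : ∀ x y, |D x - D y| ≤ ‖x - y‖ := fun x y =>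
    le_of_tendsto ((hD x).sub (hD y)).abs (Eventually.of_forall fun j => hL j x y)
  have h2 : ∀ N : ℕ, ∃ j, N ≤ j ∧ ∀ y : Eu d, ‖y‖ ≤ N → |f j y - D y| ≤ 1 / (N + 1) := by
    intro N
    have hpos : (0:ℝ) < 1 / (3 * (N + 1)) := by positivity
    obtain ⟨t, -, htf, ht⟩ := (isCompact_closedBall (0 : Eu d) (N:ℝ)).finite_cover_balls hpos
    have e1 : ∀ᶠ j in (U : Filter ℕ), ∀ p ∈ t, |f j p - D p| < 1 / (3 * (N + 1)) := by
      rw [Filter.eventually_all_finite htf]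
      intro p _
      have := (Metric.tendsto_nhds.1 (hD p)) _ hpos
      simpa [Real.dist_eq] using this
    have e2 : ∀ᶠ j in (U : Filter ℕ), N ≤ j := by
      have : (U : Filter ℕ) ≤ atTop := Nat.hyperfilter_le_atTop
      exact this (eventually_ge_atTop N)
    obtain ⟨j, hj1, hj2⟩ := (e1.and e2).exists
    refine ⟨j, hj2, fun y hy => ?_⟩
    have := ht (show y ∈ Metric.closedBall (0 : Eu d) N by simpa using hy)
    simp only [Set.mem_iUnion, Metric.mem_ball, dist_eq_norm] at this
    obtain ⟨p, hp, hyp⟩ := this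
    have a1 := hL j y p
    have a2 := hDL p y
    rw [norm_sub_rev] at a2
    have a3 := hj1 p hp
    have : (1:ℝ) / (N + 1) = 1 / (3 * (N+1)) + 1 / (3 * (N+1)) + 1 / (3 * (N+1)) := by field_simp; norm_num
    rw [this]
    rw [abs_le] at *
    rw [abs_lt] at a3
    constructor <;> linarith
  choose φ hφ using h2
  exact ⟨D, φ, hDL, hφ⟩

lemma near_limit {d : ℕ} (K : ℕ → Set (Eu d)) (hK : ∀ j, IsClosed (K j)) (hne : ∀ j, (K j).Nonempty)
    (D : Eu d → ℝ) (hDL : ∀ x y, |D x - D y| ≤ ‖x - y‖)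
    (h : ∀ N : ℕ, ∀ y : Eu d, ‖y‖ ≤ N → |Metric.infDist y (K N) - D y| ≤ 1 / (N + 1)) :
    (∀ y, Tendsto (fun N => Metric.infDist y (K N)) atTop (nhds (D y))) ∧ (∀ y, 0 ≤ D y) ∧
    ∀ y, ∃ k, D k = 0 ∧ ‖y - k‖ = D y := by
  have hbig : ∀ M : ℝ, ∀ᶠ N : ℕ in atTop, M ≤ N := fun M =>
    (tendsto_natCast_atTop_atTop (R := ℝ)).eventually_ge_atTop M
  have hT : ∀ y, Tendsto (fun N => Metric.infDist y (K N)) atTop (nhds (D y)) := by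
    intro y
    rw [tendsto_iff_norm_sub_tendsto_zero]
    refine squeeze_zero' (Eventually.of_forall fun _ => norm_nonneg _) ?_ (tendsto_one_div_add_atTop_nhds_zero_nat (𝕜 := ℝ))
    filter_upwards [hbig ‖y‖] with N hN using h N y hN
  have h0 : ∀ y, 0 ≤ D y := fun y => ge_of_tendsto (hT y) (Eventually.of_forall fun _ => Metric.infDist_nonneg)
  refine ⟨hT, h0, fun y => ?_⟩
  have : ∀ N, ∃ k ∈ K N, Metric.infDist y (K N) = dist y k := fun N => (hK N).exists_infDist_eq_dist (hne N) y
  choose k hk hyk using this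
  have hT' : Tendsto (fun N => ‖y - k N‖) atTop (nhds (D y)) := by
    refine (hT y).congr fun N => ?_
    rw [hyk, dist_eq_norm]
  have hb : ∀ᶠ N in atTop, k N ∈ Metric.closedBall y (D y + 1) := by
    filter_upwards [hT'.eventually (gt_mem_nhds (lt_add_one (D y)))] with N hN
    rw [Metric.mem_closedBall, dist_comm, dist_eq_norm]; exact hN.le
  obtain ⟨z, -, ψ, hψ, hz⟩ := tendsto_subseq_of_frequently_bounded Metric.isBounded_closedBall hb.frequently
  refine ⟨z, ?_, ?_⟩
  · refine le_antisymm ?_ (h0 z)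
    have hlim : Tendsto (fun m => ‖z - k (ψ m)‖ + 1 / ((ψ m : ℝ) + 1)) atTop (nhds (0 + 0)) := by
      refine Tendsto.add ?_ ((tendsto_one_div_add_atTop_nhds_zero_nat (𝕜 := ℝ)).comp hψ.tendsto_atTop)
      rw [← norm_zero (E := Eu d), ← sub_self z]
      exact (tendsto_const_nhds.sub hz).norm
    rw [add_zero] at hlim
    refine ge_of_tendsto hlim ?_
    have e1 := hψ.tendsto_atTop.eventually hb
    have e2 := hψ.tendsto_atTop.eventually (hbig (‖y‖ + (D y + 1)))
    filter_upwards [e1, e2] with m hm1 hm2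
    have : ‖k (ψ m)‖ ≤ ψ m := by
      rw [Metric.mem_closedBall, dist_eq_norm] at hm1
      have := norm_le_norm_add_norm_sub' (k (ψ m)) y
      linarith
    have a1 := h _ _ this
    rw [Metric.infDist_zero_of_mem (hk _), zero_sub, abs_neg, abs_of_nonneg (h0 _)] at a1
    have a2 := (le_abs_self _).trans (hDL z (k (ψ m)))
    linarith
  · exact tendsto_nhds_unique (tendsto_const_nhds.sub hz).norm (hT'.comp hψ.tendsto_atTop)

lemma exp_diff_bd (τ X : ℝ) : |Real.exp (τ * X) - 1| ≤ 2 * |τ| * (|Real.exp (X/2) - 1| * Real.exp ((|τ| + 1/2) * |X|)) := by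
  have h1 : |Real.exp (τ * X) - 1| ≤ |τ| * |X| * Real.exp (|τ| * |X|) := by
    rw [← abs_mul]
    generalize τ * X = z
    rcases le_total 0 z with hz | hz
    · rw [abs_of_nonneg hz, abs_of_nonneg (by linarith [Real.one_le_exp hz])]
      have := Real.add_one_le_exp (-z)
      rw [Real.exp_neg] at this
      have hp := Real.exp_pos z
      have : (1 - z) * Real.exp z ≤ 1 := by
        calc _ ≤ (Real.exp z)⁻¹ * Real.exp z := by gcongr; linarith
          _ = 1 := by field_simp
      nlinarith
    · rw [abs_of_nonpos hz, abs_of_nonpos (by linarith [Real.exp_le_one_iff.2 hz])]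
      have := Real.add_one_le_exp z
      have : 1 ≤ Real.exp (-z) := Real.one_le_exp (by linarith)
      nlinarith
  have h2 : |X| ≤ 2 * (|Real.exp (X/2) - 1| * Real.exp (1/2 * |X|)) := by
    rcases le_total 0 X with hz | hz
    · rw [abs_of_nonneg hz, abs_of_nonneg (by linarith [Real.one_le_exp (show 0 ≤ X/2 by linarith)])]
      have := Real.add_one_le_exp (X/2)
      have : 1 ≤ Real.exp (1/2*X) := Real.one_le_exp (by linarith)
      nlinarith
    · rw [abs_of_nonpos hz, abs_of_nonpos (by linarith [Real.exp_le_one_iff.2 (show X/2 ≤ 0 by linarith)])]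
      have e : Real.exp (1/2 * -X) = (Real.exp (X/2))⁻¹ := by rw [← Real.exp_neg]; congr 1; ring
      have hp := Real.exp_pos (X/2)
      have := Real.add_one_le_exp (-(X/2))
      rw [Real.exp_neg] at this
      rw [e]
      have : -(Real.exp (X/2) - 1) * (Real.exp (X/2))⁻¹ = (Real.exp (X/2))⁻¹ - 1 := by field_simp; ring
      rw [this]; linarith
  calc _ ≤ _ := h1
    _ ≤ |τ| * (2 * (|Real.exp (X/2) - 1| * Real.exp (1/2 * |X|))) * Real.exp (|τ| * |X|) := by gcongr
    _ = _ := by rw [add_mul, Real.exp_add]; ring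

/-- abstract step 3 -/
lemma laplace_lim (ι : ℕ → Type) [∀ N, Fintype (ι N)] (a X : ∀ N, ι N → ℝ) (ha : ∀ N i, 0 ≤ a N i) (c : ℝ)
    (B : ℝ → ℝ) (hB : ∀ N τ, ∑ i, a N i * Real.exp (τ * X N i) ≤ B τ)
    (h0 : Tendsto (fun N => ∑ i, a N i * Real.exp (0 * X N i)) atTop (nhds c))
    (h1 : Tendsto (fun N => ∑ i, a N i * Real.exp (1/2 * X N i)) atTop (nhds c))
    (h2 : Tendsto (fun N => ∑ i, a N i * Real.exp (1 * X N i)) atTop (nhds c)) (τ : ℝ) :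
    Tendsto (fun N => ∑ i, a N i * Real.exp (τ * X N i)) atTop (nhds c) := by
  set E : ℕ → ℝ := fun N => ∑ i, a N i * (Real.exp (X N i / 2) - 1)^2 with hE
  have hE0 : Tendsto E atTop (nhds 0) := by
    have := (h2.sub (h1.const_mul 2)).add h0
    rw [show c - 2 * c + c = 0 by ring] at this
    refine this.congr fun N => ?_
    rw [hE, Finset.mul_sum, ← Finset.sum_sub_distrib, ← Finset.sum_add_distrib]
    refine Finset.sum_congr rfl fun i _ => ?_
    have e : Real.exp (1 * X N i) = Real.exp (X N i / 2)^2 := by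
      rw [← Real.exp_nat_mul]; congr 1; push_cast; ring
    rw [e, zero_mul, Real.exp_zero, show 1/2 * X N i = X N i / 2 by ring]
    ring
  set κ := 2 * |τ| + 1 with hκ
  set C1 := B κ + B (-κ) with hC1
  have hC : ∀ N, ∑ i, a N i * Real.exp (κ * |X N i|) ≤ C1 := by
    intro N
    refine le_trans ?_ (add_le_add (hB N κ) (hB N (-κ)))
    rw [← Finset.sum_add_distrib]
    refine Finset.sum_le_sum fun i _ => ?_
    rw [← mul_add]
    refine mul_le_mul_of_nonneg_left ?_ (ha N i)
    rcases abs_cases (X N i) with ⟨h, _⟩ | ⟨h, _⟩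
    · rw [h]; linarith [Real.exp_pos (-κ * X N i)]
    · rw [h, show κ * -X N i = -κ * X N i by ring]; linarith [Real.exp_pos (κ * X N i)]
  have hC1' : 0 ≤ C1 := le_trans (Finset.sum_nonneg fun i _ => mul_nonneg (ha 0 i) (Real.exp_pos _).le) (hC 0)
  have hdiff : ∀ N, ∀ l > 0, |∑ i, a N i * Real.exp (τ * X N i) - ∑ i, a N i * Real.exp (0 * X N i)| ≤ |τ| * (l * E N + l⁻¹ * C1) := by
    intro N l hl
    rw [← Finset.sum_sub_distrib]
    refine (Finset.abs_sum_le_sum_abs _ _).trans ?_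
    have hterm : ∀ i, |a N i * Real.exp (τ * X N i) - a N i * Real.exp (0 * X N i)|
        ≤ |τ| * (l * (a N i * (Real.exp (X N i / 2) - 1)^2) + l⁻¹ * (a N i * Real.exp (κ * |X N i|))) := by
      intro i
      rw [zero_mul, Real.exp_zero, ← mul_sub, abs_mul, abs_of_nonneg (ha N i)]
      have b1 := exp_diff_bd τ (X N i)
      set p := |Real.exp (X N i / 2) - 1| with hp
      set q := Real.exp ((|τ| + 1/2) * |X N i|) with hq
      have b2 : (Real.exp (X N i / 2) - 1)^2 = p^2 := by rw [hp, sq_abs]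
      have b3 : Real.exp (κ * |X N i|) = q^2 := by
        rw [hq, ← Real.exp_nat_mul]; congr 1; rw [hκ]; push_cast; ring
      rw [b2, b3]
      have b4 : 2 * (p * q) ≤ l * p^2 + l⁻¹ * q^2 := by
        have : 0 ≤ l⁻¹ * (l * p - q)^2 := by positivity
        have e : l⁻¹ * (l * p - q)^2 = l * p^2 - 2 * (p * q) + l⁻¹ * q^2 := by field_simp; ring
        linarith
      calc _ ≤ a N i * (|τ| * (2 * (p * q))) := by
            refine mul_le_mul_of_nonneg_left (b1.trans (le_of_eq (by ring))) (ha N i)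
        _ ≤ a N i * (|τ| * (l * p^2 + l⁻¹ * q^2)) := by
            refine mul_le_mul_of_nonneg_left ?_ (ha N i); gcongr
        _ = _ := by ring
    refine (Finset.sum_le_sum fun i _ => hterm i).trans ?_
    rw [← Finset.mul_sum, Finset.sum_add_distrib, ← Finset.mul_sum, ← Finset.mul_sum]
    have := hC N
    gcongr
  have hz : Tendsto (fun N => ∑ i, a N i * Real.exp (τ * X N i) - ∑ i, a N i * Real.exp (0 * X N i)) atTop (nhds 0) := by
    rw [Metric.tendsto_atTop']
    intro ε hε
    set l := 2 * |τ| * (C1 + 1) / ε + 1 with hl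
    have hlp : 0 < l := by positivity
    have s1 : |τ| * (l⁻¹ * C1) ≤ ε / 2 := by
      rw [← mul_assoc, mul_comm |τ|, mul_assoc, inv_mul_le_iff₀ hlp]
      have : l * (ε / 2) = |τ| * (C1 + 1) + ε / 2 := by rw [hl]; field_simp
      rw [this]
      have := abs_nonneg τ
      nlinarith
    have s2 : ∀ᶠ N in atTop, |τ| * l * E N < ε / 2 := by
      have := hE0.const_mul (|τ| * l)
      rw [mul_zero] at this
      exact this.eventually (gt_mem_nhds (by positivity))
    obtain ⟨N0, hN0⟩ := eventually_atTop.1 s2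
    refine ⟨N0, fun N hN => ?_⟩
    rw [Real.dist_eq, sub_zero]
    have := hdiff N l hlp
    have := hN0 N hN.le
    nlinarith
  have := hz.add h0
  simpa using this
end PBF
set_option autoImplicit false
set_option linter.unusedSectionVars false
namespace PBF
open Finset MeasureTheory Bornology Filter
open scoped Pointwise ENNReal

section
variable {d n : ℕ} (D : Eu d → ℝ) (hDL : ∀ x y, |D x - D y| ≤ ‖x - y‖) (hD0 : ∀ y, 0 ≤ D y)
  (hnear : ∀ y, ∃ k, D k = 0 ∧ ‖y - k‖ = D y)
  (ι : ℕ → Type) [∀ N, Fintype (ι N)] (q : ∀ N, ι N → ℝ) (x : ∀ N, ι N → Eu d)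
  (hq : ∀ N i, 0 ≤ q N i) (C0 : ℝ)
  (hC0 : ∀ N y, gW (q N) (x N) y ≤ C0)
  (hw : ∀ y, Tendsto (fun N => gW (q N) (x N) y) atTop (nhds (cn n * Real.exp (-(D y)^2/2))))

include hDL hD0 hq hC0 hw

lemma ray (s u : Eu d) (hs : D s = 0) (hu : D (s + u) = ‖u‖) (τ : ℝ) : D (s + τ • u) = |τ| * ‖u‖ := by
  have key : ∀ N (τ : ℝ), ∑ i, (q N i * ph (x N i) s) * Real.exp (τ * inner ℝ u (x N i - s))
      = gW (q N) (x N) (s + τ • u) * Real.exp (τ^2 * ‖u‖^2/2) := by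
    intro N τ
    unfold gW
    rw [Finset.sum_mul]
    refine Finset.sum_congr rfl fun i _ => ?_
    rw [mul_assoc, mul_assoc]
    congr 1
    unfold ph
    rw [← Real.exp_add, ← Real.exp_add]
    congr 1
    have : s + τ • u - x N i = (s - x N i) + τ • u := by abel
    rw [this, @norm_add_sq_real, norm_smul, mul_pow, Real.norm_eq_abs, sq_abs, inner_smul_right,
      ← neg_sub s (x N i), inner_neg_right, real_inner_comm]
    ring
  have hhalf : D (s + (1/2:ℝ) • u) = 1/2 * ‖u‖ := by
    have h1 := hDL (s + (1/2:ℝ) • u) s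
    have h2 := hDL (s + u) (s + (1/2:ℝ) • u)
    rw [add_sub_cancel_left, norm_smul, hs] at h1
    rw [show s + u - (s + (1/2:ℝ) • u) = (1/2:ℝ) • u by module, norm_smul, hu] at h2
    rw [Real.norm_of_nonneg (by norm_num)] at h1 h2
    rw [abs_le] at h1 h2
    linarith
  have hlim : ∀ τ : ℝ, Tendsto (fun N => ∑ i, (q N i * ph (x N i) s) * Real.exp (τ * inner ℝ u (x N i - s))) atTop
      (nhds (cn n * Real.exp (-(D (s + τ • u))^2/2) * Real.exp (τ^2 * ‖u‖^2/2))) := by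
    intro τ
    simp_rw [key]
    exact (hw _).mul_const _
  have hl : ∀ τ : ℝ, 0 ≤ τ → D (s + τ • u) = τ * ‖u‖ → cn n * Real.exp (-(D (s + τ • u))^2/2) * Real.exp (τ^2 * ‖u‖^2/2) = cn n := by
    intro τ _ h
    rw [h, mul_assoc, ← Real.exp_add, mul_pow, show -(τ^2 * ‖u‖^2)/2 + τ^2 * ‖u‖^2/2 = 0 by ring, Real.exp_zero, mul_one]
  have := laplace_lim ι (fun N i => q N i * ph (x N i) s) (fun N i => inner ℝ u (x N i - s))
    (fun N i => mul_nonneg (hq N i) (ph_pos _ _).le) (cn n) (fun τ => C0 * Real.exp (τ^2 * ‖u‖^2/2))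
    (fun N τ => by rw [key]; exact mul_le_mul_of_nonneg_right (hC0 _ _) (Real.exp_pos _).le)
    (by have := hlim 0; rwa [hl 0 le_rfl (by simpa using hs)] at this)
    (by have := hlim (1/2); rwa [hl (1/2) (by norm_num) hhalf] at this)
    (by have := hlim 1; rwa [hl 1 zero_le_one (by simpa using hu)] at this) τ
  have h3 := tendsto_nhds_unique (hlim τ) this
  rw [mul_assoc, ← Real.exp_add] at h3
  have h4 : Real.exp (-D (s + τ • u) ^ 2 / 2 + τ ^ 2 * ‖u‖ ^ 2 / 2) = 1 := by
    have := cn_pos n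
    field_simp at h3 ⊢
    exact h3
  rw [Real.exp_eq_one_iff] at h4
  have h5 : D (s + τ • u)^2 = (|τ| * ‖u‖)^2 := by rw [mul_pow, sq_abs]; linarith
  exact (pow_left_inj₀ (hD0 _) (by positivity) two_ne_zero).1 h5

lemma ray_orth (s u s' : Eu d) (hs : D s = 0) (hu : D (s + u) = ‖u‖) (hs' : D s' = 0) :
    inner ℝ u (s' - s) = 0 := by
  have h : ∀ τ : ℝ, 2 * τ * inner ℝ u (s' - s) ≤ ‖s' - s‖^2 := by
    intro τ
    have h1 := ray D hDL hD0 ι q x hq C0 hC0 hw s u hs hu τ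
    have h2 := (le_abs_self _).trans (hDL (s + τ • u) s')
    rw [hs', h1, sub_zero] at h2
    have h3 : (|τ| * ‖u‖)^2 ≤ ‖s + τ • u - s'‖^2 := by gcongr
    rw [show s + τ • u - s' = τ • u - (s' - s) by abel, @norm_sub_sq_real, norm_smul, Real.norm_eq_abs, real_inner_smul_left] at h3
    linarith
  by_contra hne
  have := h ((‖s' - s‖^2 + 1) / (2 * inner ℝ u (s' - s)))
  have e : 2 * ((‖s' - s‖^2 + 1) / (2 * inner ℝ u (s' - s))) * inner ℝ u (s' - s) = ‖s' - s‖^2 + 1 := by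
    field_simp
  rw [e] at this
  linarith

include hnear
lemma plane_form : ∃ (k : ℕ) (_ : k ≤ d) (z0 : Eu d) (f : Eu k →ₗᵢ[ℝ] Eu d) (g : Eu (d - k) →ₗᵢ[ℝ] Eu d),
    (∀ a b, inner ℝ (f a) (g b) = 0) ∧ (∀ y, ∃ a b, y = f a + g b) ∧
    MeasurePreserving (fun p : Eu k × Eu (d - k) => f p.1 + g p.2) (volume.prod volume) volume ∧
    ∀ a b, D (z0 + f a + g b) = ‖b‖ := by
  obtain ⟨s0, hs0, -⟩ := hnear 0
  let V := Submodule.span ℝ ((fun s => s - s0) '' {s | D s = 0})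
  have hmem : ∀ s, D s = 0 → s - s0 ∈ V := fun s hs => Submodule.subset_span ⟨s, hs, rfl⟩
  obtain ⟨f, g, hfV, hVf, hfg, hsur, hmp⟩ := frame V rfl
  refine ⟨_, ?_, s0, f, g, hfg, hsur, hmp, ?_⟩
  · have := Submodule.finrank_le V
    simpa using this
  intro a b
  obtain ⟨k, hk, hyk⟩ := hnear (s0 + f a + g b)
  set u := s0 + f a + g b - k with hu
  have hort : ∀ s, D s = 0 → inner ℝ u (s - k) = 0 := fun s hs =>
    ray_orth D hDL hD0 ι q x hq C0 hC0 hw k u s hk (by rw [hyk, hu, add_sub_cancel]) hs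
  have hV : ∀ v ∈ V, inner ℝ u v = 0 := by
    intro v hv
    induction hv using Submodule.span_induction with
    | mem v hv =>
      obtain ⟨s, hs, rfl⟩ := hv
      have h1 := hort s hs
      have h2 := hort s0 hs0
      show inner ℝ u (s - s0) = 0
      rw [show s - s0 = (s - k) - (s0 - k) by abel, inner_sub_right, h1, h2, sub_zero]
    | zero => simp
    | add v w _ _ h1 h2 => rw [inner_add_right, h1, h2, add_zero]
    | smul c v _ h => rw [inner_smul_right, h, mul_zero]
  obtain ⟨a', ha'⟩ := hVf _ (hmem k hk)
  have hu2 : u = f (a - a') + g b := by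
    rw [hu, map_sub, ha']; abel
  have h3 := hV (f (a - a')) (hfV _)
  rw [hu2, inner_add_left, real_inner_comm, real_inner_comm (f (a-a')) (g b), hfg, add_zero, real_inner_self_eq_norm_sq] at h3
  have h4 : f (a - a') = 0 := by
    rw [← norm_eq_zero]; exact pow_eq_zero_iff two_ne_zero |>.1 h3
  rw [← hyk, hu2, h4, zero_add, g.norm_map]

end

lemma conv_id {d : ℕ} (z : Eu d) : ∫ t : Eu d, Real.exp (-2 * ‖z - t‖^2) * Real.exp (-(2/3) * ‖t‖^2)
    = (3 * Real.pi / 8) ^ ((d:ℝ)/2) * Real.exp (-‖z‖^2/2) := by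
  have h : ∀ t : Eu d, Real.exp (-2 * ‖z - t‖^2) * Real.exp (-(2/3) * ‖t‖^2)
      = Real.exp (-(8/3) * ‖t - (3/4:ℝ) • z‖^2) * Real.exp (-‖z‖^2/2) := by
    intro t
    rw [← Real.exp_add, ← Real.exp_add]
    congr 1
    rw [@norm_sub_sq_real, @norm_sub_sq_real, norm_smul, inner_smul_right, real_inner_comm, mul_pow, Real.norm_of_nonneg (by norm_num)]
    ring
  simp_rw [h]
  rw [integral_mul_const]
  congr 1
  rw [integral_sub_right_eq_self (fun t : Eu d => Real.exp (-(8/3) * ‖t‖^2)),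
    GaussianFourier.integral_rexp_neg_mul_sq_norm (by norm_num)]
  simp [finrank_euclideanSpace]
  congr 1; ring

lemma plane_limit {d n : ℕ} (D : Eu d → ℝ) (hDL : ∀ x y, |D x - D y| ≤ ‖x - y‖) (hD0 : ∀ y, 0 ≤ D y)
  (hnear : ∀ y, ∃ k, D k = 0 ∧ ‖y - k‖ = D y)
  (ι : ℕ → Type) [∀ N, Fintype (ι N)] (q : ∀ N, ι N → ℝ) (x : ∀ N, ι N → Eu d)
  (hq : ∀ N i, 0 ≤ q N i) (C0 : ℝ)
  (hC0 : ∀ N y, gW (q N) (x N) y ≤ C0)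
  (hw : ∀ y, Tendsto (fun N => gW (q N) (x N) y) atTop (nhds (cn n * Real.exp (-(D y)^2/2))))
  (hv : ∀ y, Tendsto (fun N => ∑ i, q N i * Real.exp (-2 * ‖y - x N i‖^2)) atTop
    (nhds (cn n * (1/2)^n * Real.exp (-2 * (D y)^2)))) :
  ∃ (z0 : Eu d) (f : Eu n →ₗᵢ[ℝ] Eu d) (g : Eu (d - n) →ₗᵢ[ℝ] Eu d),
    (∀ a b, inner ℝ (f a) (g b) = 0) ∧ (∀ y, ∃ a b, y = f a + g b) ∧
    MeasurePreserving (fun p : Eu n × Eu (d - n) => f p.1 + g p.2) (volume.prod volume) volume ∧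
    ∀ a b, D (z0 + f a + g b) = ‖b‖ := by
  obtain ⟨k, hkd, z0, f, g, hfg, hsur, hmp, hD⟩ := plane_form D hDL hD0 hnear ι q x hq C0 hC0 hw
  suffices hkn : k = n by subst hkn; exact ⟨z0, f, g, hfg, hsur, hmp, hD⟩
  set κ : ℝ := (3 * Real.pi / 8) ^ ((d:ℝ)/2) with hκ
  have hint : ∀ z : Eu d, Integrable (fun t : Eu d => Real.exp (-2 * ‖z - t‖^2) * Real.exp (-(2/3) * ‖t‖^2)) := by
    intro z
    refine (gauss_integrable d (2/3) (by norm_num)).mono' (by fun_prop) (Eventually.of_forall fun t => ?_)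
    rw [Real.norm_of_nonneg (by positivity)]
    have : Real.exp (-2 * ‖z - t‖^2) ≤ 1 := Real.exp_le_one_iff.2 (by nlinarith [sq_nonneg ‖z - t‖])
    nlinarith [Real.exp_pos (-(2/3) * ‖t‖^2)]
  have h1 : ∀ N, ∫ t : Eu d, (∑ i, q N i * Real.exp (-2 * ‖z0 - t - x N i‖^2)) * Real.exp (-(2/3) * ‖t‖^2)
      = κ * gW (q N) (x N) z0 := by
    intro N
    have : ∀ t : Eu d, (∑ i, q N i * Real.exp (-2 * ‖z0 - t - x N i‖^2)) * Real.exp (-(2/3) * ‖t‖^2)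
        = ∑ i, q N i * (Real.exp (-2 * ‖(z0 - x N i) - t‖^2) * Real.exp (-(2/3) * ‖t‖^2)) := by
      intro t
      rw [Finset.sum_mul]
      refine Finset.sum_congr rfl fun i _ => ?_
      rw [mul_assoc, sub_right_comm]
    simp_rw [this]
    rw [integral_finsetSum _ (fun i _ => (hint _).const_mul _)]
    unfold gW
    rw [Finset.mul_sum]
    refine Finset.sum_congr rfl fun i _ => ?_
    rw [integral_const_mul, conv_id]
    unfold ph
    ring
  have hDc : Continuous D := by
    refine (LipschitzWith.of_dist_le_mul (K := 1) fun a b => ?_).continuous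
    rw [Real.dist_eq, dist_eq_norm]; simpa using hDL a b
  have hlim1 : Tendsto (fun N => κ * gW (q N) (x N) z0) atTop
      (nhds (∫ t : Eu d, (cn n * (1/2)^n * Real.exp (-2 * (D (z0 - t))^2)) * Real.exp (-(2/3) * ‖t‖^2))) := by
    simp_rw [← h1]
    refine tendsto_integral_of_dominated_convergence (fun t => C0 * Real.exp (-(2/3) * ‖t‖^2)) ?_ ?_ ?_ ?_
    · intro N
      refine Continuous.aestronglyMeasurable ?_
      fun_prop
    · exact (gauss_integrable d (2/3) (by norm_num)).const_mul C0
    · intro N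
      refine Eventually.of_forall fun t => ?_
      rw [Real.norm_of_nonneg (mul_nonneg (Finset.sum_nonneg fun i _ => mul_nonneg (hq N i) (Real.exp_pos _).le) (Real.exp_pos _).le)]
      refine mul_le_mul_of_nonneg_right (le_trans ?_ (hC0 N (z0 - t))) (Real.exp_pos _).le
      unfold gW ph
      refine Finset.sum_le_sum fun i _ => mul_le_mul_of_nonneg_left (Real.exp_le_exp.2 ?_) (hq N i)
      nlinarith [sq_nonneg ‖z0 - t - x N i‖]
    · exact Eventually.of_forall fun t => (hv _).mul_const _
  have hlim2 := (hw z0).const_mul κ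
  have h2 := tendsto_nhds_unique hlim1 hlim2
  have hDz : D z0 = 0 := by simpa using hD 0 0
  have h3 : ∫ t : Eu d, (cn n * (1/2)^n * Real.exp (-2 * (D (z0 - t))^2)) * Real.exp (-(2/3) * ‖t‖^2)
      = cn n * (1/2)^n * ((3 * Real.pi / 2) ^ ((k:ℝ)/2) * (3 * Real.pi / 8) ^ (((d-k:ℕ):ℝ)/2)) := by
    simp_rw [mul_assoc (cn n * (1/2)^n)]
    rw [integral_const_mul]
    congr 1
    rw [← hmp.map_eq, integral_map hmp.measurable.aemeasurable (by
      refine Continuous.aestronglyMeasurable ?_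
      fun_prop)]
    have : ∀ p : Eu k × Eu (d - k), Real.exp (-2 * D (z0 - (f p.1 + g p.2)) ^ 2) * Real.exp (-(2 / 3) * ‖f p.1 + g p.2‖ ^ 2)
        = Real.exp (-(2/3) * ‖p.1‖^2) * Real.exp (-(8/3) * ‖p.2‖^2) := by
      intro p
      have e1 : z0 - (f p.1 + g p.2) = z0 + f (-p.1) + g (-p.2) := by rw [map_neg, map_neg]; abel
      rw [e1, hD, norm_neg, @norm_add_sq_real, hfg, f.norm_map, g.norm_map, ← Real.exp_add, ← Real.exp_add]
      congr 1; ring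
    simp_rw [this]
    rw [integral_prod_mul (fun a : Eu k => Real.exp (-(2/3) * ‖a‖^2)) (fun b : Eu (d-k) => Real.exp (-(8/3) * ‖b‖^2)),
      GaussianFourier.integral_rexp_neg_mul_sq_norm (by norm_num), GaussianFourier.integral_rexp_neg_mul_sq_norm (by norm_num)]
    simp only [finrank_euclideanSpace, Fintype.card_fin]
    congr 2 <;> ring
  rw [h3, hDz] at h2
  have hcn := cn_pos n
  have hpi := Real.pi_pos
  have e4 : κ = (3 * Real.pi / 8) ^ ((k:ℝ)/2) * (3 * Real.pi / 8) ^ (((d-k:ℕ):ℝ)/2) := by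
    rw [hκ, ← Real.rpow_add (by positivity)]; congr 1; push_cast [Nat.cast_sub hkd]; ring
  have e5 : (3 * Real.pi / 2) ^ ((k:ℝ)/2) = 2 ^ k * (3 * Real.pi / 8) ^ ((k:ℝ)/2) := by
    rw [show 3 * Real.pi / 2 = 4 * (3 * Real.pi / 8) by ring, Real.mul_rpow (by norm_num) (by positivity)]
    congr 1
    rw [show (4:ℝ) = 2^(2:ℝ) by norm_num, ← Real.rpow_mul (by norm_num), ← Real.rpow_natCast]
    congr 1; ring
  rw [e4, e5] at h2
  have hA : (0:ℝ) < (3 * Real.pi / 8) ^ ((k:ℝ)/2) := by positivity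
  have hB : (0:ℝ) < (3 * Real.pi / 8) ^ (((d-k:ℕ):ℝ)/2) := by positivity
  have h6 : (2:ℝ)^k = 2^n := by
    rw [show (1/2:ℝ)^n = (2^n)⁻¹ by rw [one_div, inv_pow]] at h2
    simp only [ne_eq, OfNat.ofNat_ne_zero, not_false_eq_true, zero_pow, neg_zero, zero_div, Real.exp_zero, mul_one] at h2
    have hP : (0:ℝ) < 2^n := by positivity
    field_simp at h2
    exact h2
  exact_mod_cast pow_right_injective₀ (by norm_num : (0:ℝ) < 2) (by norm_num) h6
end PBF
set_option autoImplicit false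
set_option linter.unusedSectionVars false
namespace PBF
open Finset MeasureTheory Bornology Filter
open scoped Pointwise ENNReal

/-- orthogonal frame -/
def IsFrame {n d : ℕ} (f : Eu n →ₗᵢ[ℝ] Eu d) (g : Eu (d - n) →ₗᵢ[ℝ] Eu d) : Prop :=
  (∀ a b, inner ℝ (f a) (g b) = 0) ∧ (∀ y, ∃ a b, y = f a + g b) ∧
    MeasurePreserving (fun p : Eu n × Eu (d - n) => f p.1 + g p.2) (volume.prod volume) volume

lemma compactness (n d : ℕ) (C0 R' η : ℝ) (hη : 0 < η) : ∃ j : ℕ, ∀ (K : Set (Eu d)), IsClosed K → K.Nonempty →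
    ∀ (ι : Type) (_ : Fintype ι) (q : ι → ℝ) (x : ι → Eu d), (∀ i, 0 ≤ q i) → (∀ y, gW q x y ≤ C0) →
    (∀ y : Eu d, ‖y‖ ≤ j → |cn n * Real.exp (-(Metric.infDist y K)^2/2) - gW q x y| ≤ 1/(j+1)) →
    (∀ y : Eu d, ‖y‖ ≤ j → |cn n * (1/2)^n * Real.exp (-2*(Metric.infDist y K)^2) - ∑ i, q i * Real.exp (-2 * ‖y - x i‖^2)| ≤ 1/(j+1)) →
    Metric.infDist 0 K ≤ R' →
    ∃ (z0 : Eu d) (f : Eu n →ₗᵢ[ℝ] Eu d) (g : Eu (d - n) →ₗᵢ[ℝ] Eu d), IsFrame f g ∧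
      ∀ a b, ‖z0 + f a + g b‖ ≤ R' → |Metric.infDist (z0 + f a + g b) K - ‖b‖| ≤ η := by
  by_contra hcon
  push Not at hcon
  choose K hKc hKne ι inst q x hq hC0 hb hc hR hbad using hcon
  obtain ⟨D, φ, hDL, hφ⟩ := ascoli (fun j y => Metric.infDist y (K j)) (fun j y y' => by
      have := (Metric.lipschitz_infDist_pt (K j)).dist_le_mul y y'
      rw [Real.dist_eq, dist_eq_norm] at this; simpa using this) R' (fun j => ⟨Metric.infDist_nonneg, hR j⟩)
  obtain ⟨hT, hD0, hnear⟩ := near_limit (fun N => K (φ N)) (fun N => hKc _) (fun N => hKne _) D hDL (fun N => (hφ N).2)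
  have hbig : ∀ M : ℝ, ∀ᶠ N : ℕ in atTop, M ≤ N := fun M =>
    (tendsto_natCast_atTop_atTop (R := ℝ)).eventually_ge_atTop M
  have hφb : ∀ y : Eu d, ∀ᶠ N in atTop, ‖y‖ ≤ (φ N : ℝ) ∧ (1:ℝ)/(φ N + 1) ≤ 1/(N+1) := by
    intro y
    filter_upwards [hbig ‖y‖] with N hN
    have h1 : (N:ℝ) ≤ φ N := by exact_mod_cast (hφ N).1
    refine ⟨hN.trans h1, ?_⟩
    gcongr
  have hlim : ∀ (F G : ℕ → ℝ) (l : ℝ), (∀ᶠ N : ℕ in atTop, |F N - G N| ≤ 1/(N+1)) → Tendsto F atTop (nhds l) → Tendsto G atTop (nhds l) := by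
    intro F G l h1 h2
    have h3 : Tendsto (fun N => F N - G N) atTop (nhds 0) := by
      rw [tendsto_zero_iff_norm_tendsto_zero]
      exact squeeze_zero' (Eventually.of_forall fun _ => norm_nonneg _) h1 (tendsto_one_div_add_atTop_nhds_zero_nat (𝕜 := ℝ))
    have := h2.sub h3
    simpa using this
  obtain ⟨z0, f, g, h1, h2, h3, h4⟩ := plane_limit (n := n) D hDL hD0 hnear (fun N => ι (φ N)) (fun N => q (φ N)) (fun N => x (φ N))
    (fun N => hq _) C0 (fun N => hC0 _) (by
      intro y
      refine hlim (fun N => cn n * Real.exp (-(Metric.infDist y (K (φ N)))^2/2)) _ _ ?_ ?_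
      · filter_upwards [hφb y] with N hN using (hb _ _ hN.1).trans hN.2
      · exact ((Real.continuous_exp.tendsto _).comp (((hT y).pow 2).neg.div_const 2)).const_mul _) (by
      intro y
      refine hlim (fun N => cn n * (1/2)^n * Real.exp (-2*(Metric.infDist y (K (φ N)))^2)) _ _ ?_ ?_
      · filter_upwards [hφb y] with N hN using (hc _ _ hN.1).trans hN.2
      · exact ((Real.continuous_exp.tendsto _).comp (((hT y).pow 2).const_mul (-2))).const_mul _)
  obtain ⟨N, hN1, hN2⟩ := ((hbig R').and (hbig (1/η))).exists
  obtain ⟨a, b, hab, hgt⟩ := hbad (φ N) z0 f g ⟨h1, h2, h3⟩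
  have := (hφ N).2 (z0 + f a + g b) (hab.trans hN1)
  rw [h4] at this
  have h5 : (1:ℝ)/(N+1) ≤ η := by
    rw [div_le_iff₀ (by positivity)]
    rw [div_le_iff₀ hη] at hN2
    linarith
  linarith

lemma sup_of_int {d : ℕ} (L ε : ℝ) (hL : 0 < L) (hε : 0 < ε) : ∃ θ : ℝ, 0 < θ ∧ ∀ (h : Eu d → ℝ) (_ : Measurable h)
    (_ : ∀ y y', |h y - h y'| ≤ L * ‖y - y'‖) (z : Eu d) (ρ : ℝ),
    ∫⁻ y in Metric.ball z (ρ + 1), ENNReal.ofReal (h y) ≤ ENNReal.ofReal θ → ∀ y, dist y z ≤ ρ → h y ≤ ε := by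
  set s := min (ε/(2*L)) 1 with hs
  have hsp : 0 < s := by positivity
  set v := (volume (Metric.ball (0 : Eu d) s)).toReal with hv
  have hvp : 0 < v := ENNReal.toReal_pos (Metric.measure_ball_pos _ _ hsp).ne' measure_ball_lt_top.ne
  refine ⟨ε / 4 * v, by positivity, ?_⟩
  intro h hm hLip z ρ hint y hy
  by_contra hgt
  push Not at hgt
  have h1 : ENNReal.ofReal (ε/2 * v) ≤ ∫⁻ y in Metric.ball z (ρ + 1), ENNReal.ofReal (h y) := by
    calc ENNReal.ofReal (ε/2*v) = ∫⁻ _ in Metric.ball y s, ENNReal.ofReal (ε/2) := by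
          rw [setLIntegral_const, ENNReal.ofReal_mul (by positivity), hv, ENNReal.ofReal_toReal measure_ball_lt_top.ne]
          congr 1
          rw [Measure.addHaar_ball_center volume y s]
      _ ≤ ∫⁻ y in Metric.ball y s, ENNReal.ofReal (h y) := by
          refine setLIntegral_mono (by fun_prop) fun y' hy' => ENNReal.ofReal_le_ofReal ?_
          have a1 := (le_abs_self _).trans (hLip y y')
          rw [Metric.mem_ball, dist_comm, dist_eq_norm] at hy'
          have a2 : L * ‖y - y'‖ ≤ L * (ε/(2*L)) := by
            gcongr; exact hy'.le.trans (min_le_left _ _)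
          have a3 : L * (ε/(2*L)) = ε/2 := by field_simp
          linarith
      _ ≤ _ := lintegral_mono_set (Metric.ball_subset_ball' (by
          have : s ≤ 1 := min_le_right _ _
          linarith))
  have h2 := h1.trans hint
  rw [ENNReal.ofReal_le_ofReal_iff (by positivity)] at h2
  nlinarith [mul_pos hε hvp]

lemma exp_lip4 (a b : ℝ) (ha : 0 ≤ a) (hb : 0 ≤ b) :
    |Real.exp (-a^2/2) - Real.exp (-b^2/2)| ≤ 4 * |a - b| * (Real.exp (-a^2/4) + Real.exp (-b^2/4)) ∧
    |Real.exp (-2*a^2) - Real.exp (-2*b^2)| ≤ 4 * |a - b| * (Real.exp (-a^2/4) + Real.exp (-b^2/4)) := by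
  have gen : ∀ t : ℝ, 0 ≤ t → t^2 ≤ 4 → ∀ (e : ℝ), e = t^2 → 1/4 ≤ e/2 →
      |Real.exp (-e*a^2) - Real.exp (-e*b^2)| ≤ 4 * |a - b| * (Real.exp (-a^2/4) + Real.exp (-b^2/4)) := by
    intro t ht ht2 e he h14
    have e1 : ∀ a : ℝ, Real.exp (-e*a^2) = Real.exp (-(t*a)^2/2)^2 := by
      intro a; rw [← Real.exp_nat_mul]; congr 1; rw [he]; push_cast; ring
    have e2 : ∀ a : ℝ, Real.exp (-(t*a)^2/2) ≤ Real.exp (-a^2/4) := by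
      intro a; apply Real.exp_le_exp.2; rw [mul_pow, ← he]; nlinarith [sq_nonneg a]
    have h := gl_lip (a := t*a) (b := t*b) (by positivity) (by positivity)
    rw [e1, e1, sq_sub_sq, mul_comm, abs_mul, abs_of_pos (show 0 < Real.exp (-(t*a)^2/2) + Real.exp (-(t*b)^2/2) by positivity)]
    have ht' : t ≤ 2 := by nlinarith
    have h3 : |t*a - t*b| ≤ 2 * |a - b| := by
      rw [← mul_sub, abs_mul, abs_of_nonneg ht]; gcongr
    refine mul_le_mul (by linarith) (add_le_add (e2 a) (e2 b)) (by positivity) (by positivity)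
  constructor
  · have := gen (Real.sqrt (1/2)) (by positivity) (by rw [Real.sq_sqrt] <;> norm_num) (1/2) (by rw [Real.sq_sqrt]; norm_num) (by norm_num)
    rw [show -a^2/2 = -(1/2)*a^2 by ring, show -b^2/2 = -(1/2)*b^2 by ring]
    exact this
  · exact gen (Real.sqrt 2) (by positivity) (by rw [Real.sq_sqrt] <;> norm_num) 2 (by rw [Real.sq_sqrt]; norm_num) (by norm_num)

lemma window (n d : ℕ) (C0 R' η : ℝ) (hC0p : 0 ≤ C0) (hη : 0 < η) : ∃ (j θ : ℝ), 0 < j ∧ 0 < θ ∧ ∀ (K : Set (Eu d)), IsClosed K → K.Nonempty →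
    ∀ (ι : Type) (_ : Fintype ι) (q : ι → ℝ) (x : ι → Eu d), (∀ i, 0 ≤ q i) →
    (∀ y, ∑ i, q i * Real.exp (-‖y - x i‖^2/4) ≤ C0) → ∀ z : Eu d,
    (∫⁻ y in Metric.ball z j, ENNReal.ofReal (|cn n * Real.exp (-(Metric.infDist y K)^2/2) - gW q x y| +
       |cn n * Real.exp (-(Metric.infDist ((2:ℝ) • y) ((2:ℝ) • K))^2/2) - 2^n * gW q (fun i => (2:ℝ) • x i) ((2:ℝ) • y)|)) ≤ ENNReal.ofReal θ →
    Metric.infDist z K ≤ R' →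
    ∃ (z0 : Eu d) (f : Eu n →ₗᵢ[ℝ] Eu d) (g : Eu (d - n) →ₗᵢ[ℝ] Eu d), IsFrame f g ∧
      ∀ a b, dist (z0 + f a + g b) z ≤ R' → |Metric.infDist (z0 + f a + g b) K - ‖b‖| ≤ η := by
  obtain ⟨j, hj⟩ := compactness n d C0 R' η hη
  have hcn := cn_pos n
  set L : ℝ := 4 * cn n + 2^n * (8 * C0) with hL
  have hLp : 0 < L := by positivity
  obtain ⟨θ, hθ, hsup⟩ := sup_of_int (d := d) (2*L) (1/(j+1)) (by positivity) (by positivity)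
  refine ⟨j + 1, θ, by positivity, hθ, ?_⟩
  intro K hKc hKne ι inst q x hq hC0 z hint hR
  have hv2 : ∀ y, gW q (fun i => (2:ℝ) • x i) ((2:ℝ) • y) = ∑ i, q i * Real.exp (-2 * ‖y - x i‖^2) := by
    intro y
    unfold gW ph
    refine Finset.sum_congr rfl fun i _ => ?_
    rw [← smul_sub, norm_smul, mul_pow]; congr 2; norm_num; ring
  have hd2 : ∀ y, Metric.infDist ((2:ℝ) • y) ((2:ℝ) • K) = 2 * Metric.infDist y K := by
    intro y; rw [infDist_smul₀]; norm_num; norm_num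
  simp_rw [hv2, hd2] at hint
  have hiL : ∀ y y', |Metric.infDist y K - Metric.infDist y' K| ≤ ‖y - y'‖ := fun y y' => by
      have := (Metric.lipschitz_infDist_pt K).dist_le_mul y y'
      rw [Real.dist_eq, dist_eq_norm] at this; simpa using this
  have hsumL : ∀ (E : ℝ → ℝ) (_ : ∀ a b : ℝ, 0 ≤ a → 0 ≤ b → |E a - E b| ≤ 4 * |a - b| * (Real.exp (-a^2/4) + Real.exp (-b^2/4))) (y y' : Eu d),
      |∑ i, q i * E ‖y - x i‖ - ∑ i, q i * E ‖y' - x i‖| ≤ 8 * C0 * ‖y - y'‖ := by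
    intro E hE y y'
    rw [← Finset.sum_sub_distrib]
    refine (Finset.abs_sum_le_sum_abs _ _).trans ?_
    have ht : ∀ i, |q i * E ‖y - x i‖ - q i * E ‖y' - x i‖| ≤ 4 * ‖y - y'‖ * (q i * Real.exp (-‖y - x i‖^2/4) + q i * Real.exp (-‖y' - x i‖^2/4)) := by
      intro i
      rw [← mul_sub, abs_mul, abs_of_nonneg (hq i)]
      have h1 := hE _ _ (norm_nonneg (y - x i)) (norm_nonneg (y' - x i))
      have h2 : |‖y - x i‖ - ‖y' - x i‖| ≤ ‖y - y'‖ := by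
        have := abs_norm_sub_norm_le (y - x i) (y' - x i); simpa using this
      calc _ ≤ q i * (4 * ‖y - y'‖ * (Real.exp (-‖y - x i‖^2/4) + Real.exp (-‖y' - x i‖^2/4))) := by
            refine mul_le_mul_of_nonneg_left (h1.trans ?_) (hq i); gcongr
        _ = _ := by ring
    refine (Finset.sum_le_sum fun i _ => ht i).trans ?_
    rw [← Finset.mul_sum, Finset.sum_add_distrib]
    have := hC0 y
    have := hC0 y'
    have := norm_nonneg (y - y')
    nlinarith
  set h1 : Eu d → ℝ := fun y => |cn n * Real.exp (-(Metric.infDist y K)^2/2) - gW q x y| with hh1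
  set h2 : Eu d → ℝ := fun y => |cn n * Real.exp (-(2 * Metric.infDist y K)^2/2) - 2^n * ∑ i, q i * Real.exp (-2 * ‖y - x i‖^2)| with hh2
  have hpow : (1:ℝ) ≤ 2^n := one_le_pow₀ (by norm_num)
  have l1 : ∀ y y', |h1 y - h1 y'| ≤ L * ‖y - y'‖ := by
    intro y y'
    refine (abs_abs_sub_abs_le_abs_sub _ _).trans ?_
    have b1 := (gl_lip (Metric.infDist_nonneg (x := y) (s := K)) (Metric.infDist_nonneg (x := y') (s := K))).trans (mul_le_mul_of_nonneg_left (hiL y y') zero_le_two)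
    have b2 := hsumL (fun a => Real.exp (-a^2/2)) (fun a b ha hb => (exp_lip4 a b ha hb).1) y y'
    have b2' : |gW q x y - gW q x y'| ≤ 8 * C0 * ‖y - y'‖ := b2
    set P := Real.exp (-(Metric.infDist y K)^2/2)
    set P' := Real.exp (-(Metric.infDist y' K)^2/2)
    have e : cn n * P - gW q x y - (cn n * P' - gW q x y') = cn n * (P - P') - (gW q x y - gW q x y') := by ring
    rw [e]
    refine (abs_sub _ _).trans ?_
    rw [abs_mul, abs_of_pos hcn]
    have := mul_le_mul_of_nonneg_left b1 hcn.le
    have hn0 := norm_nonneg (y - y')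
    have b3 : 8 * C0 * ‖y - y'‖ ≤ 2^n * (8 * C0 * ‖y - y'‖) := le_mul_of_one_le_left (by positivity) hpow
    have := mul_nonneg hcn.le hn0
    rw [hL]; nlinarith
  have l2 : ∀ y y', |h2 y - h2 y'| ≤ L * ‖y - y'‖ := by
    intro y y'
    refine (abs_abs_sub_abs_le_abs_sub _ _).trans ?_
    have b1 := (gl_lip (a := 2 * Metric.infDist y K) (b := 2 * Metric.infDist y' K) (by have := Metric.infDist_nonneg (x := y) (s := K); positivity) (by have := Metric.infDist_nonneg (x := y') (s := K); positivity))
    rw [← mul_sub, abs_mul, abs_of_pos (show (0:ℝ) < 2 by norm_num)] at b1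
    have b1' := hiL y y'
    have b2 := hsumL (fun a => Real.exp (-2*a^2)) (fun a b ha hb => (exp_lip4 a b ha hb).2) y y'
    set P := Real.exp (-(2 * Metric.infDist y K)^2/2)
    set P' := Real.exp (-(2 * Metric.infDist y' K)^2/2)
    set Q := ∑ i, q i * Real.exp (-2 * ‖y - x i‖^2)
    set Q' := ∑ i, q i * Real.exp (-2 * ‖y' - x i‖^2)
    have e : cn n * P - 2^n * Q - (cn n * P' - 2^n * Q') = cn n * (P - P') - 2^n * (Q - Q') := by ring
    rw [e]
    refine (abs_sub _ _).trans ?_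
    rw [abs_mul, abs_mul, abs_of_pos hcn, abs_of_pos (show (0:ℝ) < 2^n by positivity)]
    have c1 : cn n * |P - P'| ≤ cn n * (4 * ‖y - y'‖) := by gcongr; linarith
    have c2 : (2:ℝ)^n * |Q - Q'| ≤ 2^n * (8 * C0 * ‖y - y'‖) := by gcongr
    rw [hL]; nlinarith
  have hcont : Continuous (fun y => h1 y + h2 y) := by
    have : Continuous (gW q x) := by
      unfold gW ph; fun_prop
    have : Continuous (fun y => Metric.infDist y K) := Metric.continuous_infDist_pt K
    simp only [hh1, hh2]
    fun_prop
  have hsm := hsup (fun y => h1 y + h2 y) hcont.measurable (fun y y' => by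
    have := l1 y y'
    have := l2 y y'
    calc |h1 y + h2 y - (h1 y' + h2 y')| = |(h1 y - h1 y') + (h2 y - h2 y')| := by congr 1; ring
      _ ≤ _ := abs_add_le _ _
      _ ≤ _ := by linarith) z j hint
  have hiso : Isometry (fun y : Eu d => y - z) := fun y y' => by simp
  have hi : ∀ y, Metric.infDist y ((fun y : Eu d => y - z) '' K) = Metric.infDist (y + z) K := by
    intro y
    have := Metric.infDist_image hiso (x := y + z) (t := K)
    simpa using this
  have hsum2 : ∀ y, gW q x y ≤ C0 := by
    intro y
    refine le_trans ?_ (hC0 y)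
    unfold gW ph
    refine Finset.sum_le_sum fun i _ => mul_le_mul_of_nonneg_left (Real.exp_le_exp.2 ?_) (hq i)
    nlinarith [sq_nonneg ‖y - x i‖]
  have hgt : ∀ y, gW q (fun i => x i - z) y = gW q x (y + z) := by
    intro y; unfold gW ph; simp only [sub_sub_eq_add_sub]
  obtain ⟨z0, f, g, hfr, hz⟩ := hj ((fun y : Eu d => y - z) '' K) (by
      have : (fun y : Eu d => y - z) '' K = (Homeomorph.subRight z) '' K := rfl
      rw [this]; exact (Homeomorph.isClosed_image _).2 hKc) (hKne.image _) ι inst q (fun i => x i - z) hq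
      (fun y => by rw [hgt]; exact hsum2 _)
      (fun y hy => by
        have := hsm (y + z) (by simpa using hy)
        rw [hi, hgt]
        have : 0 ≤ h2 (y + z) := abs_nonneg _
        have : h1 (y + z) = |cn n * Real.exp (-(Metric.infDist (y+z) K)^2/2) - gW q x (y+z)| := rfl
        linarith)
      (fun y hy => by
        have := hsm (y + z) (by simpa using hy)
        rw [hi]
        simp only [sub_sub_eq_add_sub]
        have a1 : 0 ≤ h1 (y + z) := abs_nonneg _
        have a2 : h2 (y + z) = 2^n * |cn n * (1/2)^n * Real.exp (-2*(Metric.infDist (y+z) K)^2) - ∑ i, q i * Real.exp (-2 * ‖y + z - x i‖^2)| := by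
          rw [hh2, ← abs_of_pos (show (0:ℝ) < 2^n by positivity), ← abs_mul, abs_of_pos (show (0:ℝ) < 2^n by positivity)]
          simp only
          congr 1
          rw [mul_sub]
          congr 1
          rw [show -(2 * Metric.infDist (y+z) K)^2/2 = -2*(Metric.infDist (y+z) K)^2 by ring, one_div, inv_pow]
          field_simp
        have a3 := le_mul_of_one_le_left (abs_nonneg (cn n * (1/2)^n * Real.exp (-2*(Metric.infDist (y+z) K)^2) - ∑ i, q i * Real.exp (-2 * ‖y + z - x i‖^2))) hpow
        linarith)
      (by rw [hi]; simpa using hR)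
  refine ⟨z0 + z, f, g, hfr, fun a b hab => ?_⟩
  have := hz a b (by rw [dist_eq_norm] at hab; rwa [show z0 + f a + g b = z0 + z + f a + g b - z by abel])
  rw [hi, show z0 + f a + g b + z = z0 + z + f a + g b by abel] at this
  exact this
end PBF
set_option autoImplicit false
set_option linter.unusedSectionVars false
namespace PBF
open Finset MeasureTheory Bornology Filter
open scoped Pointwise ENNReal

variable (A : PackingBoundFunction)

lemma A_empty (d : ℕ) : A.toFun d ∅ = 0 := by
  have := A.union d ∅ ∅ isBounded_empty MeasurableSet.empty isBounded_empty MeasurableSet.empty (by simp)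
  rw [Set.union_empty] at this
  linarith

lemma A_mono {d : ℕ} {C C' : Set (Eu d)} (hb : IsBounded C') (hm : MeasurableSet C) (hm' : MeasurableSet C') (h : C ⊆ C') :
    A.toFun d C ≤ A.toFun d C' :=
  A.lipschitz d d C C' (hb.subset h) hm hb hm' ⟨id, h, fun _ _ _ _ => le_rfl⟩

lemma bdd_translate {d : ℕ} (C : Set (Eu d)) (v : Eu d) (hb : IsBounded C) : IsBounded ((fun y => y + v) ⁻¹' C) := by
  have : Isometry (fun y : Eu d => y + v) := fun a b => by simp
  exact this.antilipschitz.isBounded_preimage hb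

lemma A_union_le {d : ℕ} (hd : 1 ≤ d) {C C' : Set (Eu d)} (hb : IsBounded C) (hm : MeasurableSet C)
    (hb' : IsBounded C') (hm' : MeasurableSet C') : A.toFun d (C ∪ C') ≤ A.toFun d C + A.toFun d C' := by
  obtain ⟨M, hM⟩ := (hb.union hb').subset_closedBall (0 : Eu d)
  set M' := max M 0
  have hM' : ∀ y ∈ C ∪ C', ‖y‖ ≤ M' := fun y hy => by
    have := hM hy
    rw [mem_closedBall_zero_iff] at this
    exact this.trans (le_max_left _ _)
  have : Nonempty (Fin d) := ⟨⟨0, hd⟩⟩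
  have : Nontrivial (Eu d) := inferInstance
  obtain ⟨v, hv⟩ := NormedSpace.exists_lt_norm ℝ (Eu d) (4 * M' + 2)
  have hM0 : 0 ≤ M' := le_max_right _ _
  set C2 := (fun y => y + (-v)) ⁻¹' (C' \ C) with hC2
  have hb2 : IsBounded C2 := bdd_translate _ _ (hb'.subset Set.sdiff_subset)
  have hm2 : MeasurableSet C2 := (measurable_id.add_const (-v)) (hm'.diff hm)
  have far : ∀ x ∈ C, ∀ y ∈ C', ‖x - y‖ + 2 ≤ ‖x - (y + v)‖ := by
    intro x hx y hy
    have h1 := hM' x (Or.inl hx)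
    have h2 := hM' y (Or.inr hy)
    have h3 : ‖v‖ ≤ ‖x - y‖ + ‖x - (y + v)‖ := by
      have : v = (x - y) - (x - (y + v)) := by abel
      calc ‖v‖ = ‖(x - y) - (x - (y + v))‖ := by rw [← this]
        _ ≤ _ := norm_sub_le _ _
    have h4 := norm_sub_le x y
    linarith
  have hA2 : A.toFun d C2 ≤ A.toFun d C' := by
    refine A.lipschitz d d C2 C' hb2 hm2 hb' hm' ⟨fun y => y + (-v), fun y hy => hy.1, fun a _ b _ => by simp⟩
  have hU := A.union d C C2 hb hm hb2 hm2 (by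
    intro x hx y hy
    have := far x hx _ hy.1
    rw [dist_eq_norm]
    have e : y + -v + v = y := by abel
    rw [e] at this
    linarith [norm_nonneg (x - (y + -v))])
  classical
  have hL : A.toFun d (C ∪ C') ≤ A.toFun d (C ∪ C2) := by
    refine A.lipschitz d d _ _ (hb.union hb') (hm.union hm') (hb.union hb2) (hm.union hm2)
      ⟨fun y => if y ∈ C then y else y + v, ?_, ?_⟩
    · intro x hx
      by_cases h : x ∈ C
      · simp [h]
      · right
        simp only [h, if_false]
        show x + v + -v ∈ C' \ C
        rw [add_neg_cancel_right]
        exact ⟨hx.resolve_left h, h⟩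
    · intro x hx y hy
      by_cases h : x ∈ C <;> by_cases h' : y ∈ C
      · simp [h, h']
      · simp only [h, h', if_true, if_false]
        have := far x h y (hy.resolve_left h')
        rw [dist_eq_norm, dist_eq_norm]; linarith
      · simp only [h, h', if_true, if_false]
        have := far y h' x (hx.resolve_left h)
        rw [dist_comm x y, dist_comm (x + v) y, dist_eq_norm, dist_eq_norm]; linarith
      · simp [h, h']
  linarith

lemma A_biUnion_le {d : ℕ} (hd : 1 ≤ d) {ι : Type*} (s : Finset ι) (C : ι → Set (Eu d)) (hb : ∀ i, IsBounded (C i))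
    (hm : ∀ i, MeasurableSet (C i)) : A.toFun d (⋃ i ∈ s, C i) ≤ ∑ i ∈ s, A.toFun d (C i) := by
  classical
  induction s using Finset.induction_on with
  | empty => simp [A_empty]
  | insert a s ha ih =>
    rw [Finset.set_biUnion_insert, Finset.sum_insert ha]
    refine (A_union_le A hd (hb a) (hm a) ?_ ?_).trans (by linarith)
    · exact (isBounded_biUnion_finset s).2 fun i _ => hb i
    · exact Finset.measurableSet_biUnion s fun i _ => hm i

lemma A_biUnion_eq {d : ℕ} {ι : Type*} (s : Finset ι) (C : ι → Set (Eu d)) (hb : ∀ i, IsBounded (C i))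
    (hm : ∀ i, MeasurableSet (C i)) (hsep : ∀ i j, i ≠ j → ∀ x ∈ C i, ∀ y ∈ C j, 2 ≤ dist x y) :
    A.toFun d (⋃ i ∈ s, C i) = ∑ i ∈ s, A.toFun d (C i) := by
  classical
  induction s using Finset.induction_on with
  | empty => simp [A_empty]
  | insert a s ha ih =>
    rw [Finset.set_biUnion_insert, Finset.sum_insert ha, ← ih]
    refine A.union _ _ _ (hb a) (hm a) ?_ ?_ ?_
    · exact (isBounded_biUnion_finset s).2 fun i _ => hb i
    · exact Finset.measurableSet_biUnion s fun i _ => hm i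
    · intro x hx y hy
      simp only [Set.mem_iUnion] at hy
      obtain ⟨i, hi, hy⟩ := hy
      exact hsep a i (fun h => ha (h ▸ hi)) x hx y hy

/-- half-open box -/
def bx {d : ℕ} (x : Eu d) (R : ℝ) : Set (Eu d) := {y | ∀ i, x i ≤ y i ∧ y i < x i + R}

lemma bx_eq {d : ℕ} (x : Eu d) (R : ℝ) : bx x R = (WithLp.ofLp : Eu d → Fin d → ℝ) ⁻¹' (Set.univ.pi fun i => Set.Ico (x i) (x i + R)) := by
  ext y; simp [bx]

lemma bx_meas {d : ℕ} (x : Eu d) (R : ℝ) : MeasurableSet (bx x R) := by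
  rw [bx_eq]
  exact (MeasurableSet.univ_pi fun i => measurableSet_Ico).preimage (PiLp.volume_preserving_ofLp (Fin d)).measurable

lemma bx_vol {d : ℕ} (x : Eu d) (R : ℝ) (hR : 0 ≤ R) : volume (bx x R) = ENNReal.ofReal (R^d) := by
  rw [bx_eq, (PiLp.volume_preserving_ofLp (Fin d)).measure_preimage
    (MeasurableSet.univ_pi fun i => measurableSet_Ico).nullMeasurableSet, Real.volume_pi_Ico]
  simp [ENNReal.ofReal_pow hR]

lemma norm_le_of_coord {d : ℕ} (y : Eu d) (R : ℝ) (hR : 0 ≤ R) (h : ∀ i, |y i| ≤ R) : ‖y‖ ≤ R * d := by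
  rw [EuclideanSpace.norm_eq]
  rw [Real.sqrt_le_left (by positivity)]
  calc ∑ i, ‖y i‖^2 ≤ ∑ _i : Fin d, R^2 := by
        refine Finset.sum_le_sum fun i _ => ?_
        rw [Real.norm_eq_abs]; gcongr; exact h i
    _ = R^2 * d := by simp; ring
    _ ≤ _ := by
      rw [mul_pow]
      gcongr
      have : (d:ℝ) ≤ (d:ℝ) * d := by exact_mod_cast Nat.le_mul_self d
      nlinarith

lemma coord_le_norm {d : ℕ} (y : Eu d) (i : Fin d) : |y i| ≤ ‖y‖ := by
  rw [← Real.norm_eq_abs]; exact PiLp.norm_apply_le y i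

lemma bx_dist {d : ℕ} {x y : Eu d} {R : ℝ} (hR : 0 ≤ R) (h : y ∈ bx x R) : dist y x ≤ R * d := by
  rw [dist_eq_norm]
  refine norm_le_of_coord _ _ hR fun i => ?_
  have := h i
  simp only [PiLp.sub_apply]
  rw [abs_le]; constructor <;> linarith

lemma bx_bdd {d : ℕ} (x : Eu d) (R : ℝ) : IsBounded (bx x R) := by
  rcases le_or_gt 0 R with hR | hR
  · exact (Metric.isBounded_closedBall (x := x) (r := R * d)).subset fun y hy => bx_dist hR hy
  · rcases isEmpty_or_nonempty (Fin d) with h | h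
    · exact (Set.toFinite _).isBounded
    · have : bx x R = ∅ := by
        rw [Set.eq_empty_iff_forall_notMem]
        intro y hy
        have := hy h.some
        linarith
      rw [this]; exact isBounded_empty

noncomputable def bs (d : ℕ) (R : ℝ) (hR : 0 < R) : Module.Basis (Fin d) ℝ (Eu d) :=
  (EuclideanSpace.basisFun (Fin d) ℝ).toBasis.unitsSMul (fun _ => Units.mk0 R hR.ne')

lemma bs_repr (d : ℕ) (R : ℝ) (hR : 0 < R) (y : Eu d) (i : Fin d) : (bs d R hR).repr y i = y i / R := by
  unfold bs
  rw [Module.Basis.repr_unitsSMul]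
  simp [div_eq_inv_mul, Units.smul_def]

lemma fd_eq (d : ℕ) (R : ℝ) (hR : 0 < R) : ZSpan.fundamentalDomain (bs d R hR) = bx 0 R := by
  ext y
  rw [ZSpan.mem_fundamentalDomain]
  simp only [bs_repr, bx, Set.mem_Ico, Set.mem_ofPred_eq]
  refine forall_congr' fun i => ?_
  rw [div_lt_one hR]
  simp [div_nonneg_iff, hR.le, hR]

lemma lat_coord (d : ℕ) (R : ℝ) (hR : 0 < R) (g : Submodule.span ℤ (Set.range (bs d R hR))) (i : Fin d) :
    ∃ k : ℤ, (g : Eu d) i = k * R := by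
  have := ((bs d R hR).mem_span_iff_repr_mem ℤ (g : Eu d)).1 g.2 i
  obtain ⟨k, hk⟩ := this
  refine ⟨k, ?_⟩
  rw [bs_repr] at hk
  simp at hk
  rw [eq_div_iff hR.ne'] at hk
  exact hk.symm

lemma mem_bx_add {d : ℕ} (x y v : Eu d) (R : ℝ) : y ∈ bx (v + x) R ↔ y - v ∈ bx x R := by
  unfold bx
  simp only [Set.mem_ofPred_eq, PiLp.add_apply, PiLp.sub_apply]
  refine forall_congr' fun i => ?_
  constructor <;> rintro ⟨h1, h2⟩ <;> constructor <;> linarith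

lemma tile_sum {d : ℕ} (R : ℝ) (hR : 0 < R) (h : Eu d → ℝ≥0∞) (hh : Measurable h) :
    ∫⁻ x in bx (0 : Eu d) R, ∑' g : Submodule.span ℤ (Set.range (bs d R hR)), h ((g : Eu d) + x) = ∫⁻ x, h x := by
  have hF := ZSpan.isAddFundamentalDomain (bs d R hR) (volume : Measure (Eu d))
  have : VAddInvariantMeasure (Submodule.span ℤ (Set.range (bs d R hR))) (Eu d) volume :=
    ⟨fun g s _ => measure_preimage_add volume (g : Eu d) s⟩
  rw [hF.lintegral_eq_tsum'', fd_eq]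
  rw [lintegral_tsum]
  · rfl
  · intro g
    exact (hh.comp (measurable_const_add _)).aemeasurable

lemma master_upper {d : ℕ} (hd : 1 ≤ d) (X : Set (Eu d)) (hXb : IsBounded X) (hXm : MeasurableSet X) (R : ℝ) (hR : 0 < R)
    (h : Eu d → ℝ≥0∞) (hh : Measurable h) (hA : ∀ x, ENNReal.ofReal (A.toFun d (X ∩ bx x R)) ≤ h x) :
    ENNReal.ofReal (R^d) * ENNReal.ofReal (A.toFun d X) ≤ ∫⁻ x, h x := by
  rw [← tile_sum R hR h hh]
  have : ENNReal.ofReal (R^d) * ENNReal.ofReal (A.toFun d X) = ∫⁻ _ in bx (0 : Eu d) R, ENNReal.ofReal (A.toFun d X) := by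
    rw [setLIntegral_const, bx_vol _ _ hR.le, mul_comm]
  rw [this]
  refine lintegral_mono fun x => ?_
  refine le_trans ?_ (ENNReal.tsum_le_tsum fun g => hA _)
  set b := bs d R hR
  have hfin : {g : Submodule.span ℤ (Set.range b) | (X ∩ bx ((g:Eu d) + x) R).Nonempty}.Finite := by
    have hb : IsBounded (X + Metric.closedBall (-x) (R * d)) := hXb.add Metric.isBounded_closedBall
    have := ZSpan.setFinite_inter b hb
    refine Set.Finite.of_finite_image (f := (Subtype.val : _ → Eu d)) (this.subset ?_) Subtype.val_injective.injOn
    rintro _ ⟨g, ⟨y, hy, hyb⟩, rfl⟩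
    refine ⟨?_, g.2⟩
    have h1 := bx_dist hR.le hyb
    refine Set.mem_add.2 ⟨y, hy, (g : Eu d) - y, ?_, by abel⟩
    rw [Metric.mem_closedBall, dist_eq_norm]
    rw [dist_eq_norm] at h1
    have e : (g : Eu d) - y - -x = -(y - ((g : Eu d) + x)) := by abel
    rw [e, norm_neg]
    exact h1
  set T := hfin.toFinset with hT
  have hsub : X ⊆ ⋃ g ∈ T, X ∩ bx ((g:Eu d) + x) R := by
    intro y hy
    obtain ⟨v, hv, -⟩ := ZSpan.exist_unique_vadd_mem_fundamentalDomain b (y - x)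
    rw [fd_eq] at hv
    have hmem : y ∈ bx (((-v : Submodule.span ℤ (Set.range b)) : Eu d) + x) R := by
      rw [show (((-v : Submodule.span ℤ (Set.range b)) : Eu d) + x) = ((-(v:Eu d)) + x) + 0 by simp, mem_bx_add]
      convert hv using 1
      show _ = (v : Eu d) + (y - x)
      abel
    simp only [Set.mem_iUnion]
    refine ⟨-v, ?_, hy, hmem⟩
    rw [hT, Set.Finite.mem_toFinset]
    exact ⟨y, hy, hmem⟩
  have hcb : ∀ g : Submodule.span ℤ (Set.range b), IsBounded (X ∩ bx ((g:Eu d) + x) R) := fun g => hXb.subset Set.inter_subset_left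
  have hcm : ∀ g : Submodule.span ℤ (Set.range b), MeasurableSet (X ∩ bx ((g:Eu d) + x) R) := fun g => hXm.inter (bx_meas _ _)
  have h1 := (A_mono A ((isBounded_biUnion_finset T).2 fun i _ => hcb i) hXm (Finset.measurableSet_biUnion T fun i _ => hcm i) hsub).trans (A_biUnion_le A hd T _ hcb hcm)
  refine (ENNReal.ofReal_le_ofReal h1).trans ?_
  rw [ENNReal.ofReal_sum_of_nonneg (fun g _ => A.nonneg _ _ (hcb g) (hcm g))]
  exact ENNReal.sum_le_tsum _

lemma master_lower {d : ℕ} (X : Set (Eu d)) (hXb : IsBounded X) (hXm : MeasurableSet X) (R : ℝ) (hR : 0 < R)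
    (h : Eu d → ℝ≥0∞) (hh : Measurable h) (hA : ∀ x, h x ≤ ENNReal.ofReal (A.toFun d (X ∩ bx x (R - 2)))) :
    ∫⁻ x, h x ≤ ENNReal.ofReal (R^d) * ENNReal.ofReal (A.toFun d X) := by
  rw [← tile_sum R hR h hh]
  have : ENNReal.ofReal (R^d) * ENNReal.ofReal (A.toFun d X) = ∫⁻ _ in bx (0 : Eu d) R, ENNReal.ofReal (A.toFun d X) := by
    rw [setLIntegral_const, bx_vol _ _ hR.le, mul_comm]
  rw [this]
  refine lintegral_mono fun x => ?_
  refine (ENNReal.tsum_le_tsum fun g => hA _).trans ?_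
  set b := bs d R hR
  have hcb : ∀ g : Submodule.span ℤ (Set.range b), IsBounded (X ∩ bx ((g:Eu d) + x) (R-2)) := fun g => hXb.subset Set.inter_subset_left
  have hcm : ∀ g : Submodule.span ℤ (Set.range b), MeasurableSet (X ∩ bx ((g:Eu d) + x) (R-2)) := fun g => hXm.inter (bx_meas _ _)
  rw [ENNReal.tsum_eq_iSup_sum]
  refine iSup_le fun T => ?_
  rw [← ENNReal.ofReal_sum_of_nonneg (fun g _ => A.nonneg _ _ (hcb g) (hcm g)), ← A_biUnion_eq A T _ hcb hcm]
  · refine ENNReal.ofReal_le_ofReal (A_mono A hXb (Finset.measurableSet_biUnion T fun i _ => hcm i) hXm ?_)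
    exact Set.iUnion₂_subset fun g _ => Set.inter_subset_left
  · intro g g' hgg y hy y' hy'
    have : ∃ i, (g : Eu d) i ≠ (g' : Eu d) i := by
      by_contra hcon
      push Not at hcon
      exact hgg (Subtype.ext (by ext i; exact hcon i))
    obtain ⟨i, hi⟩ := this
    obtain ⟨k, hk⟩ := lat_coord d R hR g i
    obtain ⟨k', hk'⟩ := lat_coord d R hR g' i
    have h1 := hy.2 i
    have h2 := hy'.2 i
    simp only [PiLp.add_apply] at h1 h2
    rw [hk] at h1 hi
    rw [hk'] at h2 hi
    have h3 : 2 ≤ |y i - y' i| := by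
      have : k ≠ k' := fun h => hi (by rw [h])
      rcases lt_or_gt_of_ne this with h | h
      · have h4 : (k:ℝ) + 1 ≤ k' := by exact_mod_cast h
        rw [abs_sub_comm]
        refine le_trans ?_ (le_abs_self _)
        nlinarith
      · have h4 : (k':ℝ) + 1 ≤ k := by exact_mod_cast h
        refine le_trans ?_ (le_abs_self _)
        nlinarith
    rw [dist_eq_norm]
    exact h3.trans (coord_le_norm (y - y') i)
end PBF
set_option autoImplicit false
set_option linter.unusedSectionVars false
namespace PBF
open Finset MeasureTheory Bornology Filter
open scoped Pointwise ENNReal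

variable (A : PackingBoundFunction)

/-- closed cube -/
def cb (n : ℕ) (l : ℝ) : Set (Eu n) := {y | ∀ i, 0 ≤ y i ∧ y i ≤ l}

lemma cb_eq (n : ℕ) (k : ℕ) : (2:ℝ)^k • unitCube n = cb n (2^k) := by
  ext y
  have h2 : (0:ℝ) < 2^k := by positivity
  rw [Set.mem_smul_set_iff_inv_smul_mem₀ h2.ne']
  simp only [unitCube, cb, Set.mem_ofPred_eq, Set.mem_Icc, PiLp.smul_apply, smul_eq_mul]
  refine forall_congr' fun i => ?_
  rw [inv_mul_le_iff₀ h2, mul_one, mul_nonneg_iff_of_pos_left (by positivity)]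

lemma cb_meas (n : ℕ) (l : ℝ) : MeasurableSet (cb n l) := by
  have : cb n l = ⋂ i, {y : Eu n | 0 ≤ y i ∧ y i ≤ l} := by ext; simp [cb]
  rw [this]
  refine MeasurableSet.iInter fun i => ?_
  have hc : Continuous (fun y : Eu n => y i) := by fun_prop
  exact ((isClosed_le continuous_const hc).inter (isClosed_le hc continuous_const)).measurableSet

lemma cb_bdd (n : ℕ) (l : ℝ) : IsBounded (cb n l) := by
  refine (bx_bdd (0 : Eu n) (l+1)).subset fun y hy i => ?_
  have := hy i
  simp only [PiLp.zero_apply]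
  constructor <;> linarith

lemma cb_nonneg (n : ℕ) (l : ℝ) : 0 ≤ A.toFun n (cb n l) := A.nonneg _ _ (cb_bdd _ _) (cb_meas _ _)

/-- any subset of a box is bounded by the box at the origin -/
lemma A_box {n : ℕ} (X : Set (Eu n)) (hm : MeasurableSet X) (x : Eu n) (R : ℝ) (h : X ⊆ bx x R) :
    A.toFun n X ≤ A.toFun n (cb n R) := by
  refine A.lipschitz n n _ _ ((bx_bdd x R).subset h) hm (cb_bdd _ _) (cb_meas _ _) ⟨fun y => y - x, fun y hy i => ?_, fun a _ b _ => by simp⟩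
  have := h hy i
  simp only [PiLp.sub_apply]
  constructor <;> linarith

lemma flat_up {n : ℕ} (hn : 1 ≤ n) (U : Set (Eu n)) (hb : IsBounded U) (hm : MeasurableSet U) (l : ℝ) (hl : 0 < l) :
    ENNReal.ofReal (l^n) * ENNReal.ofReal (A.toFun n U) ≤ ENNReal.ofReal (A.toFun n (cb n l)) * volume (Metric.thickening (l * n + 1) U) := by
  refine (master_upper A hn U hb hm l hl ((Metric.thickening (l * n + 1) U).indicator fun _ => ENNReal.ofReal (A.toFun n (cb n l)))
    (measurable_const.indicator Metric.isOpen_thickening.measurableSet) ?_).trans ?_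
  · intro x
    rcases Set.eq_empty_or_nonempty (U ∩ bx x l) with h | ⟨y, hy, hyb⟩
    · rw [h, A_empty]; simp
    · rw [Set.indicator_of_mem]
      · exact ENNReal.ofReal_le_ofReal (A_box A _ (hm.inter (bx_meas _ _)) x l Set.inter_subset_right)
      · rw [Metric.mem_thickening_iff]
        refine ⟨y, hy, ?_⟩
        have := bx_dist hl.le hyb
        rw [dist_comm]; linarith
  · rw [lintegral_indicator Metric.isOpen_thickening.measurableSet, setLIntegral_const]

lemma flat_low {n : ℕ} (U V : Set (Eu n)) (hUm : MeasurableSet U) (hb : IsBounded V) (hm : MeasurableSet V) (l : ℝ) (hl : 0 < l)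
    (h : Metric.thickening (l * n + 1) U ⊆ V) :
    ENNReal.ofReal (A.toFun n (cb n l)) * volume U ≤ ENNReal.ofReal ((l+3)^n) * ENNReal.ofReal (A.toFun n V) := by
  refine le_trans ?_ (master_lower A V hb hm (l+3) (by linarith) (U.indicator fun _ => ENNReal.ofReal (A.toFun n (cb n l)))
    (measurable_const.indicator hUm) ?_)
  · rw [lintegral_indicator hUm, setLIntegral_const]
  · intro x
    by_cases hx : x ∈ U
    · rw [Set.indicator_of_mem hx]
      refine ENNReal.ofReal_le_ofReal (A.lipschitz n n _ _ (cb_bdd _ _) (cb_meas _ _) (hb.subset Set.inter_subset_left) (hm.inter (bx_meas _ _)) ⟨fun y => y + x, fun y hy => ⟨h ?_, fun i => ?_⟩, fun a _ b _ => by simp⟩)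
      · rw [Metric.mem_thickening_iff]
        refine ⟨x, hx, ?_⟩
        rw [dist_eq_norm, add_sub_cancel_right]
        have := norm_le_of_coord y l hl.le (fun i => by rw [abs_of_nonneg (hy i).1]; exact (hy i).2)
        linarith
      · have := hy i
        simp only [PiLp.add_apply]
        constructor <;> linarith
    · rw [Set.indicator_of_notMem hx]; exact bot_le

lemma cube_growth {n : ℕ} (hn : 1 ≤ n) (l t : ℝ) (hl : 0 < l) (ht : 0 ≤ t) :
    A.toFun n (cb n t) ≤ A.toFun n (cb n l) / l^n * (t + 2 * (l * n + 1))^n := by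
  have h := flat_up A hn (cb n t) (cb_bdd _ _) (cb_meas _ _) l hl
  have h2 : volume (Metric.thickening (l * n + 1) (cb n t)) ≤ ENNReal.ofReal ((t + 2 * (l * n + 1))^n) := by
    rw [← bx_vol (WithLp.toLp 2 (fun _ : Fin n => -(l * n + 1))) _ (by positivity)]
    refine measure_mono fun y hy i => ?_
    obtain ⟨z, hz, hyz⟩ := Metric.mem_thickening_iff.1 hy
    rw [dist_eq_norm] at hyz
    have h3 := (coord_le_norm (y - z) i).trans_lt hyz
    simp only [PiLp.sub_apply] at h3
    rw [abs_lt] at h3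
    have := hz i
    simp only
    constructor <;> linarith
  have h3 := h.trans (mul_le_mul_right h2 _)
  rw [← ENNReal.ofReal_mul (by positivity), ← ENNReal.ofReal_mul (cb_nonneg A _ _), ENNReal.ofReal_le_ofReal_iff (mul_nonneg (cb_nonneg A _ _) (by positivity))] at h3
  rw [div_mul_eq_mul_div, le_div_iff₀ (by positivity)]
  linarith

lemma dens_seq (n : ℕ) : pbfDensity A n = limsup (fun k : ℕ => A.toFun n (cb n (2^k)) / (2^k)^n) atTop := by
  unfold pbfDensity
  simp_rw [cb_eq, pow_mul]

lemma growth_tendsto {n : ℕ} (a c : ℝ) : Tendsto (fun k : ℕ => a * (((2:ℝ)^k + c)/2^k)^n) atTop (nhds a) := by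
  have h1 : Tendsto (fun k : ℕ => ((2:ℝ)^k + c)/2^k) atTop (nhds 1) := by
    have h2 : Tendsto (fun k : ℕ => 1 + c * ((1/2:ℝ)^k)) atTop (nhds (1 + c * 0)) :=
      ((tendsto_pow_atTop_nhds_zero_of_lt_one (by norm_num) (by norm_num)).const_mul c).const_add 1
    rw [mul_zero, add_zero] at h2
    refine h2.congr fun k => ?_
    rw [div_pow, one_pow]; field_simp
  have := (h1.pow n).const_mul a
  simpa using this

lemma seq_bound {n : ℕ} (hn : 1 ≤ n) (l : ℝ) (hl : 0 < l) (k : ℕ) : A.toFun n (cb n (2^k)) / (2^k)^n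
    ≤ A.toFun n (cb n l) / l^n * (((2:ℝ)^k + 2 * (l * n + 1))/2^k)^n := by
  rw [div_pow, ← mul_div_assoc]
  gcongr
  exact cube_growth A hn l _ hl (by positivity)

lemma seq_bdd {n : ℕ} (hn : 1 ≤ n) : IsBoundedUnder (· ≤ ·) atTop (fun k : ℕ => A.toFun n (cb n (2^k)) / (2^k)^n) := by
  have := (growth_tendsto (n := n) (A.toFun n (cb n 1) / 1^n) (2 * (1 * n + 1))).isBoundedUnder_le
  exact this.mono_le (Eventually.of_forall fun k => seq_bound A hn 1 one_pos k)

lemma seq_cobdd (n : ℕ) : IsCoboundedUnder (· ≤ ·) atTop (fun k : ℕ => A.toFun n (cb n (2^k)) / (2^k)^n) := by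
  refine IsBoundedUnder.isCoboundedUnder_le ⟨0, Filter.eventually_map.2 (Eventually.of_forall fun k => ?_)⟩
  exact div_nonneg (cb_nonneg A _ _) (by positivity)

lemma dens_le {n : ℕ} (hn : 1 ≤ n) (l : ℝ) (hl : 0 < l) : pbfDensity A n ≤ A.toFun n (cb n l) / l^n := by
  rw [dens_seq]
  have ht := growth_tendsto (n := n) (A.toFun n (cb n l) / l^n) (2 * (l * n + 1))
  rw [← ht.limsup_eq]
  exact limsup_le_limsup (Eventually.of_forall fun k => seq_bound A hn l hl k) (seq_cobdd A n) ht.isBoundedUnder_le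

lemma dens_nonneg {n : ℕ} (hn : 1 ≤ n) : 0 ≤ pbfDensity A n := by
  rw [dens_seq]
  refine le_limsup_of_frequently_le (Frequently.of_forall fun k => ?_) (seq_bdd A hn)
  exact div_nonneg (cb_nonneg A _ _) (by positivity)

lemma flatU {n : ℕ} (hn : 1 ≤ n) (ε : ℝ) (hε : 0 < ε) : ∃ c > 0, ∀ U : Set (Eu n), IsBounded U → MeasurableSet U →
    ENNReal.ofReal (A.toFun n U) ≤ ENNReal.ofReal (pbfDensity A n + ε) * volume (Metric.thickening c U) := by
  have h1 : limsup (fun k : ℕ => A.toFun n (cb n (2^k)) / (2^k)^n) atTop < pbfDensity A n + ε := by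
    rw [← dens_seq]; linarith
  obtain ⟨k, hk⟩ := (eventually_lt_of_limsup_lt h1 (seq_bdd A hn)).exists
  refine ⟨2^k * n + 1, by positivity, fun U hb hm => ?_⟩
  have h2 := flat_up A hn U hb hm (2^k) (by positivity)
  have hp : (0:ℝ) < (2^k)^n := by positivity
  have h3 : A.toFun n (cb n (2^k)) ≤ (2^k)^n * (pbfDensity A n + ε) := by
    rw [div_lt_iff₀ hp] at hk; linarith
  have h4 := h2.trans (mul_le_mul_left (ENNReal.ofReal_le_ofReal h3) _)
  rw [ENNReal.ofReal_mul hp.le, mul_assoc] at h4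
  exact (ENNReal.mul_le_mul_iff_right (by simpa using hp) ENNReal.ofReal_ne_top).1 h4

lemma flatL {n : ℕ} (hn : 1 ≤ n) (ε : ℝ) (hε : 0 < ε) : ∃ c > 0, ∀ U V : Set (Eu n), MeasurableSet U → IsBounded V → MeasurableSet V →
    Metric.thickening c U ⊆ V →
    ENNReal.ofReal (pbfDensity A n * (1 - ε)) * volume U ≤ ENNReal.ofReal (A.toFun n V) := by
  have h1 : Tendsto (fun k : ℕ => ((1:ℝ) * (((2:ℝ)^k + 3)/2^k)^n)⁻¹) atTop (nhds 1⁻¹) :=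
    (growth_tendsto (n := n) 1 3).inv₀ one_ne_zero
  rw [inv_one] at h1
  obtain ⟨k, hk⟩ := (h1.eventually (lt_mem_nhds (show 1 - ε < 1 by linarith))).exists
  refine ⟨2^k * n + 1, by positivity, fun U V hUm hb hm h => ?_⟩
  have h2 := flat_low A U V hUm hb hm (2^k) (by positivity) h
  have hp : (0:ℝ) < (2^k + 3)^n := by positivity
  have h3 : (2^k + 3)^n * (pbfDensity A n * (1 - ε)) ≤ A.toFun n (cb n (2^k)) := by
    have h5 := dens_le A hn (2^k) (by positivity)
    rw [le_div_iff₀ (by positivity)] at h5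
    rw [one_mul, div_pow, inv_div, lt_div_iff₀ hp] at hk
    have h6 := dens_nonneg A hn
    nlinarith
  have h4 := (mul_le_mul_left (ENNReal.ofReal_le_ofReal h3) (volume U)).trans h2
  rw [ENNReal.ofReal_mul hp.le, mul_assoc] at h4
  exact (ENNReal.mul_le_mul_iff_right (by simpa using hp) ENNReal.ofReal_ne_top).1 h4
end PBF
set_option autoImplicit false
set_option linter.unusedSectionVars false
namespace PBF
open Finset MeasureTheory Bornology Filter
open scoped Pointwise ENNReal

variable (A : PackingBoundFunction)

lemma A_iso {n d : ℕ} (φ : Eu n → Eu d) (hφ : Isometry φ) (W : Set (Eu n)) (hb : IsBounded W) (hm : MeasurableSet W) :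
    IsBounded (φ '' W) ∧ MeasurableSet (φ '' W) ∧ A.toFun d (φ '' W) = A.toFun n W := by
  have hb' : IsBounded (φ '' W) := hφ.lipschitz.isBounded_image hb
  have hm' : MeasurableSet (φ '' W) := hφ.isClosedEmbedding.measurableEmbedding.measurableSet_image.2 hm
  refine ⟨hb', hm', le_antisymm ?_ ?_⟩
  · refine A.lipschitz _ _ _ _ hb' hm' hb hm ⟨Function.invFun φ, ?_, ?_⟩
    · rintro _ ⟨a, ha, rfl⟩
      rwa [Function.leftInverse_invFun hφ.injective]
    · rintro _ ⟨a, ha, rfl⟩ _ ⟨b, hb, rfl⟩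
      rw [Function.leftInverse_invFun hφ.injective, Function.leftInverse_invFun hφ.injective, hφ.dist_eq]
  · exact A.lipschitz _ _ _ _ hb hm hb' hm' ⟨φ, fun a ha => ⟨a, ha, rfl⟩, fun a _ b _ => (hφ.dist_eq a b).ge⟩

lemma mesh_up {d : ℕ} (ε : ℝ) (hε : 0 < ε) (C C' : Set (Eu d)) (hb : IsBounded C) (hm : MeasurableSet C)
    (hb' : IsBounded C') (hm' : MeasurableSet C') (h : C ⊆ Metric.thickening (ε / (1 + ε)) C') :
    A.toFun d C ≤ A.toFun d ((1 + ε) • C') := by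
  have h1 : (0:ℝ) < 1 + ε := by linarith
  have := A.mesh ε hε d ((1+ε) • C) ((1+ε) • C') (hb.smul₀ _) (hm.const_smul₀ _) (hb'.smul₀ _) (hm'.const_smul₀ _)
    (by rw [thickening_smul _ _ _ h1]; exact Set.smul_set_mono h)
  rwa [smul_smul, one_div, inv_mul_cancel₀ h1.ne', one_smul] at this

lemma smul_aff {n d : ℕ} (f : Eu n →ₗᵢ[ℝ] Eu d) (z0 : Eu d) (c : ℝ) (W : Set (Eu n)) :
    c • ((fun a => z0 + f a) '' W) = (fun a => c • z0 + f a) '' (c • W) := by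
  ext y
  simp only [Set.mem_smul_set, Set.mem_image]
  constructor
  · rintro ⟨_, ⟨a, ha, rfl⟩, rfl⟩
    exact ⟨c • a, ⟨a, ha, rfl⟩, by simp⟩
  · rintro ⟨_, ⟨a, ha, rfl⟩, rfl⟩
    exact ⟨_, ⟨a, ha, rfl⟩, by simp⟩

lemma aff_iso {n d : ℕ} (f : Eu n →ₗᵢ[ℝ] Eu d) (z0 : Eu d) : Isometry (fun a => z0 + f a) :=
  (isometry_add_left z0).comp f.isometry

lemma frame_dist_le {n d : ℕ} (f : Eu n →ₗᵢ[ℝ] Eu d) (g : Eu (d-n) →ₗᵢ[ℝ] Eu d) (z0 : Eu d) (a a' : Eu n) (b b' : Eu (d-n)) :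
    dist (z0 + f a + g b) (z0 + f a' + g b') ≤ dist a a' + dist b b' := by
  rw [add_assoc, add_assoc, dist_add_left]
  refine (dist_add_add_le _ _ _ _).trans ?_
  rw [f.dist_map, g.dist_map]

/-- the all-`s` vector -/
noncomputable def dg (d : ℕ) (s : ℝ) : Eu d := WithLp.toLp 2 (fun _ => s)

lemma dg_apply (d : ℕ) (s : ℝ) (i : Fin d) : dg d s i = s := rfl

lemma bx_grow {d : ℕ} {x y y' : Eu d} {R s : ℝ} (h : y ∈ bx x R) (hd : dist y y' < s) : y' ∈ bx (x - dg d s) (R + 2*s) := by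
  intro i
  have h1 := h i
  have h2 := (coord_le_norm (y - y') i)
  rw [← dist_eq_norm] at h2
  simp only [PiLp.sub_apply, dg_apply] at *
  have := abs_lt.1 (h2.trans_lt hd)
  constructor <;> linarith [this.1, this.2, h1.1, h1.2]

lemma bx_shrink {d : ℕ} {x y y' : Eu d} {R s : ℝ} (h : y ∈ bx (x + dg d s) (R - 2*s)) (hd : dist y y' < s) : y' ∈ bx x R := by
  have := bx_grow h hd
  rwa [add_sub_cancel_right, sub_add_cancel] at this

lemma prod_vol_le {n d : ℕ} (f : Eu n →ₗᵢ[ℝ] Eu d) (g : Eu (d-n) →ₗᵢ[ℝ] Eu d) (hF : IsFrame f g) (z0 : Eu d)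
    (T : Set (Eu n)) (S : Set (Eu (d-n))) (Y : Set (Eu d)) (hY : MeasurableSet Y)
    (h : ∀ a ∈ T, ∀ b ∈ S, z0 + f a + g b ∈ Y) : volume T * volume S ≤ volume Y := by
  rw [← Measure.prod_prod, ← measure_preimage_add volume z0 Y,
    ← hF.2.2.measure_preimage (((measurable_const_add z0) hY).nullMeasurableSet)]
  refine measure_mono ?_
  rintro ⟨a, b⟩ ⟨ha, hb⟩
  have := h a ha b hb
  rw [add_assoc] at this
  exact this

lemma le_prod_vol {n d : ℕ} (f : Eu n →ₗᵢ[ℝ] Eu d) (g : Eu (d-n) →ₗᵢ[ℝ] Eu d) (hF : IsFrame f g) (z0 : Eu d)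
    (T : Set (Eu n)) (S : Set (Eu (d-n))) (Y : Set (Eu d)) (hY : MeasurableSet Y)
    (h : ∀ a b, z0 + f a + g b ∈ Y → a ∈ T ∧ b ∈ S) : volume Y ≤ volume T * volume S := by
  rw [← Measure.prod_prod, ← measure_preimage_add volume z0 Y,
    ← hF.2.2.measure_preimage (((measurable_const_add z0) hY).nullMeasurableSet)]
  refine measure_mono ?_
  rintro ⟨a, b⟩ hab
  have := h a b (by rw [add_assoc]; exact hab)
  exact this

lemma win_upper {n d : ℕ} (hn : 1 ≤ n) (ε : ℝ) (hε : 0 < ε) (η : ℝ) (hη : 0 < η) (hη2 : η < 1/2) :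
    ∃ s0 > (0:ℝ), ∀ s ≥ s0, ∀ R > (0:ℝ), ∀ R' ≥ R * d + s, ∀ (K : Set (Eu d)), IsClosed K → ∀ x : Eu d,
    (∃ (z0 : Eu d) (f : Eu n →ₗᵢ[ℝ] Eu d) (g : Eu (d-n) →ₗᵢ[ℝ] Eu d), IsFrame f g ∧
      ∀ a b, dist (z0 + f a + g b) x ≤ R' → |Metric.infDist (z0 + f a + g b) K - ‖b‖| ≤ η) →
    volume (Metric.ball (0 : Eu (d-n)) 1) * ENNReal.ofReal (A.toFun d (K ∩ bx x R)) ≤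
      ENNReal.ofReal ((pbfDensity A n + ε) * (1+2*η)^n) *
        volume (Metric.thickening (1+2*η) K ∩ bx (x - dg d s) (R + 2*s)) := by
  obtain ⟨c, hc, hU⟩ := flatU A hn ε hε
  refine ⟨c + 2, by linarith, fun s hs R hR R' hR' K hK x => ?_⟩
  rintro ⟨z0, f, g, hF, hW⟩
  have hl : (0:ℝ) < 1 + 2*η := by linarith
  set X := K ∩ bx x R with hX
  have hXm : MeasurableSet X := hK.measurableSet.inter (bx_meas _ _)
  have hXb : IsBounded X := (bx_bdd x R).subset Set.inter_subset_right
  set W0 : Set (Eu n) := {a | ∃ b, z0 + f a + g b ∈ X} with hW0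
  have hsmall : ∀ a b, z0 + f a + g b ∈ X → ‖b‖ ≤ η := by
    intro a b hab
    have h1 := hW a b ((bx_dist hR.le hab.2).trans (by linarith))
    rw [Metric.infDist_zero_of_mem hab.1] at h1
    simpa using h1
  have hW0b : IsBounded W0 := by
    rw [isBounded_iff_forall_norm_le]
    obtain ⟨M, hM⟩ := isBounded_iff_forall_norm_le.1 hXb
    refine ⟨M + ‖z0‖ + η, ?_⟩
    rintro a ⟨b, hab⟩
    have h1 := hM _ hab
    have h2 := hsmall _ _ hab
    have h3 : ‖f a‖ ≤ ‖z0 + f a + g b‖ + ‖z0‖ + ‖g b‖ := by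
      have : f a = (z0 + f a + g b) - z0 - g b := by abel
      conv_lhs => rw [this]
      exact (norm_sub_le _ _).trans (by gcongr; exact norm_sub_le _ _)
    rw [f.norm_map, g.norm_map] at h3
    linarith
  set W := closure W0
  have hWb : IsBounded W := hW0b.closure
  have hWm : MeasurableSet W := isClosed_closure.measurableSet
  obtain ⟨e1, e2, -⟩ := A_iso A _ (aff_iso f z0) W hWb hWm
  have hlW : IsBounded ((1+2*η) • W) := hWb.smul₀ _
  have hlWm : MeasurableSet ((1+2*η) • W) := hWm.const_smul₀ _
  have hA1 : A.toFun d X ≤ A.toFun n ((1+2*η) • W) := by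
    have h1 := mesh_up A (2*η) (by linarith) X ((fun a => z0 + f a) '' W) hXb hXm e1 e2 (by
      intro y hy
      obtain ⟨a, b, hab⟩ := hF.2.1 (y - z0)
      have hy' : y = z0 + f a + g b := by rw [add_assoc, ← hab]; abel
      rw [Metric.mem_thickening_iff]
      refine ⟨z0 + f a, ⟨a, subset_closure ⟨b, hy' ▸ hy⟩, rfl⟩, ?_⟩
      rw [hy', dist_eq_norm, add_sub_cancel_left, g.norm_map]
      refine (hsmall a b (hy' ▸ hy)).trans_lt ?_
      rw [lt_div_iff₀ hl]
      nlinarith)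
    rw [smul_aff] at h1
    rwa [(A_iso A _ (aff_iso f _) _ hlW hlWm).2.2] at h1
  have hvol : volume (Metric.thickening c ((1+2*η) • W)) ≤ ENNReal.ofReal ((1+2*η)^n) * volume (Metric.thickening c W0) := by
    rw [thickening_smul _ _ _ hl, vol_smul _ _ hl]
    refine mul_le_mul_right (measure_mono ?_) _
    rw [Metric.thickening_closure]
    exact Metric.thickening_mono (div_le_self hc.le (by linarith)) _
  have hprod : volume (Metric.thickening c W0) * volume (Metric.ball (0 : Eu (d-n)) 1) ≤
      volume (Metric.thickening (1+2*η) K ∩ bx (x - dg d s) (R + 2*s)) := by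
    refine prod_vol_le f g hF z0 _ _ _ (Metric.isOpen_thickening.measurableSet.inter (bx_meas _ _)) ?_
    intro a ha b hb
    obtain ⟨a0, ⟨b0, hab⟩, hd⟩ := Metric.mem_thickening_iff.1 ha
    have hb0 := hsmall a0 b0 hab
    have hbn : ‖b‖ < 1 := by simpa using hb
    have hdist : dist (z0 + f a0 + g b0) (z0 + f a + g b) < s := by
      refine (frame_dist_le f g z0 _ _ _ _).trans_lt ?_
      rw [dist_comm a0]
      have : dist b0 b ≤ ‖b0‖ + ‖b‖ := by rw [dist_eq_norm]; exact norm_sub_le _ _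
      linarith
    refine ⟨?_, bx_grow hab.2 hdist⟩
    have h1 := hW a b (by
      have := dist_triangle_left (z0 + f a + g b) x (z0 + f a0 + g b0)
      have := bx_dist hR.le hab.2
      linarith)
    rw [Metric.mem_thickening_iff_infDist_lt ⟨_, hab.1⟩]
    linarith [(abs_le.1 h1).2]
  have hδ : 0 ≤ pbfDensity A n := dens_nonneg A hn
  calc _ ≤ volume (Metric.ball (0 : Eu (d-n)) 1) * (ENNReal.ofReal (pbfDensity A n + ε) * (ENNReal.ofReal ((1+2*η)^n) * volume (Metric.thickening c W0))) := by
        gcongr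
        refine (ENNReal.ofReal_le_ofReal hA1).trans ((hU _ hlW hlWm).trans ?_)
        gcongr
    _ = ENNReal.ofReal ((pbfDensity A n + ε) * (1+2*η)^n) * (volume (Metric.thickening c W0) * volume (Metric.ball (0 : Eu (d-n)) 1)) := by
        rw [ENNReal.ofReal_mul (by linarith)]; ring
    _ ≤ _ := by gcongr

lemma win_lower {n d : ℕ} (hn : 1 ≤ n) (ε : ℝ) (hε : 0 < ε) (η : ℝ) (hη : 0 < η) (hη2 : η < 1/2) :
    ∃ s0 > (0:ℝ), ∀ s ≥ s0, ∀ R > 2 + 2 * s, ∀ R' ≥ R * d + s, ∀ (K : Set (Eu d)), IsClosed K → K.Nonempty → ∀ x : Eu d,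
    (∃ (z0 : Eu d) (f : Eu n →ₗᵢ[ℝ] Eu d) (g : Eu (d-n) →ₗᵢ[ℝ] Eu d), IsFrame f g ∧
      ∀ a b, dist (z0 + f a + g b) x ≤ R' → |Metric.infDist (z0 + f a + g b) K - ‖b‖| ≤ η) →
    ENNReal.ofReal (pbfDensity A n * (1 - ε)) * (ENNReal.ofReal ((1/(1+2*η))^n) *
        volume (Metric.thickening (1-2*η) K ∩ bx (x + dg d s) (R - 2 - 2*s))) ≤
     volume (Metric.ball (0 : Eu (d-n)) 1) * ENNReal.ofReal (A.toFun d (K ∩ bx x (R-2))) := by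
  obtain ⟨c, hc, hU⟩ := flatL A hn ε hε
  refine ⟨2 * c + 2, by linarith, fun s hs R hR R' hR' K hK hKne x => ?_⟩
  rintro ⟨z0, f, g, hF, hW⟩
  have hl : (0:ℝ) < 1 + 2*η := by linarith
  have hli : (0:ℝ) < 1 / (1 + 2*η) := by positivity
  set Y := Metric.thickening (1-2*η) K ∩ bx (x + dg d s) (R - 2 - 2*s) with hY
  have hYm : MeasurableSet Y := Metric.isOpen_thickening.measurableSet.inter (bx_meas _ _)
  set X := K ∩ bx x (R-2) with hX
  have hXm : MeasurableSet X := hK.measurableSet.inter (bx_meas _ _)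
  have hXb : IsBounded X := (bx_bdd x _).subset Set.inter_subset_right
  set W0 : Set (Eu n) := {a | ∃ b, z0 + f a + g b ∈ Y} with hW0
  have hs0 : 0 < s := by linarith
  have hYx : ∀ y ∈ Y, dist y x ≤ R * d := by
    intro y hy
    have h1 : y ∈ bx x (R-2) := bx_shrink (s := s) hy.2 (by simpa using hs0)
    refine (bx_dist (by linarith) h1).trans ?_
    have : (0:ℝ) ≤ d := by positivity
    nlinarith
  have hsmall : ∀ a b, z0 + f a + g b ∈ Y → ‖b‖ < 1 := by
    intro a b hab
    have h1 := hW a b ((hYx _ hab).trans (by linarith))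
    have h2 := (Metric.mem_thickening_iff_infDist_lt hKne).1 hab.1
    linarith [(abs_le.1 h1).1]
  have hW0b : IsBounded W0 := by
    rw [isBounded_iff_forall_norm_le]
    refine ⟨R*d + ‖x‖ + ‖z0‖ + 1, ?_⟩
    rintro a ⟨b, hab⟩
    have h1 := hYx _ hab
    have h2 := hsmall _ _ hab
    have h3 : ‖f a‖ ≤ ‖z0 + f a + g b - x‖ + ‖x‖ + ‖z0‖ + ‖g b‖ := by
      have : f a = (z0 + f a + g b - x) + x - z0 - g b := by abel
      conv_lhs => rw [this]
      exact (norm_sub_le _ _).trans (by gcongr; exact (norm_sub_le _ _).trans (by gcongr; exact norm_add_le _ _))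
    rw [f.norm_map, g.norm_map, ← dist_eq_norm] at h3
    linarith
  set U := closure W0
  set V := Metric.thickening (2*c) W0
  have hVb : IsBounded V := hW0b.thickening
  have hVm : MeasurableSet V := Metric.isOpen_thickening.measurableSet
  obtain ⟨e1, e2, -⟩ := A_iso A _ (aff_iso f z0) V hVb hVm
  have hVb' : IsBounded ((1/(1+2*η)) • V) := hVb.smul₀ _
  have hVm' : MeasurableSet ((1/(1+2*η)) • V) := hVm.const_smul₀ _
  have hA1 : A.toFun n ((1/(1+2*η)) • V) ≤ A.toFun d X := by
    have h1 := A.mesh (2*η) (by linarith) d ((fun a => z0 + f a) '' V) X e1 e2 hXb hXm (by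
      rintro _ ⟨a, ha, rfl⟩
      obtain ⟨a0, ⟨b0, hab⟩, hd⟩ := Metric.mem_thickening_iff.1 ha
      have hb0 := hsmall a0 b0 hab
      have hdist : dist (z0 + f a0 + g b0) (z0 + f a) < 2*c + 1 := by
        have := (frame_dist_le f g z0 a0 a b0 0)
        simp only [map_zero, add_zero, dist_zero_right] at this
        rw [dist_comm a0] at this
        linarith
      have h1 := hW a 0 (by
        have := dist_triangle_left (z0 + f a) x (z0 + f a0 + g b0)
        have := hYx _ hab
        simp only [map_zero, add_zero]
        linarith)
      simp only [map_zero, add_zero, norm_zero, sub_zero] at h1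
      have h2 : Metric.infDist (z0 + f a) K < 2*η := by linarith [(abs_le.1 h1).2]
      obtain ⟨k, hk, hkd⟩ := (Metric.infDist_lt_iff hKne).1 h2
      refine Metric.mem_thickening_iff.2 ⟨k, ⟨hk, ?_⟩, hkd⟩
      refine bx_shrink (s := s) hab.2 ?_
      have := dist_triangle (z0 + f a0 + g b0) (z0 + f a) k
      linarith)
    rw [smul_aff] at h1
    rwa [(A_iso A _ (aff_iso f _) _ hVb' hVm').2.2] at h1
  have hUm : MeasurableSet U := isClosed_closure.measurableSet
  have h3 := hU ((1/(1+2*η)) • U) ((1/(1+2*η)) • V) (hUm.const_smul₀ _) hVb' hVm' (by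
    rw [thickening_smul _ _ _ hli, Metric.thickening_closure]
    refine Set.smul_set_mono (Metric.thickening_mono ?_ _)
    rw [div_div_eq_mul_div, div_one]
    nlinarith)
  rw [vol_smul _ _ hli] at h3
  have hprod : volume Y ≤ volume U * volume (Metric.ball (0 : Eu (d-n)) 1) := by
    refine le_prod_vol f g hF z0 _ _ _ hYm ?_
    intro a b hab
    exact ⟨subset_closure ⟨b, hab⟩, by simpa using hsmall a b hab⟩
  calc _ ≤ ENNReal.ofReal (pbfDensity A n * (1 - ε)) * (ENNReal.ofReal ((1/(1+2*η))^n) * (volume U * volume (Metric.ball (0 : Eu (d-n)) 1))) := by gcongr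
    _ = volume (Metric.ball (0 : Eu (d-n)) 1) * (ENNReal.ofReal (pbfDensity A n * (1 - ε)) * (ENNReal.ofReal ((1/(1+2*η))^n) * volume U)) := by ring
    _ ≤ _ := by
      gcongr
      exact h3.trans (ENNReal.ofReal_le_ofReal hA1)

end PBF
set_option autoImplicit false
set_option linter.unusedSectionVars false
namespace PBF
open Finset MeasureTheory Bornology Filter
open scoped Pointwise ENNReal

variable (A : PackingBoundFunction)

lemma conv_int {d : ℕ} (G : Eu d → ℝ≥0∞) (hG : Measurable G) (B : Set (Eu d)) (hB : MeasurableSet B) :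
    Measurable (fun x : Eu d => ∫⁻ y, G y * B.indicator 1 (y - x)) ∧
    ∫⁻ x, ∫⁻ y, G y * B.indicator 1 (y - x) = volume B * ∫⁻ y, G y := by
  have hm : Measurable (fun p : Eu d × Eu d => G p.2 * B.indicator (1 : Eu d → ℝ≥0∞) (p.2 - p.1)) :=
    (hG.comp measurable_snd).mul ((measurable_one.indicator hB).comp (measurable_snd.sub measurable_fst))
  refine ⟨hm.lintegral_prod_right', ?_⟩
  rw [lintegral_lintegral_swap hm.aemeasurable]
  have : ∀ y : Eu d, ∫⁻ x, G y * B.indicator (1 : Eu d → ℝ≥0∞) (y - x) = volume B * G y := by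
    intro y
    have hmm : Measurable (fun x => B.indicator (1 : Eu d → ℝ≥0∞) (y - x)) :=
      (measurable_one.indicator hB).comp (measurable_const_sub y)
    rw [lintegral_const_mul _ hmm,
      lintegral_sub_left_eq_self (fun x => B.indicator (1 : Eu d → ℝ≥0∞) x) y, lintegral_indicator_one hB, mul_comm]
  simp_rw [this]
  rw [lintegral_const_mul _ hG]

lemma vol_bx_conv {d : ℕ} (Y : Set (Eu d)) (hY : MeasurableSet Y) (v : Eu d) (S : ℝ) (hS : 0 ≤ S) :
    Measurable (fun x : Eu d => volume (Y ∩ bx (x + v) S)) ∧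
    ∫⁻ x : Eu d, volume (Y ∩ bx (x + v) S) = ENNReal.ofReal (S^d) * volume Y := by
  obtain ⟨h1, h2⟩ := conv_int (Y.indicator 1) (measurable_one.indicator hY) (bx v S) (bx_meas v S)
  have : ∀ x : Eu d, volume (Y ∩ bx (x + v) S) = ∫⁻ y, Y.indicator 1 y * (bx v S).indicator 1 (y - x) := by
    intro x
    rw [← lintegral_indicator_one (hY.inter (bx_meas _ _))]
    refine lintegral_congr fun y => ?_
    rw [Set.inter_indicator_one]
    simp only [Pi.mul_apply]
    congr 1
    by_cases h : y ∈ bx (x + v) S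
    · rw [Set.indicator_of_mem h, Set.indicator_of_mem ((mem_bx_add v y x S).1 h)]; rfl
    · rw [Set.indicator_of_notMem h, Set.indicator_of_notMem (fun h' => h ((mem_bx_add v y x S).2 h'))]
  simp_rw [this]
  rw [lintegral_indicator_one hY, bx_vol _ _ hS] at h2
  exact ⟨h1, h2⟩

lemma lint_two {d : ℕ} (F : Eu d → ℝ≥0∞) (hF : Measurable F) : ∫⁻ y, F ((2:ℝ) • y) ≤ ∫⁻ y, F y := by
  have h := Measure.map_addHaar_smul (volume : Measure (Eu d)) (r := 2) (by norm_num)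
  have h2 : ∫⁻ y, F ((2:ℝ) • y) = ∫⁻ y, F y ∂(Measure.map ((2:ℝ) • ·) volume) :=
    (lintegral_map hF (measurable_const_smul _)).symm
  rw [h2, h, lintegral_smul_measure]
  refine mul_le_of_le_one_left (by positivity) ?_
  rw [ENNReal.ofReal_le_one, abs_of_pos (by positivity)]
  exact inv_le_one_of_one_le₀ (one_le_pow₀ (by norm_num))

lemma lint_nuG {d : ℕ} (F : Eu d → ℝ) (hF : Integrable F (nuG d)) (B : ℝ) (h : ∫ y, |F y| ∂(nuG d) ≤ B) :
    ∫⁻ y, ENNReal.ofReal |F y| ≤ ENNReal.ofReal (cn d * B) := by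
  have hc := cn_pos d
  have h1 : ∫⁻ y, ENNReal.ofReal |F y| ∂(nuG d) ≤ ENNReal.ofReal B := by
    rw [← ofReal_integral_eq_lintegral_ofReal hF.abs (Eventually.of_forall fun y => abs_nonneg _)]
    exact ENNReal.ofReal_le_ofReal h
  unfold nuG at h1
  rw [lintegral_smul_measure, smul_eq_mul] at h1
  calc ∫⁻ y, ENNReal.ofReal |F y| = ENNReal.ofReal (cn d) * (ENNReal.ofReal (cn d)⁻¹ * ∫⁻ y, ENNReal.ofReal |F y|) := by
        rw [← mul_assoc, ← ENNReal.ofReal_mul hc.le, mul_inv_cancel₀ hc.ne', ENNReal.ofReal_one, one_mul]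
    _ ≤ ENNReal.ofReal (cn d) * ENNReal.ofReal B := by gcongr
    _ = _ := (ENNReal.ofReal_mul hc.le).symm

lemma badset (n d : ℕ) (hn : 1 ≤ n) (hnd : n ≤ d) (K : Set (Eu d)) (hK : IsCompact K) (hKne : K.Nonempty)
    (m : ℝ) (hm : 0 < m) (hH : normHausdorff n d K = ENNReal.ofReal m) (hM : HasMinkowskiContent n d K m)
    (R' η τ : ℝ) (hη : 0 < η) (hτ : 0 < τ) :
    ∃ r0 > (0:ℝ), ∀ r ≥ r0, ∃ Bad : Set (Eu d), MeasurableSet Bad ∧ volume Bad ≤ ENNReal.ofReal (τ * r^n) ∧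
      ∀ x, x ∉ Bad → Metric.infDist x (r • K) ≤ R' →
      ∃ (z0 : Eu d) (f : Eu n →ₗᵢ[ℝ] Eu d) (g : Eu (d-n) →ₗᵢ[ℝ] Eu d), IsFrame f g ∧
      ∀ a b, dist (z0 + f a + g b) x ≤ R' → |Metric.infDist (z0 + f a + g b) (r • K) - ‖b‖| ≤ η := by
  have hcn := cn_pos n
  have hcd := cn_pos d
  obtain ⟨j, θ, hj, hθ, hwin⟩ := window n d (cn n * Real.sqrt 2 ^ n) R' η (by positivity) hη
  set vb := (volume (Metric.ball (0 : Eu d) j)).toReal with hvb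
  have hvbe : volume (Metric.ball (0 : Eu d) j) = ENNReal.ofReal vb :=
    (ENNReal.ofReal_toReal measure_ball_lt_top.ne).symm
  have hvb0 : 0 < vb := ENNReal.toReal_pos (Metric.measure_ball_pos volume _ hj).ne' measure_ball_lt_top.ne
  obtain ⟨r0, hr0, hL⟩ := L1close n d hn hnd K hK hKne m hm hH hM (τ * θ / (2 * cn d * vb)) (by positivity)
  refine ⟨r0, hr0, fun r hr => ?_⟩
  have hrp : 0 < r := lt_of_lt_of_le hr0 hr
  obtain ⟨ι, inst, q, x, hq, hC0, ht⟩ := hL r hr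
  set F : ℝ → Eu d → ℝ := fun t y => cn n * Real.exp (-Metric.infDist y ((t * r) • K)^2/2) - t^n * gW q (fun i => t • x i) y with hF
  have hgi : ∀ s : ι → Eu d, Integrable (gW q s) (nuG d) := fun s =>
    integrable_finsetSum _ (fun i _ => (int_ph (gaussNu d) (s i)).const_mul _)
  have hFc : ∀ t, Continuous (F t) := by
    intro t
    have h1 : Continuous (gW q (fun i => t • x i)) := by
      unfold gW ph
      refine continuous_finsetSum _ fun i _ => ?_
      fun_prop
    have h2 := Metric.continuous_infDist_pt ((t*r) • K)
    simp only [hF]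
    fun_prop
  have hFi : ∀ t : ℝ, t = 1 ∨ t = 2 → ∫⁻ y, ENNReal.ofReal |F t y| ≤ ENNReal.ofReal (cn d * (τ * θ / (2 * cn d * vb) * r^n)) :=
    fun t h => lint_nuG (F t) (((ht t h).1.const_mul _).sub ((hgi _).const_mul _)) _ (ht t h).2
  set H : Eu d → ℝ≥0∞ := fun y => ENNReal.ofReal (|F 1 y| + |F 2 ((2:ℝ) • y)|) with hH
  have hHm : Measurable H := by
    have h1 := hFc 1
    have h2 := hFc 2
    have : Continuous fun y => |F 1 y| + |F 2 ((2:ℝ) • y)| := by fun_prop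
    exact ENNReal.measurable_ofReal.comp this.measurable
  have hHi : ∫⁻ y, H y ≤ ENNReal.ofReal (τ * θ / vb * r^n) := by
    have : ∀ y, H y = ENNReal.ofReal |F 1 y| + ENNReal.ofReal |F 2 ((2:ℝ) • y)| := fun y =>
      ENNReal.ofReal_add (abs_nonneg _) (abs_nonneg _)
    simp_rw [this]
    have hm1 : Measurable fun y => ENNReal.ofReal |F 1 y| := ENNReal.measurable_ofReal.comp (hFc 1).abs.measurable
    rw [lintegral_add_left hm1]
    calc _ ≤ ENNReal.ofReal (cn d * (τ * θ / (2 * cn d * vb) * r^n)) + ENNReal.ofReal (cn d * (τ * θ / (2 * cn d * vb) * r^n)) := by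
          refine add_le_add (hFi 1 (Or.inl rfl)) ?_
          exact (lint_two (fun y => ENNReal.ofReal |F 2 y|) (ENNReal.measurable_ofReal.comp (hFc 2).abs.measurable)).trans (hFi 2 (Or.inr rfl))
      _ = _ := by
          rw [← ENNReal.ofReal_add (by positivity) (by positivity)]
          congr 1; field_simp; ring
  obtain ⟨hNm, hNi⟩ := conv_int H hHm (Metric.ball 0 j) measurableSet_ball
  set N : Eu d → ℝ≥0∞ := fun x => ∫⁻ y, H y * (Metric.ball (0 : Eu d) j).indicator 1 (y - x) with hN
  have hNeq : ∀ z, ∫⁻ y in Metric.ball z j, H y = N z := by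
    intro z
    rw [← lintegral_indicator measurableSet_ball]
    refine lintegral_congr fun y => ?_
    by_cases h : y ∈ Metric.ball z j
    · have h' : y - z ∈ Metric.ball (0 : Eu d) j := by rwa [mem_ball_zero_iff, ← dist_eq_norm]
      rw [Set.indicator_of_mem h, Set.indicator_of_mem h']; simp
    · have h' : y - z ∉ Metric.ball (0 : Eu d) j := by rwa [mem_ball_zero_iff, ← dist_eq_norm]
      rw [Set.indicator_of_notMem h, Set.indicator_of_notMem h']; simp
  refine ⟨{z | ENNReal.ofReal θ < N z}, measurableSet_lt measurable_const hNm, ?_, ?_⟩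
  · have h1 := mul_meas_ge_le_lintegral hNm (μ := volume) (ENNReal.ofReal θ)
    have h2 : ENNReal.ofReal θ * volume {z | ENNReal.ofReal θ < N z} ≤ ENNReal.ofReal θ * ENNReal.ofReal (τ * r^n) := by
      calc _ ≤ ENNReal.ofReal θ * volume {z | ENNReal.ofReal θ ≤ N z} := by
            gcongr with z; exact le_of_lt
        _ ≤ _ := h1
        _ = _ := hNi
        _ ≤ ENNReal.ofReal vb * ENNReal.ofReal (τ * θ / vb * r^n) := by rw [hvbe]; gcongr
        _ = _ := by
          rw [← ENNReal.ofReal_mul hvb0.le, ← ENNReal.ofReal_mul hθ.le]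
          congr 1; field_simp
    exact (ENNReal.mul_le_mul_iff_right (ENNReal.ofReal_pos.2 hθ).ne' ENNReal.ofReal_ne_top).1 h2
  · intro z hz hd
    have hKc : IsClosed (r • K) := (hK.smul r).isClosed
    refine hwin (r • K) hKc hKne.smul_set ι inst q x hq hC0 z ?_ hd
    rw [Set.mem_ofPred_eq, not_lt, ← hNeq] at hz
    refine le_of_eq_of_le ?_ hz
    refine lintegral_congr fun y => ?_
    simp only [hH, hF, one_mul, one_smul, one_pow, smul_smul]

end PBF
set_option autoImplicit false
set_option linter.unusedSectionVars false
namespace PBF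
open Finset MeasureTheory Bornology Filter
open scoped Pointwise ENNReal

variable (A : PackingBoundFunction)

/-- volume of the unit ball in codimension -/
noncomputable def om (k : ℕ) : ℝ := (volume (Metric.ball (0 : Eu k) 1)).toReal

lemma om_pos (k : ℕ) : 0 < om k :=
  ENNReal.toReal_pos (Metric.measure_ball_pos volume _ one_pos).ne' measure_ball_lt_top.ne

lemma om_eq (k : ℕ) : volume (Metric.ball (0 : Eu k) 1) = ENNReal.ofReal (om k) :=
  (ENNReal.ofReal_toReal measure_ball_lt_top.ne).symm

lemma vol_limit (n d : ℕ) (hnd : n ≤ d) (K : Set (Eu d)) (m : ℝ) (hM : HasMinkowskiContent n d K m) (ρ : ℝ) (hρ : 0 < ρ) :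
    Tendsto (fun r : ℝ => (volume (Metric.thickening ρ (r • K))).toReal / (om (d-n) * r^n)) atTop (nhds (m * ρ^(d-n))) := by
  have h1 : Tendsto (fun r : ℝ => ρ / r) atTop (nhdsWithin 0 (Set.Ioi 0)) := by
    refine tendsto_nhdsWithin_iff.2 ⟨tendsto_const_nhds.div_atTop tendsto_id, ?_⟩
    filter_upwards [eventually_gt_atTop 0] with r hr
    exact div_pos hρ hr
  have h2 := (hM.comp h1).mul_const (ρ^(d-n))
  refine h2.congr' ?_
  filter_upwards [eventually_gt_atTop 0] with r hr
  simp only [Function.comp_apply]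
  have hb : volume (Metric.ball (0 : Eu (d-n)) (ρ / r)) = ENNReal.ofReal ((ρ/r)^(d-n)) * volume (Metric.ball (0 : Eu (d-n)) 1) := by
    have := vol_ball_scale (d-n) 0 1 (ρ/r) (by positivity) one_pos
    rwa [mul_one] at this
  have hdn : r^d = r^n * r^(d-n) := by rw [← pow_add, Nat.add_sub_cancel' hnd]
  have := om_pos (d-n)
  rw [thickening_smul _ _ _ hr, vol_smul _ _ hr, hb, om_eq, ENNReal.toReal_mul, ENNReal.toReal_mul,
    ENNReal.toReal_ofReal (by positivity), ENNReal.toReal_ofReal (by positivity), ENNReal.toReal_ofReal (by positivity), hdn, div_pow]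
  field_simp

lemma thick_fin {d : ℕ} (K : Set (Eu d)) (hK : IsBounded K) (ρ : ℝ) :
    volume (Metric.thickening ρ K) = ENNReal.ofReal (volume (Metric.thickening ρ K)).toReal :=
  (ENNReal.ofReal_toReal hK.thickening.measure_lt_top.ne).symm

lemma upper_real (n d : ℕ) (hn : 1 ≤ n) (hnd : n ≤ d) (K : Set (Eu d)) (hK : IsCompact K) (hKne : K.Nonempty)
    (m : ℝ) (hm : 0 < m) (hH : normHausdorff n d K = ENNReal.ofReal m) (hM : HasMinkowskiContent n d K m)
    (t σ : ℝ) (ht : 0 < t) (ht2 : t < 1/2) (hσ : 0 < σ) :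
    ∀ᶠ r : ℝ in atTop, A.toFun d (r • K) / r^n ≤ (pbfDensity A n + t) * (1+2*t)^n * (1+t)^d *
      ((volume (Metric.thickening (1+2*t) (r • K))).toReal / (om (d-n) * r^n)) + σ := by
  obtain ⟨s, hs, hwin⟩ := win_upper A (n := n) (d := d) hn t ht t ht ht2
  have hδ : 0 ≤ pbfDensity A n := dens_nonneg A hn
  set R := 2*s/t with hR
  have hRp : 0 < R := by positivity
  set CR := A.toFun d (cb d R) with hCR
  have hCR0 : 0 ≤ CR := cb_nonneg A d R
  set τ := σ * R^d / (CR + 1) with hτ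
  have hτp : 0 < τ := by positivity
  obtain ⟨r0, hr0, hbad⟩ := badset n d hn hnd K hK hKne m hm hH hM (R*d+s) t τ ht hτp
  have hw := om_pos (d-n)
  filter_upwards [eventually_ge_atTop r0] with r hr
  have hrp : 0 < r := lt_of_lt_of_le hr0 hr
  obtain ⟨Bad, hBm, hBv, hgood⟩ := hbad r hr
  have hXc : IsCompact (r • K) := hK.smul r
  set X := r • K with hX
  set κ := (pbfDensity A n + t) * (1+2*t)^n with hκ
  have hκ0 : 0 ≤ κ := by positivity
  set V := (volume (Metric.thickening (1+2*t) X)).toReal with hV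
  have hVe := thick_fin X hXc.isBounded (1+2*t)
  obtain ⟨c1, c2⟩ := vol_bx_conv (Metric.thickening (1+2*t) X) Metric.isOpen_thickening.measurableSet (-dg d s) (R+2*s) (by positivity)
  have hmain := master_upper A (hn.trans hnd) X hXc.isBounded hXc.isClosed.measurableSet R hRp
    (fun x => ENNReal.ofReal (κ / om (d-n)) * volume (Metric.thickening (1+2*t) X ∩ bx (x + -dg d s) (R+2*s)) +
      Bad.indicator (fun _ => ENNReal.ofReal CR) x)
    ((c1.const_mul _).add (measurable_const.indicator hBm)) (by
      intro x
      by_cases hx : x ∈ Bad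
      · rw [Set.indicator_of_mem hx]
        refine le_add_left (ENNReal.ofReal_le_ofReal ?_)
        exact A_box A _ (hXc.isClosed.measurableSet.inter (bx_meas _ _)) x R Set.inter_subset_right
      · refine le_add_right ?_
        by_cases hd : Metric.infDist x X ≤ R*d+s
        · have h1 := hwin s le_rfl R hRp (R*d+s) le_rfl X hXc.isClosed x (hgood x hx hd)
          rw [om_eq] at h1
          rw [← ENNReal.mul_le_mul_iff_right (ENNReal.ofReal_pos.2 hw).ne' ENNReal.ofReal_ne_top, ← mul_assoc,
            ← ENNReal.ofReal_mul (q := κ / om (d-n)) hw.le, mul_div_cancel₀ _ hw.ne', ← sub_eq_add_neg]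
          exact h1
        · have : X ∩ bx x R = ∅ := by
            rw [Set.eq_empty_iff_forall_notMem]
            rintro y ⟨hy, hyb⟩
            apply hd
            have h1 := Metric.infDist_le_dist_of_mem (x := x) hy
            have h2 := bx_dist hRp.le hyb
            rw [dist_comm] at h2
            linarith
          rw [this, A_empty]; simp)
  rw [lintegral_add_left (c1.const_mul _), lintegral_const_mul _ c1, c2, lintegral_indicator_const hBm, hVe] at hmain
  have h2 : ENNReal.ofReal (R^d * A.toFun d X) ≤ ENNReal.ofReal (κ / om (d-n) * ((R+2*s)^d * V) + CR * (τ * r^n)) := by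
    rw [ENNReal.ofReal_mul (by positivity), ENNReal.ofReal_add (by positivity) (by positivity), ENNReal.ofReal_mul (by positivity),
      ENNReal.ofReal_mul (p := (R+2*s)^d) (by positivity), ENNReal.ofReal_mul hCR0]
    refine hmain.trans ?_
    gcongr
  rw [ENNReal.ofReal_le_ofReal_iff (by positivity)] at h2
  have e1 : (R + 2*s)^d = R^d * (1+t)^d := by
    rw [← mul_pow]; congr 1; rw [hR]; field_simp
  have e2 : CR * (τ * r^n) ≤ R^d * (σ * r^n) := by
    have : CR * τ ≤ R^d * σ := by
      rw [hτ, ← mul_div_assoc, div_le_iff₀ (by positivity)]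
      have : 0 ≤ σ * R^d := by positivity
      nlinarith
    have := mul_le_mul_of_nonneg_right this (pow_pos hrp n).le
    linarith
  rw [div_le_iff₀ (by positivity)]
  have hRd : 0 < R^d := by positivity
  refine le_of_mul_le_mul_left (h2.trans ((add_le_add_right e2 _).trans (le_of_eq ?_))) hRd
  rw [e1]
  field_simp

lemma lower_real (n d : ℕ) (hn : 1 ≤ n) (hnd : n ≤ d) (K : Set (Eu d)) (hK : IsCompact K) (hKne : K.Nonempty)
    (m : ℝ) (hm : 0 < m) (hH : normHausdorff n d K = ENNReal.ofReal m) (hM : HasMinkowskiContent n d K m)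
    (t σ : ℝ) (ht : 0 < t) (ht2 : t < 1/2) (hσ : 0 < σ) :
    ∀ᶠ r : ℝ in atTop, (pbfDensity A n * (1 - t)) * (1/(1+2*t))^n * (1-t)^d *
      ((volume (Metric.thickening (1-2*t) (r • K))).toReal / (om (d-n) * r^n)) ≤ A.toFun d (r • K) / r^n + σ := by
  obtain ⟨s, hs, hwin⟩ := win_lower A (n := n) (d := d) hn t ht t ht ht2
  have hδ : 0 ≤ pbfDensity A n := dens_nonneg A hn
  have h1t : 0 ≤ 1 - t := by linarith
  set R := (2+2*s)/t with hR
  have hRp : 0 < R := by positivity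
  have hR2 : R > 2 + 2*s := by
    rw [hR, gt_iff_lt, lt_div_iff₀ ht]; nlinarith
  have hw := om_pos (d-n)
  set κ := (pbfDensity A n * (1 - t)) * (1/(1+2*t))^n with hκ
  have hκ0 : 0 ≤ κ := by positivity
  set τ := σ * om (d-n) / (κ + 1) with hτ
  have hτp : 0 < τ := by positivity
  obtain ⟨r0, hr0, hbad⟩ := badset n d hn hnd K hK hKne m hm hH hM (R*d+s) t τ ht hτp
  filter_upwards [eventually_ge_atTop r0] with r hr
  have hrp : 0 < r := lt_of_lt_of_le hr0 hr
  obtain ⟨Bad, hBm, hBv, hgood⟩ := hbad r hr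
  have hXc : IsCompact (r • K) := hK.smul r
  have hXne : (r • K).Nonempty := hKne.smul_set
  set X := r • K with hX
  have hA0 : 0 ≤ A.toFun d X := A.nonneg d X hXc.isBounded hXc.isClosed.measurableSet
  set V := (volume (Metric.thickening (1-2*t) X)).toReal with hV
  have hVe := thick_fin X hXc.isBounded (1-2*t)
  have hS : 0 ≤ R - 2 - 2*s := by linarith
  obtain ⟨c1, c2⟩ := vol_bx_conv (Metric.thickening (1-2*t) X) Metric.isOpen_thickening.measurableSet (dg d s) (R-2-2*s) hS
  set Q : Eu d → ℝ≥0∞ := fun x => ENNReal.ofReal (κ / om (d-n)) * volume (Metric.thickening (1-2*t) X ∩ bx (x + dg d s) (R-2-2*s)) with hQ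
  have hQm : Measurable Q := c1.const_mul _
  have hmain := master_lower A X hXc.isBounded hXc.isClosed.measurableSet R hRp
    (Badᶜ.indicator Q) (hQm.indicator hBm.compl) (by
      intro x
      by_cases hx : x ∈ Bad
      · rw [Set.indicator_of_notMem (by simpa using hx)]; exact bot_le
      · rw [Set.indicator_of_mem (by simpa using hx)]
        by_cases hd : Metric.infDist x X ≤ R*d+s
        · have h1 := hwin s le_rfl R hR2 (R*d+s) le_rfl X hXc.isClosed hXne x (hgood x hx hd)
          rw [om_eq, ← mul_assoc, ← ENNReal.ofReal_mul (by positivity)] at h1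
          rw [← ENNReal.mul_le_mul_iff_right (ENNReal.ofReal_pos.2 hw).ne' ENNReal.ofReal_ne_top, hQ]
          simp only
          rw [← mul_assoc, ← ENNReal.ofReal_mul (q := κ / om (d-n)) hw.le, mul_div_cancel₀ _ hw.ne']
          exact h1
        · have : Metric.thickening (1-2*t) X ∩ bx (x + dg d s) (R-2-2*s) = ∅ := by
            rw [Set.eq_empty_iff_forall_notMem]
            rintro y ⟨hy, hyb⟩
            apply hd
            have hyb' : y ∈ bx x (R-2) := bx_shrink (s := s) hyb (by simpa using hs)
            have h1 := (Metric.mem_thickening_iff_infDist_lt hXne).1 hy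
            have h2 := bx_dist (by linarith) hyb'
            rw [dist_comm] at h2
            have h3 := Metric.infDist_le_infDist_add_dist (s := X) (x := x) (y := y)
            have : (1:ℝ) ≤ d := by exact_mod_cast hn.trans hnd
            linarith
          simp only [hQ]
          rw [this]; simp)
  have hsplit : ∫⁻ x, Q x ≤ (∫⁻ x, Badᶜ.indicator Q x) + ENNReal.ofReal (κ / om (d-n) * R^d) * volume Bad := by
    rw [← lintegral_indicator_const hBm, ← lintegral_add_left (hQm.indicator hBm.compl)]
    refine lintegral_mono fun x => ?_
    by_cases hx : x ∈ Bad
    · simp only [Set.indicator_of_mem hx]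
      refine le_add_left ?_
      rw [ENNReal.ofReal_mul (by positivity), hQ]
      simp only
      gcongr
      refine (measure_mono Set.inter_subset_right).trans ?_
      rw [bx_vol _ _ hS]
      apply ENNReal.ofReal_le_ofReal
      gcongr
      linarith
    · rw [Set.indicator_of_mem (by simpa using hx)]
      exact le_self_add
  have hQi : ∫⁻ x, Q x = ENNReal.ofReal (κ / om (d-n)) * (ENNReal.ofReal ((R-2-2*s)^d) * ENNReal.ofReal V) := by
    rw [hQ, lintegral_const_mul _ c1, c2, hVe]
  have h2 : ENNReal.ofReal (κ / om (d-n) * ((R-2-2*s)^d * V)) ≤ ENNReal.ofReal (R^d * A.toFun d X + κ / om (d-n) * R^d * (τ * r^n)) := by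
    rw [ENNReal.ofReal_mul (by positivity), ENNReal.ofReal_mul (by positivity), ← hQi, ENNReal.ofReal_add (by positivity) (by positivity),
      ENNReal.ofReal_mul (by positivity), ENNReal.ofReal_mul (p := κ / om (d-n) * R^d) (by positivity)]
    refine hsplit.trans ?_
    gcongr
  rw [ENNReal.ofReal_le_ofReal_iff (by positivity)] at h2
  have e1 : (R - 2 - 2*s)^d = R^d * (1-t)^d := by
    rw [← mul_pow]; congr 1; rw [hR]; field_simp; ring
  have e2 : κ / om (d-n) * R^d * (τ * r^n) ≤ R^d * (σ * r^n) := by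
    have : κ / om (d-n) * τ ≤ σ := by
      rw [hτ]
      have : κ / om (d-n) * (σ * om (d-n) / (κ+1)) = σ * (κ / (κ+1)) := by field_simp
      rw [this]
      refine mul_le_of_le_one_right hσ.le ?_
      rw [div_le_one (by positivity)]; linarith
    have := mul_le_mul_of_nonneg_left this (mul_pos (pow_pos hRp d) (pow_pos hrp n)).le
    linarith
  have hRd : 0 < R^d := by positivity
  have h3 := h2.trans (add_le_add_right e2 _)
  rw [e1] at h3
  have h4 : κ * (1-t)^d * (V / om (d-n)) ≤ A.toFun d X + σ * r^n := by
    refine le_of_mul_le_mul_left (le_trans (le_of_eq ?_) (h3.trans (le_of_eq ?_))) hRd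
    · field_simp
    · ring
  have hrn : 0 < r^n := by positivity
  calc _ = (κ * (1-t)^d * (V / om (d-n))) / r^n := by field_simp
    _ ≤ (A.toFun d X + σ * r^n) / r^n := by gcongr
    _ = _ := by field_simp

end PBF
set_option autoImplicit false
set_option linter.unusedSectionVars false
namespace PBF
open Finset MeasureTheory Bornology Filter
open scoped Pointwise ENNReal

variable (A : PackingBoundFunction)

lemma lim_zero (n d : ℕ) (hn : 1 ≤ n) (hnd : n ≤ d) (K : Set (Eu d)) (hK : IsCompact K) (hM : HasMinkowskiContent n d K 0) :
    Tendsto (fun r : ℝ => A.toFun d (r • K) / r^n) atTop (nhds 0) := by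
  have hw := om_pos (d-n)
  have hC := cb_nonneg A d 1
  have h1 := (vol_limit n d hnd K 0 hM (d+1) (by positivity)).const_mul (A.toFun d (cb d 1) * om (d-n))
  rw [zero_mul, mul_zero] at h1
  refine tendsto_of_tendsto_of_tendsto_of_le_of_le' tendsto_const_nhds h1 ?_ ?_
  · filter_upwards [eventually_gt_atTop 0] with r hr
    have hXc : IsCompact (r • K) := hK.smul r
    exact div_nonneg (A.nonneg d _ hXc.isBounded hXc.isClosed.measurableSet) (by positivity)
  · filter_upwards [eventually_gt_atTop 0] with r hr
    have hXc : IsCompact (r • K) := hK.smul r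
    have hT : MeasurableSet (Metric.thickening ((d:ℝ)+1) (r • K)) := Metric.isOpen_thickening.measurableSet
    have hmain := master_upper A (hn.trans hnd) (r • K) hXc.isBounded hXc.isClosed.measurableSet 1 one_pos
      ((Metric.thickening ((d:ℝ)+1) (r • K)).indicator fun _ => ENNReal.ofReal (A.toFun d (cb d 1)))
      (measurable_const.indicator hT) (by
        intro x
        by_cases hx : x ∈ Metric.thickening ((d:ℝ)+1) (r • K)
        · rw [Set.indicator_of_mem hx]
          apply ENNReal.ofReal_le_ofReal
          exact A_box A _ (hXc.isClosed.measurableSet.inter (bx_meas _ _)) x 1 Set.inter_subset_right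
        · have : (r • K) ∩ bx x 1 = ∅ := by
            rw [Set.eq_empty_iff_forall_notMem]
            rintro y ⟨hy, hyb⟩
            apply hx
            have h2 := bx_dist zero_le_one hyb
            rw [dist_comm] at h2
            exact Metric.mem_thickening_iff.2 ⟨y, hy, by linarith⟩
          rw [this, A_empty]; simp)
    rw [lintegral_indicator_const hT, one_pow, ENNReal.ofReal_one, one_mul, thick_fin _ hXc.isBounded, ← ENNReal.ofReal_mul hC,
      ENNReal.ofReal_le_ofReal_iff (by positivity)] at hmain
    rw [div_le_iff₀ (by positivity)]
    refine hmain.trans (le_of_eq ?_)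
    field_simp

lemma lim_compact (n d : ℕ) (hn : 1 ≤ n) (hnd : n ≤ d) (K : Set (Eu d)) (hK : IsCompact K) (m : ℝ) (hm : 0 ≤ m)
    (hH : normHausdorff n d K = ENNReal.ofReal m) (hM : HasMinkowskiContent n d K m) :
    Tendsto (fun r : ℝ => A.toFun d (r • K) / r^n) atTop (nhds (pbfDensity A n * m)) := by
  rcases hm.eq_or_lt with rfl | hm
  · rw [mul_zero]; exact lim_zero A n d hn hnd K hK hM
  have hKne : K.Nonempty := by
    rw [Set.nonempty_iff_ne_empty]
    rintro rfl
    rw [measure_empty] at hH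
    exact (ENNReal.ofReal_pos.2 hm).ne hH
  have hsmall : ∀ᶠ t : ℝ in nhdsWithin 0 (Set.Ioi 0), 0 < t ∧ t < 1/2 := by
    have : Set.Ioo (0:ℝ) (1/2) ∈ nhdsWithin 0 (Set.Ioi 0) := Ioo_mem_nhdsGT (by norm_num)
    filter_upwards [this] with t ht using ht
  rw [tendsto_order]
  constructor
  · intro a ha
    have hc : ContinuousAt (fun t : ℝ => (pbfDensity A n * (1 - t)) * (1/(1+2*t))^n * (1-t)^d * (m * (1-2*t)^(d-n))) 0 := by
      have : ContinuousAt (fun t : ℝ => 1/(1+2*t)) 0 := by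
        refine ContinuousAt.div (by fun_prop) (by fun_prop) (by norm_num)
      fun_prop
    have h1 : ∀ᶠ t : ℝ in nhdsWithin 0 (Set.Ioi 0), a < (pbfDensity A n * (1 - t)) * (1/(1+2*t))^n * (1-t)^d * (m * (1-2*t)^(d-n)) := by
      refine (hc.tendsto.mono_left nhdsWithin_le_nhds).eventually_const_lt ?_
      simpa using ha
    obtain ⟨t, ht1, ht, ht2⟩ := (h1.and hsmall).exists
    have h2 := (vol_limit n d hnd K m hM (1-2*t) (by linarith)).const_mul ((pbfDensity A n * (1 - t)) * (1/(1+2*t))^n * (1-t)^d)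
    set U := (pbfDensity A n * (1 - t)) * (1/(1+2*t))^n * (1-t)^d * (m * (1-2*t)^(d-n)) with hU
    have h3 := h2.eventually_const_lt (show U - (U-a)/2 < U by linarith)
    filter_upwards [h3, lower_real A n d hn hnd K hK hKne m hm hH hM t ((U-a)/2) ht ht2 (by linarith)] with r hr1 hr2
    linarith
  · intro a ha
    have hc : ContinuousAt (fun t : ℝ => (pbfDensity A n + t) * (1+2*t)^n * (1+t)^d * (m * (1+2*t)^(d-n))) 0 := by
      fun_prop
    have h1 : ∀ᶠ t : ℝ in nhdsWithin 0 (Set.Ioi 0), (pbfDensity A n + t) * (1+2*t)^n * (1+t)^d * (m * (1+2*t)^(d-n)) < a := by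
      refine (hc.tendsto.mono_left nhdsWithin_le_nhds).eventually_lt_const ?_
      simpa using ha
    obtain ⟨t, ht1, ht, ht2⟩ := (h1.and hsmall).exists
    have h2 := (vol_limit n d hnd K m hM (1+2*t) (by linarith)).const_mul ((pbfDensity A n + t) * (1+2*t)^n * (1+t)^d)
    set U := (pbfDensity A n + t) * (1+2*t)^n * (1+t)^d * (m * (1+2*t)^(d-n)) with hU
    have h3 := h2.eventually_lt_const (show U < U + (a-U)/2 by linarith)
    filter_upwards [h3, upper_real A n d hn hnd K hK hKne m hm hH hM t ((a-U)/2) ht ht2 (by linarith)] with r hr1 hr2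
    linarith

lemma lim_set (n d : ℕ) (C : Set (Eu d)) (hCb : IsBounded C) (hCm : MeasurableSet C) (L : ℝ)
    (h : Tendsto (fun r : ℝ => A.toFun d (r • closure C) / r^n) atTop (nhds L)) :
    Tendsto (fun r : ℝ => A.toFun d (r • C) / r^n) atTop (nhds L) := by
  rw [tendsto_order]
  constructor
  · intro a ha
    have hc : ContinuousAt (fun t : ℝ => L * (1/(1+t))^n) 0 := by
      have : ContinuousAt (fun t : ℝ => 1/(1+t)) 0 := by
        refine ContinuousAt.div (by fun_prop) (by fun_prop) (by norm_num)
      fun_prop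
    have h1 : ∀ᶠ t : ℝ in nhdsWithin 0 (Set.Ioi 0), a < L * (1/(1+t))^n := by
      refine (hc.tendsto.mono_left nhdsWithin_le_nhds).eventually_const_lt ?_
      simpa using ha
    obtain ⟨t, ht1, ht⟩ := (h1.and eventually_mem_nhdsWithin).exists
    have ht : 0 < t := ht
    have h2 : Tendsto (fun r : ℝ => (1/(1+t)) * r) atTop atTop := tendsto_id.const_mul_atTop (by positivity)
    have h3 := ((h.comp h2).mul_const ((1/(1+t))^n)).eventually_const_lt ht1
    filter_upwards [h3, eventually_gt_atTop 0] with r hr hr0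
    refine hr.trans_le ?_
    have hKb := hCb.closure
    have hKm : MeasurableSet (closure C) := isClosed_closure.measurableSet
    have hmesh := A.mesh t ht d (r • closure C) (r • C) (hKb.smul₀ r) (hKm.const_smul₀ r) (hCb.smul₀ r) (hCm.const_smul₀ r) (by
      rw [thickening_smul _ _ _ hr0]
      exact Set.smul_set_mono (Metric.closure_subset_thickening (by positivity) _))
    rw [smul_smul] at hmesh
    simp only [Function.comp_apply]
    calc _ = A.toFun d ((1/(1+t) * r) • closure C) / r^n := by rw [mul_pow]; field_simp
      _ ≤ _ := by gcongr
  · intro a ha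
    filter_upwards [h.eventually_lt_const ha, eventually_gt_atTop 0] with r hr hr0
    refine lt_of_le_of_lt ?_ hr
    have := A_mono A (hCb.closure.smul₀ r) (hCm.const_smul₀ r) ((isClosed_closure.measurableSet : MeasurableSet (closure C)).const_smul₀ r)
      (Set.smul_set_mono (a := r) (subset_closure (s := C)))
    gcongr

end PBF

/-- Let `A` be a packing bound function, `1 ≤ n ≤ d`, and let `C ⊆ ℝ^d`
be an `(H_n, n)`-rectifiable set whose Minkowski content `m = M_n(C)` exists and equals
`H_n(closure C) < ∞`. Then `A(rC)/r^n → δ_{A,n} · M_n(C)` as `r → ∞`. -/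
theorem packingBoundFunction_rectifiable_limit (A : PackingBoundFunction) (n d : ℕ)
    (hn : 1 ≤ n) (hnd : n ≤ d)
    (C : Set (EuclideanSpace ℝ (Fin d))) (hCb : IsBounded C) (hCm : MeasurableSet C)
    (hrect : ∃ (ψ : ℕ → EuclideanSpace ℝ (Fin n) → EuclideanSpace ℝ (Fin d))
      (K : ℕ → NNReal) (E : ℕ → Set (EuclideanSpace ℝ (Fin n))),
      (∀ i, LipschitzWith (K i) (ψ i)) ∧ (∀ i, IsBounded (E i)) ∧
      (∀ i, MeasurableSet (E i)) ∧
      normHausdorff n d (C \ ⋃ i, ψ i '' E i) = 0)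
    (m : ℝ) (hmink : HasMinkowskiContent n d C m)
    (hfin : normHausdorff n d (closure C) ≠ ⊤)
    (heq : m = (normHausdorff n d (closure C)).toReal) :
    Filter.Tendsto (fun r : ℝ => A.toFun d (r • C) / r ^ n) Filter.atTop
      (nhds (pbfDensity A n * m)) := by
  have hK : IsCompact (closure C) := hCb.isCompact_closure
  refine PBF.lim_set A n d C hCb hCm _ (PBF.lim_compact A n d hn hnd (closure C) hK m ?_ ?_ ?_)
  · rw [heq]; exact ENNReal.toReal_nonneg
  · rw [heq, ENNReal.ofReal_toReal hfin]
  · unfold HasMinkowskiContent at hmink ⊢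
    simpa only [Metric.thickening_closure] using hmink
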